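/- Let p be a prime and let G be a finite p-solvable group. Let φ ∈ IBr(G) have vertex subgroup Q, and suppose M is a normal subgroup of G. Then there is some irreducible constituent θ of the restriction φ_M that has vertex Q ∩ M. -/

import Mathlib

open scoped Classical

noncomputable section

/-- All prime divisors of `n` belong to the set of primes `σ`. -/
def IsPiNumber (σ : Set ℕ) (n : ℕ) : Prop :=
  ∀ q : ℕ, q.Prime → q ∣ n → q ∈ σ

/-- `g` is a `σ`-element: its order is a `σ`-number. -/
def IsPiElt (σ : Set ℕ) {G : Type} [Group G] (g : G) : Prop :=
  IsPiNumber σ (orderOf g)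

/-- The `p`-part of a natural number. -/
def pPart (p n : ℕ) : ℕ := p ^ (n.factorization p)

/-- `χ` is the character of a finite-dimensional complex representation of `G`. -/
def IsCharacter (G : Type) [Group G] (χ : G → ℂ) : Prop :=
  ∃ V : FDRep ℂ G, ∀ g, χ g = V.character g

/-- `χ` is an irreducible (ordinary, complex) character of `G`: a nonzero character
which is not the sum of two nonzero characters. -/
def IsIrrChar (G : Type) [Group G] (χ : G → ℂ) : Prop :=
  IsCharacter G χ ∧ χ ≠ 0 ∧
    ¬ ∃ χ₁ χ₂ : G → ℂ, IsCharacter G χ₁ ∧ χ₁ ≠ 0 ∧ IsCharacter G χ₂ ∧ χ₂ ≠ 0 ∧ χ = χ₁ + χ₂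

/-- Restriction of a class function on `G` to a subgroup `H`. -/
def resChar {G : Type} [Group G] (H : Subgroup G) (χ : G → ℂ) : ↥H → ℂ :=
  fun h => χ (h : G)

/-- Restriction of a class function between nested subgroups. -/
def resCharLe {G : Type} [Group G] {K H : Subgroup G} (hKH : K ≤ H) (χ : ↥H → ℂ) : ↥K → ℂ :=
  fun k => χ ⟨(k : G), hKH k.2⟩

/-- The induced class function from a subgroup `H` of `G`, given by the usual
induction formula. -/
def indChar {G : Type} [Group G] [Fintype G] (H : Subgroup G) (ψ : ↥H → ℂ) : G → ℂ :=
  fun g => (Nat.card ↥H : ℂ)⁻¹ *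
    ∑ x : G, if h : x * g * x⁻¹ ∈ H then ψ ⟨x * g * x⁻¹, h⟩ else 0

/-- Induction of a class function between nested subgroups. -/
def indCharLe {G : Type} [Group G] [Fintype G] {K H : Subgroup G} (_ : K ≤ H)
    (ψ : ↥K → ℂ) : ↥H → ℂ :=
  fun x => (Nat.card ↥K : ℂ)⁻¹ *
    ∑ y : ↥H, if h : (y : G) * (x : G) * (y : G)⁻¹ ∈ K then ψ ⟨(y : G) * (x : G) * (y : G)⁻¹, h⟩ else 0

/-- `θ` is an irreducible constituent of the class function `χ`. -/
def IsConstituent {G : Type} [Group G] (θ χ : G → ℂ) : Prop :=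
  IsIrrChar G θ ∧ ∃ ξ : G → ℂ, (ξ = 0 ∨ IsCharacter G ξ) ∧ χ = θ + ξ

/-- The restriction `χ^o` of a class function to the `σ`-elements of `G`
(extended by zero elsewhere). -/
def piRestrict (σ : Set ℕ) {G : Type} [Group G] (χ : G → ℂ) : G → ℂ :=
  fun g => if IsPiElt σ g then χ g else 0

/-- `φ` is a `σ`-partial character of `G`: the restriction to the `σ`-elements of an
ordinary character. -/
def IsPartialChar (σ : Set ℕ) (G : Type) [Group G] (φ : G → ℂ) : Prop :=
  ∃ χ : G → ℂ, IsCharacter G χ ∧ χ ≠ 0 ∧ φ = piRestrict σ χ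

/-- `φ ∈ I_σ(G)`: an irreducible `σ`-partial character, i.e. one which is not the
sum of two `σ`-partial characters. -/
def IsIPiChar (σ : Set ℕ) (G : Type) [Group G] (φ : G → ℂ) : Prop :=
  IsPartialChar σ G φ ∧
    ¬ ∃ φ₁ φ₂ : G → ℂ, IsPartialChar σ G φ₁ ∧ IsPartialChar σ G φ₂ ∧ φ = φ₁ + φ₂

/-- `φ ∈ IBr(G)` (at the prime `p`): irreducible Brauer characters are the irreducible
`p'`-partial characters, where the `p`-regular elements are the `{p}ᶜ`-elements. -/
def IsIBrChar (p : ℕ) (G : Type) [Group G] (φ : G → ℂ) : Prop :=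
  IsIPiChar ({p}ᶜ) G φ

/-- The restriction `χ^o` of `χ` to the `p`-regular elements of `G`. -/
def brRestrict (p : ℕ) {G : Type} [Group G] (χ : G → ℂ) : G → ℂ :=
  piRestrict ({p}ᶜ) χ

/-- `χ` is a lift of the `σ`-partial character `φ`. -/
def IsLiftOfPi (σ : Set ℕ) (G : Type) [Group G] (χ φ : G → ℂ) : Prop :=
  IsIrrChar G χ ∧ piRestrict σ χ = φ

/-- `χ` is a lift: `χ` is irreducible and `χ^o` is an irreducible `σ`-partial character. -/
def IsLiftPi (σ : Set ℕ) (G : Type) [Group G] (χ : G → ℂ) : Prop :=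
  IsIrrChar G χ ∧ IsIPiChar σ G (piRestrict σ χ)

/-- `H` is a subnormal subgroup of `G`. -/
def IsSubnormalSubgroup {G : Type} [Group G] (H : Subgroup G) : Prop :=
  ∃ (n : ℕ) (c : Fin (n + 1) → Subgroup G),
    c 0 = H ∧ c (Fin.last n) = ⊤ ∧
    ∀ i : Fin n, c i.castSucc ≤ c i.succ ∧ ((c i.castSucc).subgroupOf (c i.succ)).Normal

/-- The determinantal order `o(det θ)` of `θ` is a `σ`-number. -/
def HasPiDetOrder (σ : Set ℕ) (G : Type) [Group G] (θ : G → ℂ) : Prop :=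
  ∃ V : FDRep ℂ G, (∀ g, θ g = V.character g) ∧
    IsPiNumber σ (orderOf (fun g : G => LinearMap.det (V.ρ g)))

/-- `χ` is a `σ`-special character of `G`: `χ` is irreducible, `χ(1)` is a `σ`-number,
and for every subnormal subgroup `M` of `G`, every irreducible constituent of `χ_M`
has determinantal order a `σ`-number. -/
def IsPiSpecial (σ : Set ℕ) (G : Type) [Group G] (χ : G → ℂ) : Prop :=
  IsIrrChar G χ ∧ (∃ n : ℕ, χ 1 = (n : ℂ) ∧ IsPiNumber σ n) ∧
    ∀ M : Subgroup G, IsSubnormalSubgroup M →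
      ∀ θ : ↥M → ℂ, IsConstituent θ (resChar M χ) → HasPiDetOrder σ ↥M θ

/-- `χ` is `σ`-factored: `χ = αβ` with `α` `σ`-special and `β` `σ'`-special. -/
def IsPiFactored (σ : Set ℕ) (G : Type) [Group G] (χ : G → ℂ) : Prop :=
  ∃ α β : G → ℂ, IsPiSpecial σ G α ∧ IsPiSpecial σᶜ G β ∧ χ = α * β

/-- `G` is `σ`-separable: it has a subnormal series each of whose factors is a
`σ`-group or a `σ'`-group (equivalently, every composition factor is a `σ`-group or a
`σ'`-group). -/
def IsPiSeparable (σ : Set ℕ) (G : Type) [Group G] : Prop :=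
  ∃ (n : ℕ) (c : Fin (n + 1) → Subgroup G),
    c 0 = ⊥ ∧ c (Fin.last n) = ⊤ ∧
    ∀ i : Fin n, c i.castSucc ≤ c i.succ ∧ ((c i.castSucc).subgroupOf (c i.succ)).Normal ∧
      (IsPiNumber σ (Nat.card (↥(c i.succ) ⧸ (c i.castSucc).subgroupOf (c i.succ))) ∨
        IsPiNumber σᶜ (Nat.card (↥(c i.succ) ⧸ (c i.castSucc).subgroupOf (c i.succ))))

/-- `G` is `p`-solvable: every composition factor is a `p`-group or a `p'`-group. -/
def IsPSolvable (p : ℕ) (G : Type) [Group G] : Prop :=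
  IsPiSeparable {p} G

/-- The character `δ` of the subgroup `Q` is invariant under (conjugation by the
elements of) the subgroup `S`. -/
def InvariantUnder {G : Type} [Group G] (Q : Subgroup G) (δ : ↥Q → ℂ) (S : Subgroup G) : Prop :=
  ∀ g ∈ S, ∀ x : ↥Q, ∀ h : g * (x : G) * g⁻¹ ∈ Q, δ ⟨g * (x : G) * g⁻¹, h⟩ = δ x

/-- `(Q, δ)` is a vertex pair for `χ ∈ Irr(G)` (at the prime `p`): `Q` is a `p`-subgroup
of `G`, `δ ∈ Irr(Q)`, and there are a subgroup `U ≤ G` and an irreducible character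
`ψ = αβ` of `U` with `α` `p'`-special and `β` `p`-special, such that `ψ^G = χ`, `Q` is a
Sylow `p`-subgroup of `U`, and `β_Q = δ`. -/
def IsVertexPair (p : ℕ) {G : Type} [Group G] [Fintype G] (χ : G → ℂ)
    (Q : Subgroup G) (δ : ↥Q → ℂ) : Prop :=
  IsPGroup p ↥Q ∧ IsIrrChar ↥Q δ ∧
    ∃ (U : Subgroup G) (hQU : Q ≤ U) (α β : ↥U → ℂ),
      IsPiSpecial ({p}ᶜ) ↥U α ∧ IsPiSpecial {p} ↥U β ∧
      IsIrrChar ↥U (α * β) ∧ indChar U (α * β) = χ ∧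
      ¬ p ∣ (Q.subgroupOf U).index ∧
      ∀ x : ↥Q, δ x = β ⟨(x : G), hQU x.2⟩

/-- `(Q, δ)` is a generalized `σ`-vertex for `χ ∈ Irr(G)`: there are `U ≤ G` and an
irreducible `ψ = αβ ∈ Irr(U)` with `α` `σ`-special and `β` `σ'`-special such that
`ψ^G = χ`, `Q` is a Hall `σ'`-subgroup of `U` and `δ = β_Q`. -/
def IsGenPiVertex (σ : Set ℕ) {G : Type} [Group G] [Fintype G] (χ : G → ℂ)
    (Q : Subgroup G) (δ : ↥Q → ℂ) : Prop :=
  ∃ (U : Subgroup G) (hQU : Q ≤ U) (α β : ↥U → ℂ),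
    IsPiSpecial σ ↥U α ∧ IsPiSpecial σᶜ ↥U β ∧
    IsIrrChar ↥U (α * β) ∧ indChar U (α * β) = χ ∧
    IsPiNumber σᶜ (Nat.card ↥Q) ∧ IsPiNumber σ ((Q.subgroupOf U).index) ∧
    ∀ x : ↥Q, δ x = β ⟨(x : G), hQU x.2⟩

/-- The pair `(Q₂, δ₂)` is the conjugate of the pair `(Q₁, δ₁)` by the element `g`. -/
def IsConjPair {G : Type} [Group G] (g : G)
    (Q₁ : Subgroup G) (δ₁ : ↥Q₁ → ℂ) (Q₂ : Subgroup G) (δ₂ : ↥Q₂ → ℂ) : Prop :=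
  Q₂ = Subgroup.map (MulAut.conj g).toMonoidHom Q₁ ∧
    ∀ x : ↥Q₁, ∀ h : g * (x : G) * g⁻¹ ∈ Q₂, δ₂ ⟨g * (x : G) * g⁻¹, h⟩ = δ₁ x

/-- `Q` is a vertex (subgroup) of the irreducible `σ`-partial character `φ` of `G`:
`Q` is a Hall `σ'`-subgroup of a subgroup `U ≤ G` possessing an irreducible `σ`-partial
character `κ` of `σ`-degree with `κ^G = φ`. -/
def IsVertexSubgroup (σ : Set ℕ) {G : Type} [Group G] [Fintype G] (φ : G → ℂ)
    (Q : Subgroup G) : Prop :=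
  ∃ (U : Subgroup G) (κ : ↥U → ℂ), Q ≤ U ∧
    IsPiNumber σᶜ (Nat.card ↥Q) ∧ IsPiNumber σ ((Q.subgroupOf U).index) ∧
    IsIPiChar σ ↥U κ ∧ (∃ n : ℕ, κ 1 = (n : ℂ) ∧ IsPiNumber σ n) ∧
    indChar U κ = φ

/-- `θ ∈ I_σ(M)` is an irreducible constituent of the restriction `φ_M`. -/
def IsIPiConstituent (σ : Set ℕ) {G : Type} [Group G] (M : Subgroup G)
    (θ : ↥M → ℂ) (φ : G → ℂ) : Prop :=
  IsIPiChar σ ↥M θ ∧ ∃ ξ : ↥M → ℂ, (ξ = 0 ∨ IsPartialChar σ ↥M ξ) ∧ resChar M φ = θ + ξ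

section PSolvGroups

/-- Every element of `L` has a power in `N` whose exponent satisfies `E`. -/
def PowStep (E : ℕ → Prop) {H : Type} [Group H] (N L : Subgroup H) : Prop :=
  ∀ x ∈ L, ∃ q, E q ∧ x ^ q ∈ N

/-- The exponent is a power of `p`. -/
def EPow (p : ℕ) : ℕ → Prop := fun q => ∃ a, q = p ^ a

/-- The exponent is prime to `p`. -/
def EReg (p : ℕ) : ℕ → Prop := fun q => ¬ p ∣ q

/-- A quotient-free version of `p`-solvability inherited by subgroups. -/
def PSolv (p : ℕ) (G : Type) [Group G] : Prop :=
  ∀ (H : Type) [Group H] [Finite H] (i : H →* G), Function.Injective i →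
    ∀ N : Subgroup H, N.Normal → N ≠ ⊤ →
      ∃ L : Subgroup H, L.Normal ∧ N < L ∧ (PowStep (EPow p) N L ∨ PowStep (EReg p) N L)

variable {p : ℕ} {G G' : Type} [Group G] [Group G']

theorem PSolv.of_injective (h : PSolv p G) (f : G' →* G) (hf : Function.Injective f) :
    PSolv p G' := by
  intro H _ _ i hi
  exact h H (f.comp i) (hf.comp hi)

theorem PowStep.comap {E : ℕ → Prop} {N L : Subgroup G} (h : PowStep E N L) (f : G' →* G) :
    PowStep E (N.comap f) (L.comap f) := by
  intro x hx
  obtain ⟨q, hq, h1⟩ := h _ hx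
  exact ⟨q, hq, by simpa using h1⟩

theorem PowStep.map {E : ℕ → Prop} {N L : Subgroup G} (h : PowStep E N L) (f : G →* G') :
    PowStep E (N.map f) (L.map f) := by
  rintro _ ⟨x, hx, rfl⟩
  obtain ⟨q, hq, h1⟩ := h _ hx
  exact ⟨q, hq, x ^ q, h1, by simp⟩

theorem PSolv.of_surjective [Finite G] (h : PSolv p G) (f : G →* G') (hf : Function.Surjective f) :
    PSolv p G' := by
  intro H _ _ i hi N hN hNt
  let P : Subgroup (G × H) :=
    (f.comp (MonoidHom.fst G H)).eqLocus (i.comp (MonoidHom.snd G H))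
  let a : P →* G := (MonoidHom.fst G H).comp P.subtype
  let b : P →* H := (MonoidHom.snd G H).comp P.subtype
  have hP : ∀ x : P, f x.1.1 = i x.1.2 := fun x => x.2
  have ha : Function.Injective a := by
    intro x y hxy
    have h1 : x.1.1 = y.1.1 := hxy
    have h2 : x.1.2 = y.1.2 := by apply hi; rw [← hP, ← hP, h1]
    exact Subtype.ext (Prod.ext h1 h2)
  have hb : Function.Surjective b := by
    intro y
    obtain ⟨g, hg⟩ := hf (i y)
    exact ⟨⟨(g, y), hg⟩, rfl⟩
  have hNt' : N.comap b ≠ ⊤ := by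
    intro h
    apply hNt
    rw [eq_top_iff]
    intro y _
    obtain ⟨x, rfl⟩ := hb y
    have : x ∈ N.comap b := by rw [h]; trivial
    exact this
  obtain ⟨L, hL, hNL, h1⟩ := h P a ha (N.comap b) (hN.comap b) hNt'
  have hNm : (N.comap b).map b = N := Subgroup.map_comap_eq_self_of_surjective hb N
  refine ⟨L.map b, hL.map b hb, ?_, ?_⟩
  · obtain ⟨h2, x, hx, hx'⟩ := SetLike.lt_iff_le_and_exists.mp hNL
    refine SetLike.lt_iff_le_and_exists.mpr ⟨?_, b x, ⟨x, hx, rfl⟩, hx'⟩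
    rw [← hNm]
    exact Subgroup.map_mono h2
  · rw [← hNm]
    exact h1.imp (fun h => h.map b) (fun h => h.map b)

theorem exists_mem_quotient {H : Type} [Group H] {N K : Subgroup H} [N.Normal] {x : H}
    (hx : x ∈ K ⊔ N) : ∃ y ∈ K, ∀ q : ℕ, ∀ M : Subgroup H, N ≤ M → y ^ q ∈ M → x ^ q ∈ M := by
  obtain ⟨y, hy, n, hn, rfl⟩ := Subgroup.mem_sup_of_normal_right.mp hx
  refine ⟨y, hy, fun q M hM h => ?_⟩
  have h1 : ((y * n : H) : H ⧸ N) ^ q = (y : H ⧸ N) ^ q := by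
    congr 1
    rw [QuotientGroup.mk_mul, (QuotientGroup.eq_one_iff n).mpr hn, mul_one]
  rw [← QuotientGroup.mk_pow, ← QuotientGroup.mk_pow, eq_comm, QuotientGroup.eq] at h1
  have := M.mul_mem h (hM h1)
  rwa [mul_inv_cancel_left] at this

theorem PSolv.of_ker (h : PSolv p G) (f : G' →* G)
    (hf : ∀ x ∈ f.ker, ∃ m, ¬ p ∣ m ∧ x ^ m = 1) : PSolv p G' := by
  intro H _ _ i hi N hN hNt
  let g := (f.comp i).rangeRestrict
  have hg : Function.Surjective g := MonoidHom.rangeRestrict_surjective _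
  have hgk : g.ker = (f.comp i).ker := MonoidHom.ker_rangeRestrict _
  by_cases hK : g.ker ≤ N
  · have hfin : Finite (f.comp i).range := Finite.of_surjective g hg
    have hNc : (N.map g).comap g = N := by
      rw [Subgroup.comap_map_eq, sup_eq_left.mpr hK]
    obtain ⟨L, hL, hNL, h1⟩ := h (f.comp i).range (f.comp i).range.subtype
      (Subgroup.subtype_injective _) (N.map g) (hN.map g hg) (by
        intro h; apply hNt; rw [← hNc, h, Subgroup.comap_top])
    refine ⟨L.comap g, hL.comap g, ?_, ?_⟩
    · rw [← hNc]; exact (Subgroup.comap_lt_comap_of_surjective hg).mpr hNL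
    · rw [← hNc]
      exact h1.imp (fun h => h.comap g) (fun h => h.comap g)
  · refine ⟨g.ker ⊔ N, inferInstance, right_lt_sup.mpr hK, Or.inr ?_⟩
    intro x hx
    obtain ⟨y, hy, hxy⟩ := exists_mem_quotient hx
    rw [hgk] at hy
    obtain ⟨m, hm, h1⟩ := hf (i y) hy
    rw [← map_pow, ← map_one i] at h1
    refine ⟨m, hm, hxy m N le_rfl ?_⟩
    rw [hi h1]; exact N.one_mem

theorem powStep_of_minimal {E D : ℕ → Prop} (hED : ∀ q r, E q → D r → q.Coprime r)
    (hfac : ∀ n : ℕ, 0 < n → ∃ q r, E q ∧ D r ∧ n = q * r)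
    {H : Type} [Group H] [Finite H] {N L e : Subgroup H} (hN : N.Normal) (hL : L.Normal)
    (hmin : ∀ S : Subgroup H, S.Normal → N ≤ S → S < L → S = N)
    (hNe : N ≤ e) (heL : e < L) (h : PowStep E e L) : PowStep E N L := by
  let s : Set H := {x | x ∈ L ∧ ∃ m, D m ∧ x ^ m ∈ N}
  have hsn : (Subgroup.closure s).Normal := by
    refine ⟨fun x hx g => ?_⟩
    have : Subgroup.closure s ≤ (Subgroup.closure s).comap (MulAut.conj g).toMonoidHom := by
      rw [Subgroup.closure_le]
      rintro x ⟨hx, m, hm, hxm⟩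
      refine Subgroup.subset_closure ⟨hL.conj_mem x hx g, m, hm, ?_⟩
      have : (g * x * g⁻¹) ^ m ∈ N := by rw [conj_pow]; exact hN.conj_mem _ hxm g
      exact this
    exact this hx
  have hse : Subgroup.closure s ≤ e := by
    rw [Subgroup.closure_le]
    rintro x ⟨hx, m, hm, hxm⟩
    obtain ⟨q, hq, hxq⟩ := h x hx
    have hc : Int.gcd q m = 1 := by simpa using hED q m hq hm
    have hb := Int.gcd_eq_gcd_ab q m
    rw [hc] at hb
    have : x = (x ^ q) ^ (Int.gcdA q m) * (x ^ m) ^ (Int.gcdB q m) := by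
      rw [← zpow_natCast, ← zpow_natCast, ← zpow_mul, ← zpow_mul, ← zpow_add, ← hb]; simp
    show x ∈ e
    rw [this]
    exact e.mul_mem (e.zpow_mem hxq _) (e.zpow_mem (hNe hxm) _)
  have hS : Subgroup.closure s ⊔ N = N :=
    hmin _ inferInstance le_sup_right (lt_of_le_of_lt (sup_le hse hNe) heL)
  intro x hx
  obtain ⟨q, r, hq, hr, hn⟩ := hfac (orderOf x) (orderOf_pos x)
  refine ⟨q, hq, ?_⟩
  rw [← hS]
  apply Subgroup.mem_sup_left
  apply Subgroup.subset_closure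
  refine ⟨L.pow_mem hx q, r, hr, ?_⟩
  rw [← pow_mul, ← hn, pow_orderOf_eq_one]; exact N.one_mem

theorem coprime_EPow_EReg (hp : p.Prime) (q r : ℕ) (hq : EPow p q) (hr : EReg p r) : q.Coprime r := by
  obtain ⟨a, rfl⟩ := hq
  exact Nat.Coprime.pow_left _ ((hp.coprime_iff_not_dvd).mpr hr)

theorem exists_EPow_EReg (hp : p.Prime) (n : ℕ) (hn : 0 < n) :
    ∃ q r, EPow p q ∧ EReg p r ∧ n = q * r := by
  obtain ⟨a, m, hm, h⟩ := Nat.exists_eq_pow_mul_and_not_dvd hn.ne' p hp.ne_one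
  exact ⟨p ^ a, m, ⟨a, rfl⟩, hm, h⟩

theorem powStep_of_card (hp : p.Prime) [Finite G] {A B : Subgroup G}
    (hn : (A.subgroupOf B).Normal)
    (h : IsPiNumber {p} (Nat.card (↥B ⧸ A.subgroupOf B)) ∨
      IsPiNumber {p}ᶜ (Nat.card (↥B ⧸ A.subgroupOf B))) :
    PowStep (EPow p) A B ∨ PowStep (EReg p) A B := by
  have key : ∀ x ∈ B, x ^ (Nat.card (↥B ⧸ A.subgroupOf B)) ∈ A := by
    intro x hx
    have h1 : ((⟨x, hx⟩ : B) : ↥B ⧸ A.subgroupOf B) ^ Nat.card (↥B ⧸ A.subgroupOf B) = 1 :=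
      pow_card_eq_one'
    rw [← QuotientGroup.mk_pow, QuotientGroup.eq_one_iff] at h1
    simpa [Subgroup.mem_subgroupOf] using h1
  rcases h with h | h
  · left
    intro x hx
    refine ⟨_, ?_, key x hx⟩
    obtain ⟨a, m, hm, hc⟩ := Nat.exists_eq_pow_mul_and_not_dvd
      (Nat.card_pos (α := ↥B ⧸ A.subgroupOf B)).ne' p hp.ne_one
    have hm1 : m = 1 := by
      by_contra hne
      obtain ⟨q, hq, hqm⟩ := Nat.exists_prime_and_dvd hne
      have := h q hq (hc ▸ hqm.mul_left _)
      rw [Set.mem_singleton_iff] at this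
      exact hm (this ▸ hqm)
    exact ⟨a, by rw [hc, hm1, mul_one]⟩
  · right
    intro x hx
    refine ⟨_, fun hd => ?_, key x hx⟩
    exact h p hp hd rfl

theorem IsPSolvable.pSolv (hp : p.Prime) [Finite G] (h : IsPSolvable p G) : PSolv p G := by
  obtain ⟨n, c, h0, hn, hc⟩ := h
  intro H _ _ i hi N hN hNt
  -- choose a minimal normal subgroup above `N`
  obtain ⟨L, ⟨hL, hNL⟩, hLmin⟩ :=
    (Set.toFinite {L : Subgroup H | L.Normal ∧ N < L}).exists_minimal
      ⟨⊤, inferInstance, lt_top_iff_ne_top.mpr hNt⟩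
  have hmin : ∀ S : Subgroup H, S.Normal → N ≤ S → S < L → S = N := by
    intro S hS hNS hSL
    by_contra hne
    exact hSL.not_ge (hLmin ⟨hS, lt_of_le_of_ne hNS (Ne.symm hne)⟩ hSL.le)
  refine ⟨L, hL, hNL, ?_⟩
  let e : Fin (n + 1) → Subgroup H := fun j => ((c j).comap i ⊓ L) ⊔ N
  have heL : ∀ j, e j ≤ L := fun j => sup_le inf_le_right hNL.le
  have he0 : e 0 ≠ L := by
    have : (c 0).comap i = ⊥ := by rw [h0, MonoidHom.comap_bot, (MonoidHom.ker_eq_bot_iff i).mpr hi]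
    simp only [e, this, bot_inf_eq, bot_sup_eq]
    exact hNL.ne
  have hen : e (Fin.last n) = L := by
    simp only [e, hn, Subgroup.comap_top, top_inf_eq]
    exact sup_eq_left.mpr hNL.le
  obtain ⟨j, hj1, hj2⟩ : ∃ j : Fin n, e j.castSucc ≠ L ∧ e j.succ = L := by
    by_contra hcon
    push Not at hcon
    have : ∀ j : Fin (n + 1), e j ≠ L := by
      intro j
      induction j using Fin.induction with
      | zero => exact he0
      | succ j ih => exact hcon j ih
    exact this _ hen
  obtain ⟨-, hnorm, hcard⟩ := hc j
  have hlt : e j.castSucc < L := lt_of_le_of_ne (heL _) hj1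
  have step : ∀ E, PowStep E (c j.castSucc) (c j.succ) → PowStep E (e j.castSucc) L := by
    intro E hE x hx
    rw [← hj2] at hx
    obtain ⟨y, hy, hxy⟩ := exists_mem_quotient hx
    obtain ⟨q, hq, hyq⟩ := hE (i y) hy.1
    refine ⟨q, hq, hxy q _ le_sup_right (Subgroup.mem_sup_left ⟨?_, L.pow_mem hy.2 q⟩)⟩
    simpa using hyq
  refine (powStep_of_card hp hnorm hcard).imp (fun h => ?_) (fun h => ?_)
  · exact powStep_of_minimal (coprime_EPow_EReg hp) (exists_EPow_EReg hp) hN hL hmin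
      le_sup_right hlt (step _ h)
  · exact powStep_of_minimal (D := EPow p) (fun q r hq hr => (coprime_EPow_EReg hp r q hr hq).symm)
      (fun n hn => by
        obtain ⟨q, r, hq, hr, h⟩ := exists_EPow_EReg hp n hn
        exact ⟨r, q, hr, hq, h.trans (mul_comm _ _)⟩) hN hL hmin
      le_sup_right hlt (step _ h)
end PSolvGroups

section PModular
open Polynomial IsLocalRing

theorem exists_valuationSubring_nonunits (p : ℕ) (hp : p.Prime) :
    ∃ B : ValuationSubring ℂ, (p : ℂ) ∈ B.nonunits := by
  let A : Subring ℂ := (Int.castRingHom ℂ).range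
  have hmem : (p : ℂ) ∈ A := ⟨(p : ℤ), by simp⟩
  let I : Ideal A := Ideal.span {⟨(p : ℂ), hmem⟩}
  have hI : I ≠ ⊤ := by
    intro h
    rw [Ideal.span_singleton_eq_top] at h
    obtain ⟨⟨b, n, rfl⟩, hb⟩ := h.exists_right_inv
    have h1 : (p : ℂ) * ((n : ℤ) : ℂ) = 1 := by simpa using congrArg Subtype.val hb
    have h2 : (p : ℤ) * n = 1 := by exact_mod_cast h1
    have h3 : (p : ℤ) ∣ 1 := ⟨n, h2.symm⟩
    have h4 : p ∣ 1 := by exact_mod_cast h3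
    exact hp.one_lt.ne' (Nat.dvd_one.mp h4)
  obtain ⟨B, -, hB⟩ := Ideal.image_subset_nonunits_valuationSubring I hI
  exact ⟨B, hB ⟨_, Ideal.subset_span rfl, rfl⟩⟩

/-- A valuation subring of `ℂ` whose maximal ideal contains `p`. -/
def VR (p : ℕ) [hp : Fact p.Prime] : ValuationSubring ℂ :=
  (exists_valuationSubring_nonunits p hp.out).choose

/-- The residue field of `VR p`. -/
abbrev KK (p : ℕ) [Fact p.Prime] : Type := ResidueField (VR p)

variable {p : ℕ} [hp : Fact p.Prime]

theorem VR_mem_maximalIdeal : (p : VR p) ∈ maximalIdeal (VR p) := by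
  rw [← ValuationSubring.coe_mem_nonunits_iff]
  exact (exists_valuationSubring_nonunits p hp.out).choose_spec

instance KK_charP : CharP (KK p) p := by
  refine (CharP.charP_iff_prime_eq_zero hp.out).mpr ?_
  have := (residue_eq_zero_iff (p : VR p)).mpr VR_mem_maximalIdeal
  simpa using this

theorem monic_eq_prod_roots (f : (VR p)[X]) (hf : f.Monic) :
    ∃ s : Multiset (VR p), f = (s.map (fun r => X - C r)).prod := by
  have hinj : Function.Injective (algebraMap (VR p) ℂ) := Subtype.val_injective
  have hmon := hf.map (algebraMap (VR p) ℂ)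
  have hroot : ∀ r ∈ (f.map (algebraMap (VR p) ℂ)).roots, ∃ r' : VR p, algebraMap (VR p) ℂ r' = r := by
    intro r hr
    have : IsIntegral (VR p) r := by
      refine ⟨f, hf, ?_⟩
      have := (mem_roots'.mp hr).2
      rwa [IsRoot, eval_map] at this
    exact IsIntegrallyClosed.isIntegral_iff.mp this
  choose! g hg using hroot
  refine ⟨(f.map (algebraMap (VR p) ℂ)).roots.map g, ?_⟩
  apply map_injective _ hinj
  have h1 := (IsAlgClosed.splits (f.map (algebraMap (VR p) ℂ))).eq_prod_roots_of_monic hmon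
  conv_lhs => rw [h1]
  rw [Polynomial.map_multiset_prod, Multiset.map_map, Multiset.map_map]
  congr 1
  apply Multiset.map_congr rfl
  intro r hr
  simp [hg r hr]

instance KK_isAlgClosed : IsAlgClosed (KK p) := by
  apply IsAlgClosed.of_exists_root
  intro f hf hirr
  have hl : f ∈ lifts (residue (VR p)) := by
    rw [lifts_iff_coeff_lifts]
    intro n
    exact residue_surjective _
  obtain ⟨q, hq, hdeg, hmon⟩ := lifts_and_degree_eq_and_monic hl hf
  obtain ⟨s, hs⟩ := monic_eq_prod_roots q hmon
  have hd : q.degree ≠ 0 := by rw [hdeg]; exact (degree_pos_of_irreducible hirr).ne'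
  have : s ≠ 0 := by
    rintro rfl
    simp [hs] at hd
  obtain ⟨r, hr⟩ := Multiset.exists_mem_of_ne_zero this
  refine ⟨residue _ r, ?_⟩
  rw [← hq, eval_map, eval₂_hom, hs, eval_multiset_prod, Multiset.prod_eq_zero, map_zero]
  rw [Multiset.map_map, Multiset.mem_map]
  exact ⟨r, hr, by simp⟩

theorem natCast_KK_ne_zero {n : ℕ} (h : ¬ p ∣ n) : (n : KK p) ≠ 0 := by
  rwa [Ne, CharP.cast_eq_zero_iff (KK p) p]

/-- If `η ≡ 1` and `η ^ m = 1` with `p ∤ m`, then `η = 1`. -/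
theorem eq_one_of_residue_eq_one {η : VR p} {m : ℕ} (hm : ¬ p ∣ m) (h1 : residue _ η = 1)
    (h : η ^ m = 1) : η = 1 := by
  have hg : (η - 1) * (∑ i ∈ Finset.range m, η ^ i) = 0 := by
    rw [mul_comm, geom_sum_mul, h, sub_self]
  have hu : IsUnit (∑ i ∈ Finset.range m, η ^ i) := by
    rw [← residue_ne_zero_iff_isUnit]
    simpa [h1] using natCast_KK_ne_zero hm
  rcases mul_eq_zero.mp hg with h | h
  · exact sub_eq_zero.mp h
  · exact absurd h hu.ne_zero

/-- Teichmuller section. -/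
def tch (x : KK p) : ℂ :=
  if h : ∃ ζ : VR p, residue _ ζ = x ∧ ∃ m, ¬ p ∣ m ∧ ζ ^ m = 1 then (h.choose : ℂ) else 0

theorem tch_residue {ζ : VR p} {m : ℕ} (hm : ¬ p ∣ m) (h : ζ ^ m = 1) :
    tch (residue _ ζ) = (ζ : ℂ) := by
  have hex : ∃ ζ' : VR p, residue _ ζ' = residue _ ζ ∧ ∃ m, ¬ p ∣ m ∧ ζ' ^ m = 1 := ⟨ζ, rfl, m, hm, h⟩
  rw [tch, dif_pos hex]
  obtain ⟨h1, m', hm', h2⟩ := hex.choose_spec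
  set ζ' := hex.choose
  have hm0 : m ≠ 0 := by rintro rfl; simp at hm
  have h3 : ζ ^ (m - 1) * ζ = 1 := by rw [← pow_succ, Nat.sub_add_cancel (Nat.pos_of_ne_zero hm0), h]
  have h4 : ζ' * ζ ^ (m - 1) = 1 := by
    apply eq_one_of_residue_eq_one (m := m * m')
    · rw [hp.out.dvd_mul]; tauto
    · rw [map_mul, h1, ← map_mul, mul_comm, h3, map_one]
    · rw [mul_pow, mul_comm m, pow_mul, h2, one_pow, one_mul, ← pow_mul, mul_comm _ (m' * m), mul_comm m', pow_mul, pow_mul, h, one_pow, one_pow]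
  have : ζ' = ζ := by
    calc ζ' = ζ' * (ζ ^ (m - 1) * ζ) := by rw [h3, mul_one]
      _ = ζ := by rw [← mul_assoc, h4, one_mul]
  rw [this]

variable {ι : Type} [Fintype ι]

/-- The sum of the Teichmuller lifts of the eigenvalues. -/
def brTr (f : (KK p)[X]) : ℂ := (f.roots.map tch).sum

theorem brTr_mul {f g : (KK p)[X]} (hf : f ≠ 0) (hg : g ≠ 0) : brTr (f * g) = brTr f + brTr g := by
  rw [brTr, roots_mul (mul_ne_zero hf hg), Multiset.map_add, Multiset.sum_add]; rfl

theorem brTr_charpoly (A : Matrix ι ι (VR p)) {m : ℕ} (hm : ¬ p ∣ m) (hA : A ^ m = 1) :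
    brTr (A.map (residue (VR p))).charpoly = ((A.trace : VR p) : ℂ) := by
  obtain ⟨s, hs⟩ := monic_eq_prod_roots A.charpoly A.charpoly_monic
  have hinj : Function.Injective (algebraMap (VR p) ℂ) := Subtype.val_injective
  have hroots : ∀ r ∈ s, r ^ m = 1 := by
    intro r hr
    have h0 : A.charpoly.eval r = 0 := by
      rw [hs, eval_multiset_prod, Multiset.prod_eq_zero_iff]
      simp only [Multiset.map_map, Multiset.mem_map, Function.comp_apply]
      exact ⟨r, hr, by simp⟩
    have h1 : (Matrix.scalar ι r - A).det = 0 := by rw [← Matrix.eval_charpoly]; exact h0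
    obtain ⟨v, hv, hv'⟩ := Matrix.exists_mulVec_eq_zero_iff.mpr h1
    have h2 : A.mulVec v = r • v := by
      rw [Matrix.sub_mulVec, sub_eq_zero] at hv'
      rw [← hv']; ext i; simp [Matrix.scalar_apply, Matrix.mulVec_diagonal]
    have h3 : ∀ j : ℕ, (A ^ j).mulVec v = r ^ j • v := by
      intro j
      induction j with
      | zero => simp
      | succ j ih => rw [pow_succ, ← Matrix.mulVec_mulVec, h2, Matrix.mulVec_smul, ih, smul_smul, pow_succ, mul_comm]
    have h4 := h3 m
    rw [hA, Matrix.one_mulVec] at h4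
    obtain ⟨i, hi⟩ := Function.ne_iff.mp hv
    have h5 := congrFun h4 i
    simp only [Pi.smul_apply, smul_eq_mul, Pi.zero_apply] at h5 hi
    have : (r ^ m - 1) * v i = 0 := by rw [sub_mul, ← h5, one_mul, sub_self]
    rcases mul_eq_zero.mp this with h | h
    · exact sub_eq_zero.mp h
    · exact absurd h hi
  have hrt : (A.map (residue (VR p))).charpoly.roots = s.map (residue (VR p)) := by
    rw [Matrix.charpoly_map, hs, Polynomial.map_multiset_prod, Multiset.map_map]
    have : s.map (Polynomial.map (residue (VR p)) ∘ fun r => X - C r) = (s.map (residue (VR p))).map (fun r => X - C r) := by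
      rw [Multiset.map_map]; apply Multiset.map_congr rfl; intro r _; simp
    rw [this, roots_multiset_prod_X_sub_C]
  rw [brTr, hrt, Multiset.map_map]
  have h6 : (A.map (algebraMap (VR p) ℂ)).charpoly.roots = s.map (algebraMap (VR p) ℂ) := by
    rw [Matrix.charpoly_map, hs, Polynomial.map_multiset_prod, Multiset.map_map]
    have : s.map (Polynomial.map (algebraMap (VR p) ℂ) ∘ fun r => X - C r) = (s.map (algebraMap (VR p) ℂ)).map (fun r => X - C r) := by
      rw [Multiset.map_map]; apply Multiset.map_congr rfl; intro r _; simp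
    rw [this, roots_multiset_prod_X_sub_C]
  have h7 : ((A.trace : VR p) : ℂ) = (A.map (algebraMap (VR p) ℂ)).trace := by
    exact AddMonoidHom.map_trace (algebraMap (VR p) ℂ).toAddMonoidHom A
  rw [h7, Matrix.trace_eq_sum_roots_charpoly, h6]
  congr 1
  apply Multiset.map_congr rfl
  intro r hr
  exact tch_residue hm (hroots r hr)

theorem matrix_eq_one_of_residue {A : Matrix ι ι (VR p)} {m : ℕ} (hm : ¬ p ∣ m)
    (h1 : A.map (residue (VR p)) = 1) (hA : A ^ m = 1) : A = 1 := by
  have hg : (∑ i ∈ Finset.range m, A ^ i) * (A - 1) = 0 := by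
    rw [geom_sum_mul, hA, sub_self]
  have hmap : (residue (VR p)).mapMatrix (∑ i ∈ Finset.range m, A ^ i) = (m : Matrix ι ι (KK p)) := by
    rw [map_sum]
    simp only [map_pow]
    have : (residue (VR p)).mapMatrix A = 1 := h1
    simp [this]
  have hu : IsUnit (∑ i ∈ Finset.range m, A ^ i) := by
    rw [Matrix.isUnit_iff_isUnit_det, ← residue_ne_zero_iff_isUnit, RingHom.map_det, hmap]
    have : (m : Matrix ι ι (KK p)) = Matrix.diagonal (fun _ => (m : KK p)) := by
      rw [Matrix.diagonal_natCast]
    rw [this, Matrix.det_diagonal]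
    exact Finset.prod_ne_zero_iff.mpr fun _ _ => natCast_KK_ne_zero hm
  exact sub_eq_zero.mp ((hu.mul_right_eq_zero).mp hg)

theorem trace_pow_char {k : Type} [Field k] [CharP k p] (M : Matrix ι ι k) :
    (M ^ p).trace = M.trace ^ p := by
  cases isEmpty_or_nonempty ι
  · simp [Matrix.trace, hp.out.ne_zero]
  have key : M.charpoly ^ p = expand k p (M ^ p).charpoly := by
    unfold Matrix.charpoly
    rw [AlgHom.map_det, ← Matrix.coe_detMonoidHom,
      ← (Matrix.detMonoidHom : Matrix ι ι k[X] →* k[X]).map_pow]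
    apply congr_arg Matrix.det
    refine matPolyEquiv.injective ?_
    rw [map_pow, Matrix.matPolyEquiv_charmatrix, sub_pow_char_of_commute, ← C_pow]
    · exact (matPolyEquiv_eq_X_pow_sub_C p M).symm
    · exact (C M).commute_X
  have h1 : M.charpoly ^ p = expand k p (M.charpoly.map (frobenius k p)) := by
    rw [← map_frobenius_expand, map_expand]
  have h2 := expand_injective hp.out.pos (h1.symm.trans key)
  rw [Matrix.trace_eq_neg_charpoly_coeff, Matrix.trace_eq_neg_charpoly_coeff, ← h2, coeff_map,
    frobenius_def]
  have h3 := map_neg (frobenius k p) (M.charpoly.coeff (Fintype.card ι - 1))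
  simpa [frobenius_def] using h3.symm
end PModular

section RepBasics
open Module

variable {k : Type} [Field k] {G : Type} [Group G] {V : Type} [AddCommGroup V] [Module k V]

/-- Invariant subspaces. -/
def InvSub (ρ : Representation k G V) (W : Submodule k V) : Prop :=
  ∀ g, ∀ v ∈ W, ρ g v ∈ W

/-- Irreducible representations. -/
def Irr (ρ : Representation k G V) : Prop :=
  Nontrivial V ∧ ∀ W : Submodule k V, InvSub ρ W → W = ⊥ ∨ W = ⊤

/-- Minimal nonzero invariant subspaces. -/
def IrrSub (ρ : Representation k G V) (C : Submodule k V) : Prop :=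
  InvSub ρ C ∧ C ≠ ⊥ ∧ ∀ D : Submodule k V, InvSub ρ D → D ≤ C → D = ⊥ ∨ D = C

/-- The representation on an invariant subspace. -/
def subRep (ρ : Representation k G V) (W : Submodule k V) (h : InvSub ρ W) : Representation k G W where
  toFun g := (ρ g).restrict (h g)
  map_one' := by ext; simp
  map_mul' a b := by ext; simp

/-- The representation on the quotient by an invariant subspace. -/
def quoRep (ρ : Representation k G V) (W : Submodule k V) (h : InvSub ρ W) :
    Representation k G (V ⧸ W) where
  toFun g := W.mapQ W (ρ g) (h g)
  map_one' := by ext; simp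
  map_mul' a b := by ext; simp

@[simp] theorem rho_inv_self (ρ : Representation k G V) (g : G) (v : V) : ρ g⁻¹ (ρ g v) = v := by
  rw [← Module.End.mul_apply, ← map_mul]; simp

@[simp] theorem rho_self_inv (ρ : Representation k G V) (g : G) (v : V) : ρ g (ρ g⁻¹ v) = v := by
  rw [← Module.End.mul_apply, ← map_mul]; simp

theorem rho_mul_apply (ρ : Representation k G V) (g h : G) (v : V) : ρ (g * h) v = ρ g (ρ h v) := by
  rw [map_mul]; rfl

theorem rho_injective (ρ : Representation k G V) (g : G) : Function.Injective (ρ g) :=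
  Function.LeftInverse.injective (g := ρ g⁻¹) (fun v => by simp)

theorem InvSub.map_eq {ρ : Representation k G V} {W : Submodule k V} (h : InvSub ρ W) (g : G) :
    W.map (ρ g) = W := by
  apply le_antisymm
  · rw [Submodule.map_le_iff_le_comap]; exact h g
  · intro v hv; exact ⟨ρ g⁻¹ v, h g⁻¹ v hv, by simp⟩

theorem InvSub.inf {ρ : Representation k G V} {W W' : Submodule k V} (h : InvSub ρ W) (h' : InvSub ρ W') :
    InvSub ρ (W ⊓ W') := fun g v hv => ⟨h g v hv.1, h' g v hv.2⟩

theorem InvSub.sSup_mem {ρ : Representation k G V} {B : Set (Submodule k V)} (h : ∀ W ∈ B, InvSub ρ W) :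
    InvSub ρ (sSup B) := by
  intro g
  have : sSup B ≤ (sSup B).comap (ρ g) := by
    apply sSup_le
    intro W hW v hv
    exact (le_sSup hW : W ≤ sSup B) (h W hW g v hv)
  exact fun v hv => this hv

theorem IrrSub.irr {ρ : Representation k G V} {C : Submodule k V} (h : IrrSub ρ C) :
    Irr (subRep ρ C h.1) := by
  refine ⟨Submodule.nontrivial_iff_ne_bot.mpr h.2.1, fun W hW => ?_⟩
  have h1 : InvSub ρ (W.map C.subtype) := by
    rintro g _ ⟨w, hw, rfl⟩
    exact ⟨subRep ρ C h.1 g w, hW g w hw, rfl⟩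
  rcases h.2.2 _ h1 (Submodule.map_subtype_le C W) with h2 | h2
  · left; exact Submodule.map_injective_of_injective C.subtype_injective (by rw [h2, Submodule.map_bot])
  · right
    rw [eq_top_iff]
    intro w _
    have : (w : V) ∈ W.map C.subtype := by rw [h2]; exact w.2
    obtain ⟨w', hw', h3⟩ := this
    have : w' = w := Subtype.ext h3
    exact this ▸ hw'

theorem exists_irrSub [FiniteDimensional k V] (ρ : Representation k G V) {W : Submodule k V}
    (hW : InvSub ρ W) (h0 : W ≠ ⊥) : ∃ C ≤ W, IrrSub ρ C := by
  obtain ⟨C, ⟨h1, h2, h3⟩, hmin⟩ :=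
    (wellFounded_lt (α := Submodule k V)).has_min {C | C ≤ W ∧ InvSub ρ C ∧ C ≠ ⊥} ⟨W, le_rfl, hW, h0⟩
  refine ⟨C, h1, h2, h3, fun D hD hDC => ?_⟩
  by_contra hcon
  push Not at hcon
  exact hmin D ⟨hDC.trans h1, hD, hcon.1⟩ (lt_of_le_of_ne hDC hcon.2)

/-- Schur's lemma. -/
theorem Irr.schur [IsAlgClosed k] [FiniteDimensional k V] {ρ : Representation k G V} (h : Irr ρ)
    (f : V →ₗ[k] V) (hf : ∀ g v, f (ρ g v) = ρ g (f v)) : ∃ c : k, ∀ v, f v = c • v := by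
  have := h.1
  obtain ⟨c, hc⟩ := Module.End.exists_eigenvalue f
  refine ⟨c, ?_⟩
  have h1 : InvSub ρ (Module.End.eigenspace f c) := by
    intro g v hv
    rw [Module.End.mem_eigenspace_iff] at hv ⊢
    rw [hf, hv, map_smul]
  rcases h.2 _ h1 with h2 | h2
  · exact absurd h2 hc
  · intro v
    have : v ∈ Module.End.eigenspace f c := by rw [h2]; trivial
    exact Module.End.mem_eigenspace_iff.mp this

theorem Irr.injective {ρ : Representation k G V} (h : Irr ρ) {V' : Type} [AddCommGroup V']
    [Module k V'] {σ : Representation k G V'} (f : V →ₗ[k] V') (hf : ∀ g v, f (ρ g v) = σ g (f v))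
    (h0 : f ≠ 0) : Function.Injective f := by
  have h1 : InvSub ρ (LinearMap.ker f) := by
    intro g v hv
    rw [LinearMap.mem_ker] at hv ⊢
    rw [hf, hv, map_zero]
  rcases h.2 _ h1 with h2 | h2
  · exact LinearMap.ker_eq_bot.mp h2
  · exact absurd (LinearMap.ker_eq_top.mp h2) h0

theorem inv_range {ρ : Representation k G V} {V' : Type} [AddCommGroup V']
    [Module k V'] {σ : Representation k G V'} (f : V →ₗ[k] V') (hf : ∀ g v, f (ρ g v) = σ g (f v)) :
    InvSub σ (LinearMap.range f) := by
  rintro g _ ⟨v, rfl⟩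
  exact ⟨ρ g v, hf g v⟩

theorem Irr.surjective {ρ : Representation k G V} {V' : Type} [AddCommGroup V']
    [Module k V'] {σ : Representation k G V'} (h : Irr σ) (f : V →ₗ[k] V')
    (hf : ∀ g v, f (ρ g v) = σ g (f v)) (h0 : f ≠ 0) : Function.Surjective f := by
  rcases h.2 _ (inv_range f hf) with h2 | h2
  · exact absurd (LinearMap.range_eq_bot.mp h2) h0
  · exact LinearMap.range_eq_top.mp h2

/-! Decompositions into independent subspaces. -/

/-- A set of subspaces forming a direct sum decomposition. -/
def Dec (B : Set (Submodule k V)) : Prop := sSupIndep B ∧ sSup B = ⊤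

/-- The projection onto a member of a decomposition. -/
def bproj (B : Set (Submodule k V)) (C : Submodule k V) : V →ₗ[k] V :=
  if h : IsCompl C (sSup (B \ {C})) then C.projection _ h else 0

variable {B : Set (Submodule k V)}

theorem Dec.isCompl (hB : Dec B) {C : Submodule k V} (hC : C ∈ B) : IsCompl C (sSup (B \ {C})) := by
  refine ⟨hB.1 hC, codisjoint_iff.mpr ?_⟩
  rw [← sSup_insert, Set.insert_sdiff_singleton, Set.insert_eq_of_mem hC, hB.2]

theorem Dec.finite [FiniteDimensional k V] (hB : Dec B) : B.Finite :=
  WellFoundedGT.finite_of_sSupIndep hB.1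

theorem Dec.proj_self (hB : Dec B) {C : Submodule k V} (hC : C ∈ B) {v : V} (hv : v ∈ C) :
    bproj B C v = v := by
  rw [bproj, dif_pos (hB.isCompl hC)]
  exact Submodule.projection_apply_of_mem_left _ hv

theorem Dec.proj_mem (hB : Dec B) {C : Submodule k V} (hC : C ∈ B) (v : V) :
    bproj B C v ∈ C := by
  rw [bproj, dif_pos (hB.isCompl hC)]
  exact Submodule.projection_apply_mem _ _

theorem Dec.proj_other (hB : Dec B) {C D : Submodule k V} (hC : C ∈ B) (hD : D ∈ B) (hne : D ≠ C)
    {v : V} (hv : v ∈ D) : bproj B C v = 0 := by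
  rw [bproj, dif_pos (hB.isCompl hC), Submodule.projection_apply_eq_zero_iff]
  exact (le_sSup (⟨hD, hne⟩ : D ∈ B \ {C}) : D ≤ _) hv

theorem Dec.ext (hB : Dec B) {V' : Type} [AddCommGroup V'] [Module k V'] {f g : V →ₗ[k] V'}
    (h : ∀ C ∈ B, ∀ v ∈ C, f v = g v) : f = g := by
  have : sSup B ≤ LinearMap.eqLocus f g := sSup_le fun C hC v hv => h C hC v hv
  ext v
  exact this (hB.2 ▸ Submodule.mem_top)

theorem Dec.sum_proj [FiniteDimensional k V] (hB : Dec B) :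
    ∑ C ∈ hB.finite.toFinset, bproj B C = LinearMap.id := by
  apply hB.ext
  intro C hC v hv
  rw [LinearMap.sum_apply, Finset.sum_eq_single C]
  · simp [hB.proj_self hC hv]
  · intro D hD hne
    exact hB.proj_other (by simpa using hD) hC hne.symm hv
  · intro h; exact absurd ((Set.Finite.mem_toFinset _).mpr hC) h

theorem Dec.proj_comp (hB : Dec B) {e : V →ₗ[k] V} (he : Function.Injective e)
    (hmap : ∀ C ∈ B, C.map e ∈ B)
    {C : Submodule k V} (hC : C ∈ B) : e ∘ₗ bproj B C = bproj B (C.map e) ∘ₗ e := by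
  apply hB.ext
  intro D hD v hv
  have hev : e v ∈ D.map e := ⟨v, hv, rfl⟩
  by_cases hDC : D = C
  · subst hDC
    simp [hB.proj_self hC hv, hB.proj_self (hmap _ hC) hev]
  · have : D.map e ≠ C.map e := fun h => hDC (Submodule.map_injective_of_injective he h)
    simp [hB.proj_other hC hD hDC hv, hB.proj_other (hmap _ hC) (hmap _ hD) this hev]

theorem Dec.eq_zero_of_proj [FiniteDimensional k V] (hB : Dec B) {v : V}
    (h : ∀ C ∈ B, bproj B C v = 0) : v = 0 := by
  have := congrArg (fun f : V →ₗ[k] V => f v) hB.sum_proj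
  simp only [LinearMap.sum_apply, LinearMap.id_apply] at this
  rw [← this]
  exact Finset.sum_eq_zero fun C hC => h C (by simpa using hC)

theorem Dec.proj_sSup (hB : Dec B) {A : Set (Submodule k V)} (hA : A ⊆ B) {C : Submodule k V}
    (hC : C ∈ B) (hCA : C ∉ A) {v : V} (hv : v ∈ sSup A) : bproj B C v = 0 := by
  have : sSup A ≤ LinearMap.ker (bproj B C) := by
    apply sSup_le
    intro D hD v hv
    exact hB.proj_other hC (hA hD) (fun h => hCA (h ▸ hD)) hv
  exact this hv

theorem Dec.disjoint_sSup [FiniteDimensional k V] (hB : Dec B) {A A' : Set (Submodule k V)}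
    (hA : A ⊆ B) (hA' : A' ⊆ B) (h : Disjoint A A') : Disjoint (sSup A) (sSup A') := by
  rw [Submodule.disjoint_def]
  intro v hv hv'
  apply hB.eq_zero_of_proj
  intro C hC
  by_cases hCA : C ∈ A
  · exact hB.proj_sSup hA' hC (Set.disjoint_left.mp h hCA) hv'
  · exact hB.proj_sSup hA hC hCA hv

/-- Refining each member of a decomposition. -/
theorem Dec.refine {Ω : Set (Submodule k V)} (hΩ : Dec Ω)
    (F : Submodule k V → Set (Submodule k V))
    (hF : ∀ W ∈ Ω, sSupIndep (F W) ∧ sSup (F W) = W) : Dec {C | ∃ W ∈ Ω, C ∈ F W} := by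
  constructor
  · rintro C ⟨W, hW, hC⟩
    have hle : sSup ({C | ∃ W ∈ Ω, C ∈ F W} \ {C}) ≤ sSup (F W \ {C}) ⊔ sSup (Ω \ {W}) := by
      apply sSup_le
      rintro D ⟨⟨W', hW', hD⟩, hDC⟩
      by_cases h : W' = W
      · subst h; exact le_sup_of_le_left (le_sSup ⟨hD, hDC⟩)
      · refine le_sup_of_le_right (le_trans ?_ (le_sSup (⟨hW', h⟩ : W' ∈ Ω \ {W})))
        rw [← (hF W' hW').2]; exact le_sSup hD
    refine Disjoint.mono_right hle ?_
    rw [Submodule.disjoint_def]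
    intro v hv hv'
    obtain ⟨a, ha, b, hb, rfl⟩ := Submodule.mem_sup.mp hv'
    have hCW : C ≤ W := by rw [← (hF W hW).2]; exact le_sSup hC
    have haW : a ∈ W := by
      rw [← (hF W hW).2]
      exact (sSup_le_sSup Set.sdiff_subset : sSup (F W \ {C}) ≤ sSup (F W)) ha
    have hbW : b ∈ W := by simpa using W.sub_mem (hCW hv) haW
    have hb0 : b = 0 := Submodule.disjoint_def.mp (hΩ.1 hW) b hbW hb
    subst hb0
    rw [add_zero] at hv ⊢
    exact Submodule.disjoint_def.mp ((hF W hW).1 hC) a hv ha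
  · rw [eq_top_iff, ← hΩ.2]
    apply sSup_le
    intro W hW
    rw [← (hF W hW).2]
    exact sSup_le_sSup fun C hC => ⟨W, hW, hC⟩

theorem exists_dec_irrSub [FiniteDimensional k V] (ρ : Representation k G V)
    (h : sSup {C | IrrSub ρ C} = ⊤) : ∃ B, Dec B ∧ ∀ C ∈ B, IrrSub ρ C := by
  obtain ⟨B, -, h1⟩ := zorn_subset_nonempty
    {B : Set (Submodule k V) | sSupIndep B ∧ ∀ C ∈ B, IrrSub ρ C} (by
      intro c hc hchain hne
      refine ⟨⋃₀ c, ⟨?_, ?_⟩, fun s hs => Set.subset_sUnion_of_mem hs⟩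
      · exact iSupIndep_sUnion_of_directed hchain.directedOn fun a ha => (hc ha).1
      · rintro C ⟨s, hs, hC⟩
        exact (hc hs).2 C hC) ∅ ⟨sSupIndep_empty, by simp⟩
  refine ⟨B, ⟨h1.prop.1, ?_⟩, h1.prop.2⟩
  by_contra hne
  have : ∃ C, IrrSub ρ C ∧ ¬ C ≤ sSup B := by
    by_contra hcon
    push Not at hcon
    apply hne
    rw [eq_top_iff, ← h]
    exact sSup_le fun C hC => hcon C hC
  obtain ⟨C, hC, hCB⟩ := this
  have hdisj : Disjoint C (sSup B) := by
    rw [disjoint_iff]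
    rcases hC.2.2 _ (hC.1.inf (InvSub.sSup_mem fun W hW => (h1.prop.2 W hW).1)) inf_le_left with h2 | h2
    · exact h2
    · exact absurd (inf_eq_left.mp h2) hCB
  have hCB' : C ∉ B := fun h => hCB (le_sSup h)
  apply hCB'
  have hins : insert C B ∈ {B : Set (Submodule k V) | sSupIndep B ∧ ∀ C ∈ B, IrrSub ρ C} := by
    refine ⟨?_, ?_⟩
    · intro D hD
      by_cases hDC : D = C
      · subst hDC
        refine hdisj.mono_right (sSup_le_sSup ?_)
        rintro E ⟨hE | hE, hne⟩
        · exact absurd hE hne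
        · exact hE
      · have hDB : D ∈ B := hD.resolve_left hDC
        have hle : sSup (insert C B \ {D}) ≤ C ⊔ sSup (B \ {D}) := by
          apply sSup_le
          rintro E ⟨rfl | hE, hne⟩
          · exact le_sup_left
          · exact le_sup_of_le_right (le_sSup ⟨hE, hne⟩)
        refine Disjoint.mono_right hle ?_
        rw [Submodule.disjoint_def]
        intro v hv hv'
        obtain ⟨a, ha, b, hb, rfl⟩ := Submodule.mem_sup.mp hv'
        have hb' : b ∈ sSup B := (sSup_le_sSup Set.sdiff_subset : sSup (B \ {D}) ≤ sSup B) hb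
        have ha' : a ∈ sSup B := by
          simpa using (sSup B).sub_mem ((le_sSup hDB : D ≤ sSup B) hv) hb'
        have ha0 := Submodule.disjoint_def.mp hdisj a ha ha'
        subst ha0
        rw [zero_add] at hv ⊢
        exact Submodule.disjoint_def.mp (h1.prop.1 hDB) b hv hb
    · rintro D (rfl | hD)
      · exact hC
      · exact h1.prop.2 D hD
  exact h1.le_of_ge hins (Set.subset_insert _ _) (Set.mem_insert _ _)
end RepBasics

section RepAlgebra
open Module

variable {k : Type} [Field k] {G : Type} [Group G] {V : Type} [AddCommGroup V] [Module k V]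

theorem charpoly_sub_quo [Infinite k] [FiniteDimensional k V] (f : V →ₗ[k] V) (W : Submodule k V)
    (h : W ≤ W.comap f) :
    f.charpoly = (f.restrict h).charpoly * (W.mapQ W f h).charpoly := by
  apply Polynomial.funext
  intro t
  rw [Polynomial.eval_mul, LinearMap.eval_charpoly, LinearMap.eval_charpoly, LinearMap.eval_charpoly]
  have h' : W ≤ W.comap (algebraMap k (Module.End k V) t - f) := by
    intro v hv
    rw [Submodule.mem_comap, LinearMap.sub_apply]
    exact W.sub_mem (W.smul_mem t hv) (h hv)
  rw [LinearMap.det_eq_det_mul_det W _ h']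
  congr 2
  ext v
  simp

theorem trace_eq_neg_nextCoeff_charpoly [FiniteDimensional k V] (f : V →ₗ[k] V) :
    LinearMap.trace k V f = - f.charpoly.nextCoeff := by
  rw [LinearMap.trace_eq_matrix_trace k (finBasis k V), Matrix.trace_eq_neg_charpoly_nextCoeff,
    LinearMap.charpoly_toMatrix]

theorem trace_sub_quo [Infinite k] [FiniteDimensional k V] (f : V →ₗ[k] V) (W : Submodule k V)
    (h : W ≤ W.comap f) :
    LinearMap.trace k V f = LinearMap.trace k W (f.restrict h) +
      LinearMap.trace k (V ⧸ W) (W.mapQ W f h) := by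
  rw [trace_eq_neg_nextCoeff_charpoly, trace_eq_neg_nextCoeff_charpoly,
    trace_eq_neg_nextCoeff_charpoly, charpoly_sub_quo f W h,
    Polynomial.Monic.nextCoeff_mul (LinearMap.charpoly_monic _) (LinearMap.charpoly_monic _)]
  ring

/-- Burnside's theorem on matrix algebras. -/
theorem Irr.burnside [IsAlgClosed k] [FiniteDimensional k V] {ρ : Representation k G V} (h : Irr ρ) :
    Function.Surjective ρ.asAlgebraHom := by
  have hs : IsSimpleModule (MonoidAlgebra k G) ρ.asModule := by
    have hnt : Nontrivial ρ.asModule := h.1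
    rw [isSimpleModule_iff]
    refine ⟨fun N => ?_⟩
    have h1 : InvSub ρ (N.restrictScalars k) := by
      intro g v hv
      have : (MonoidAlgebra.of k G g) • (ρ.asModuleEquiv.symm v) ∈ N := N.smul_mem _ hv
      rwa [← Representation.asModuleEquiv_symm_map_rho] at this
    rcases h.2 _ h1 with h2 | h2
    · left; exact (Submodule.restrictScalars_eq_bot_iff _ _ _).mp h2
    · right; exact (Submodule.restrictScalars_eq_top_iff _ _ _).mp h2
  intro f
  have hsc : ∀ e : Module.End (MonoidAlgebra k G) ρ.asModule, ∃ c : k, ∀ v, e v = c • v := by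
    intro e
    refine h.schur (e.restrictScalars k : ρ.asModule →ₗ[k] ρ.asModule) ?_
    intro g v
    have := e.map_smul (MonoidAlgebra.of k G g) (ρ.asModuleEquiv.symm v)
    rw [← Representation.asModuleEquiv_symm_map_rho] at this
    refine Eq.trans this ?_
    have h3 := Representation.asModuleEquiv_map_smul ρ (MonoidAlgebra.of k G g) (e (ρ.asModuleEquiv.symm v))
    rw [Representation.asAlgebraHom_of] at h3
    exact h3
  let F : Module.End (Module.End (MonoidAlgebra k G) ρ.asModule) ρ.asModule :=
    { toFun := fun v => f v
      map_add' := fun a b => map_add f a b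
      map_smul' := by
        intro e v
        obtain ⟨c, hc⟩ := hsc e
        have h1 : e • v = c • v := hc v
        have h2 : e • (show ρ.asModule from f v) = c • (show ρ.asModule from f v) := hc _
        rw [h1, RingHom.id_apply]
        exact (map_smul f c v).trans h2.symm }
  obtain ⟨a, ha⟩ := jacobson_density F (Finset.univ.image (finBasis k V))
  refine ⟨a, ?_⟩
  apply (finBasis k V).ext
  intro i
  have h1 := ha (finBasis k V i) (Finset.mem_image_of_mem _ (Finset.mem_univ i))
  have h2 := Representation.asModuleEquiv_map_smul ρ a (finBasis k V i)
  exact h2.symm.trans h1.symm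
end RepAlgebra

section TraceSeparation
open Module

variable {k : Type} [Field k] {G : Type} [Group G] {V : Type} [AddCommGroup V] [Module k V]

theorem eq_zero_of_trace_mul_eq_zero [FiniteDimensional k V] (f : V →ₗ[k] V)
    (h : ∀ g : V →ₗ[k] V, LinearMap.trace k V (f ∘ₗ g) = 0) : f = 0 := by
  ext v
  rw [LinearMap.zero_apply]
  by_contra hv
  obtain ⟨ξ, hξ⟩ := Module.Projective.exists_dual_ne_zero k hv
  have h1 := h (ξ.smulRight v)
  have h2 : f ∘ₗ ξ.smulRight v = ξ.smulRight (f v) := by ext; simp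
  rw [h2, LinearMap.trace_smulRight] at h1
  exact hξ h1

theorem eq_zero_or_eq_zero_of_comp [FiniteDimensional k V] (f f' : V →ₗ[k] V)
    (h : ∀ g : V →ₗ[k] V, f ∘ₗ g ∘ₗ f' = 0) : f = 0 ∨ f' = 0 := by
  by_contra hcon
  push Not at hcon
  obtain ⟨v, hv⟩ : ∃ v, f v ≠ 0 := by
    by_contra h1; push Not at h1; exact hcon.1 (LinearMap.ext h1)
  obtain ⟨w, hw⟩ : ∃ w, f' w ≠ 0 := by
    by_contra h1; push Not at h1; exact hcon.2 (LinearMap.ext h1)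
  obtain ⟨ξ, hξ⟩ := Module.Projective.exists_dual_ne_zero k hw
  have h1 := congrArg (fun e : V →ₗ[k] V => e w) (h (ξ.smulRight v))
  simp only [LinearMap.comp_apply, LinearMap.smulRight_apply, map_smul, LinearMap.zero_apply,
    smul_eq_zero] at h1
  exact h1.elim hξ hv

theorem trace_asAlgebraHom_eq {V₁ V₂ : Type} [AddCommGroup V₁] [Module k V₁]
    [AddCommGroup V₂] [Module k V₂] (ρ : Representation k G V) (ρ₁ : Representation k G V₁)
    (ρ₂ : Representation k G V₂)
    (h : ∀ g, LinearMap.trace k V (ρ g) = LinearMap.trace k V₁ (ρ₁ g) + LinearMap.trace k V₂ (ρ₂ g))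
    (a : MonoidAlgebra k G) :
    LinearMap.trace k V (ρ.asAlgebraHom a) =
      LinearMap.trace k V₁ (ρ₁.asAlgebraHom a) + LinearMap.trace k V₂ (ρ₂.asAlgebraHom a) := by
  induction a using MonoidAlgebra.induction_on with
  | of g => simpa [Representation.asAlgebraHom_single_one] using h g
  | add f g hf hg => simp only [map_add, hf, hg]; ring
  | smul r f hf => simp only [map_smul, hf, smul_add]

theorem Irr.finrank_le_of_ker_le [IsAlgClosed k] [Finite G] [FiniteDimensional k V]
    {ρ : Representation k G V} (h : Irr ρ) {V₁ : Type} [AddCommGroup V₁] [Module k V₁] [FiniteDimensional k V₁]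
    (ρ₁ : Representation k G V₁) (hle : ∀ a, ρ₁.asAlgebraHom a = 0 → ρ.asAlgebraHom a = 0) :
    finrank k V ≤ finrank k V₁ := by
  have h1 := LinearMap.range_eq_top.mpr (show Function.Surjective ρ.asAlgebraHom.toLinearMap from h.burnside)
  have h2 := LinearMap.finrank_range_add_finrank_ker ρ.asAlgebraHom.toLinearMap
  have h3 := LinearMap.finrank_range_add_finrank_ker ρ₁.asAlgebraHom.toLinearMap
  have h4 : LinearMap.ker ρ₁.asAlgebraHom.toLinearMap ≤ LinearMap.ker ρ.asAlgebraHom.toLinearMap :=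
    fun a ha => hle a ha
  have h5 := Submodule.finrank_mono h4
  have h6 := Submodule.finrank_le (LinearMap.range ρ₁.asAlgebraHom.toLinearMap)
  rw [h1, finrank_top] at h2
  rw [Module.finrank_linearMap] at h2 h6
  by_contra hlt
  push Not at hlt
  have := Nat.mul_lt_mul'' hlt hlt
  omega

/-- An irreducible trace function is not the sum of two trace functions of smaller degree. -/
theorem Irr.trace_ne_add [IsAlgClosed k] [Finite G] [FiniteDimensional k V]
    {ρ : Representation k G V} (h : Irr ρ) {V₁ V₂ : Type} [AddCommGroup V₁] [Module k V₁]
    [AddCommGroup V₂] [Module k V₂] [FiniteDimensional k V₁] [FiniteDimensional k V₂]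
    (ρ₁ : Representation k G V₁) (ρ₂ : Representation k G V₂)
    (h₁ : finrank k V₁ < finrank k V) (h₂ : finrank k V₂ < finrank k V) :
    ¬ ∀ g, LinearMap.trace k V (ρ g) =
      LinearMap.trace k V₁ (ρ₁ g) + LinearMap.trace k V₂ (ρ₂ g) := by
  intro ht
  have ht' := trace_asAlgebraHom_eq ρ ρ₁ ρ₂ ht
  have hab : ∀ a b, ρ₁.asAlgebraHom a = 0 → ρ₂.asAlgebraHom b = 0 →
      ρ.asAlgebraHom a = 0 ∨ ρ.asAlgebraHom b = 0 := by
    intro a b ha hb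
    apply eq_zero_or_eq_zero_of_comp
    intro g
    apply eq_zero_of_trace_mul_eq_zero
    intro g'
    obtain ⟨c, rfl⟩ := h.burnside g
    obtain ⟨d, rfl⟩ := h.burnside g'
    have h3 := ht' (a * (c * b) * d)
    simp only [map_mul, ha, hb, zero_mul, mul_zero, map_zero, add_zero] at h3
    exact h3
  by_cases hc : ∀ a, ρ₁.asAlgebraHom a = 0 → ρ.asAlgebraHom a = 0
  · exact absurd (h.finrank_le_of_ker_le ρ₁ hc) (by omega)
  · push Not at hc
    obtain ⟨a, ha, ha'⟩ := hc
    exact absurd (h.finrank_le_of_ker_le ρ₂ fun b hb => (hab a b ha hb).resolve_left ha') (by omega)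
end TraceSeparation

section Isotypic
open Module

variable {k : Type} [Field k] {G : Type} [Group G] {V : Type} [AddCommGroup V] [Module k V]
  {W : Type} [AddCommGroup W] [Module k W] {W' : Type} [AddCommGroup W'] [Module k W']

/-- The space of intertwining maps. -/
def homs (σ : Representation k G W) (ρ : Representation k G V) : Submodule k (W →ₗ[k] V) where
  carrier := {f | ∀ g w, f (σ g w) = ρ g (f w)}
  add_mem' := by
    intro a b ha hb g w
    rw [LinearMap.add_apply, ha, hb, LinearMap.add_apply, map_add]
  zero_mem' := by intro g w; simp
  smul_mem' := by
    intro c a ha g w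
    rw [LinearMap.smul_apply, ha, LinearMap.smul_apply, map_smul]

/-- The span of the values of a space of linear maps. -/
def spanOf (E : Submodule k (W →ₗ[k] V)) : Submodule k V := Submodule.map₂ LinearMap.id E ⊤

theorem apply_mem_spanOf {E : Submodule k (W →ₗ[k] V)} {f : W →ₗ[k] V} (hf : f ∈ E) (w : W) :
    f w ∈ spanOf E := Submodule.apply_mem_map₂ LinearMap.id hf trivial

theorem range_le_spanOf {E : Submodule k (W →ₗ[k] V)} {f : W →ₗ[k] V} (hf : f ∈ E) :
    LinearMap.range f ≤ spanOf E := by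
  rintro _ ⟨w, rfl⟩; exact apply_mem_spanOf hf w

theorem spanOf_le {E : Submodule k (W →ₗ[k] V)} {U : Submodule k V} :
    spanOf E ≤ U ↔ ∀ f ∈ E, ∀ w, f w ∈ U := by
  rw [spanOf, Submodule.map₂_le]; simp

theorem spanOf_sup (E E' : Submodule k (W →ₗ[k] V)) : spanOf (E ⊔ E') = spanOf E ⊔ spanOf E' :=
  Submodule.map₂_sup_left _ _ _ _

theorem spanOf_sSup (S : Set (Submodule k (W →ₗ[k] V))) : spanOf (sSup S) = sSup (spanOf '' S) := by
  rw [sSup_image, sSup_eq_iSup]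
  simp only [spanOf, Submodule.map₂_iSup_left]

theorem homs_asAlgebraHom {σ : Representation k G W} {ρ : Representation k G V} {f : W →ₗ[k] V}
    (hf : f ∈ homs σ ρ) (a : MonoidAlgebra k G) (w : W) :
    f (σ.asAlgebraHom a w) = ρ.asAlgebraHom a (f w) := by
  induction a using MonoidAlgebra.induction_on with
  | of g => simpa [Representation.asAlgebraHom_single_one] using hf g w
  | add a b ha hb => simp only [map_add, LinearMap.add_apply, ha, hb]
  | smul r a ha => simp only [map_smul, LinearMap.smul_apply, ha]

theorem linearIndependent_homs [IsAlgClosed k] [FiniteDimensional k W] {σ : Representation k G W}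
    (hσ : Irr σ) {ρ : Representation k G V} {J ι : Type} [Fintype J] [Fintype ι]
    {f : J → W →ₗ[k] V} (hf : ∀ j, f j ∈ homs σ ρ) (hli : LinearIndependent k f)
    (b : Basis ι k W) : LinearIndependent k (fun ji : J × ι => f ji.1 (b ji.2)) := by
  rw [Fintype.linearIndependent_iff] at hli ⊢
  rintro c hc ⟨j, i₀⟩
  refine hli (fun j => c (j, i₀)) ?_ j
  ext w
  obtain ⟨a, ha⟩ := hσ.burnside ((b.coord i₀).smulRight w)
  have h1 := congrArg (ρ.asAlgebraHom a) hc
  rw [map_zero, map_sum] at h1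
  rw [LinearMap.zero_apply, ← h1, Fintype.sum_prod_type, LinearMap.sum_apply]
  refine Finset.sum_congr rfl fun j _ => ?_
  rw [Finset.sum_eq_single i₀]
  · rw [map_smul, ← homs_asAlgebraHom (hf j), ha]; simp
  · intro i _ hi
    rw [map_smul, ← homs_asAlgebraHom (hf j), ha]; simp [hi.symm]
  · simp

/-- A basis of the span of a space of intertwining maps out of an irreducible representation. -/
def spanBasis [IsAlgClosed k] [FiniteDimensional k W] {σ : Representation k G W}
    (hσ : Irr σ) {ρ : Representation k G V} {J ι : Type} [Fintype J] [Fintype ι]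
    {E : Submodule k (W →ₗ[k] V)} (hE : E ≤ homs σ ρ) (bE : Basis J k E) (b : Basis ι k W) :
    Basis (J × ι) k (spanOf E) :=
  Basis.mk (v := fun ji : J × ι => (⟨(bE ji.1 : W →ₗ[k] V) (b ji.2),
      apply_mem_spanOf (bE ji.1).2 _⟩ : spanOf E))
    (by
      have h1 : LinearIndependent k (fun j => (bE j : W →ₗ[k] V)) :=
        bE.linearIndependent.map' E.subtype (Submodule.ker_subtype E)
      exact LinearIndependent.of_comp (spanOf E).subtype
        (linearIndependent_homs hσ (fun j => hE (bE j).2) h1 b))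
    (by
      rintro ⟨v, hv⟩ -
      have hE' : E = Submodule.span k (Set.range fun j => (bE j : W →ₗ[k] V)) := by
        have h1 := congrArg (Submodule.map E.subtype) bE.span_eq
        rw [Submodule.map_span, Submodule.map_top, Submodule.range_subtype, ← Set.range_comp] at h1
        exact h1.symm
      have hv' := hv
      rw [spanOf, hE', ← b.span_eq, Submodule.map₂_span_span] at hv'
      have h2 : (⟨v, hv⟩ : spanOf E) ∈ Submodule.span k (Set.range fun ji : J × ι =>
          (⟨(bE ji.1 : W →ₗ[k] V) (b ji.2), apply_mem_spanOf (bE ji.1).2 _⟩ : spanOf E)) ↔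
          v ∈ Submodule.map (spanOf E).subtype (Submodule.span k (Set.range fun ji : J × ι =>
          (⟨(bE ji.1 : W →ₗ[k] V) (b ji.2), apply_mem_spanOf (bE ji.1).2 _⟩ : spanOf E))) := by
        simp [hv]
      rw [h2, Submodule.map_span, ← Set.range_comp]
      refine Submodule.span_mono ?_ hv'
      rintro _ ⟨_, ⟨j, rfl⟩, _, ⟨i, rfl⟩, rfl⟩
      exact ⟨(j, i), rfl⟩)

theorem spanBasis_apply [IsAlgClosed k] [FiniteDimensional k W] {σ : Representation k G W}
    (hσ : Irr σ) {ρ : Representation k G V} {J ι : Type} [Fintype J] [Fintype ι]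
    {E : Submodule k (W →ₗ[k] V)} (hE : E ≤ homs σ ρ) (bE : Basis J k E) (b : Basis ι k W) (ji : J × ι) :
    (spanBasis hσ hE bE b ji : V) = (bE ji.1 : W →ₗ[k] V) (b ji.2) := by
  rw [spanBasis, Basis.mk_apply]

theorem finrank_spanOf [IsAlgClosed k] [FiniteDimensional k W] [FiniteDimensional k V] {σ : Representation k G W}
    (hσ : Irr σ) {ρ : Representation k G V} {E : Submodule k (W →ₗ[k] V)} (hE : E ≤ homs σ ρ) :
    finrank k (spanOf E) = finrank k E * finrank k W := by
  rw [finrank_eq_card_basis (spanBasis hσ hE (finBasis k E) (finBasis k W))]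
  simp

theorem spanOf_disjoint [IsAlgClosed k] [FiniteDimensional k W] [FiniteDimensional k V] {σ : Representation k G W}
    (hσ : Irr σ) {ρ : Representation k G V} {E E' : Submodule k (W →ₗ[k] V)} (hE : E ≤ homs σ ρ)
    (hE' : E' ≤ homs σ ρ) (h : Disjoint E E') : Disjoint (spanOf E) (spanOf E') := by
  have h1 := Submodule.finrank_sup_add_finrank_inf_eq E E'
  have h2 := Submodule.finrank_sup_add_finrank_inf_eq (spanOf E) (spanOf E')
  rw [← spanOf_sup, finrank_spanOf hσ (sup_le hE hE'), finrank_spanOf hσ hE,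
    finrank_spanOf hσ hE'] at h2
  rw [disjoint_iff.mp h, finrank_bot, add_zero] at h1
  rw [disjoint_iff, ← Submodule.finrank_eq_zero (R := k)]
  rw [h1, add_mul] at h2
  omega

theorem spanOf_homs_le_of_range_eq {σ : Representation k G W} {σ' : Representation k G W'}
    {ρ : Representation k G V} {f : W →ₗ[k] V} (hf : f ∈ homs σ ρ) (hfi : Function.Injective f)
    {f' : W' →ₗ[k] V} (hf' : f' ∈ homs σ' ρ)
    (hr : LinearMap.range f = LinearMap.range f') :
    spanOf (homs σ ρ) ≤ spanOf (homs σ' ρ) := by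
  let φ : W' →ₗ[k] W := (LinearEquiv.ofInjective f hfi).symm.toLinearMap ∘ₗ
    (f'.codRestrict (LinearMap.range f) fun c => by rw [hr]; exact ⟨c, rfl⟩)
  have hφ : ∀ c, f (φ c) = f' c := by
    intro c
    have := LinearEquiv.apply_symm_apply (LinearEquiv.ofInjective f hfi)
      (f'.codRestrict (LinearMap.range f) (fun c => by rw [hr]; exact ⟨c, rfl⟩) c)
    exact congrArg Subtype.val this
  rw [spanOf_le]
  intro h hh w
  obtain ⟨c, hc⟩ : f w ∈ LinearMap.range f' := by rw [← hr]; exact ⟨w, rfl⟩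
  have hw : φ c = w := hfi (by rw [hφ, hc])
  have hmem : h ∘ₗ φ ∈ homs σ' ρ := by
    intro g c
    have : φ (σ' g c) = σ g (φ c) := hfi (by rw [hφ, hf' g c, hf g, hφ])
    rw [LinearMap.comp_apply, this, hh]; rfl
  have := apply_mem_spanOf hmem c
  rwa [LinearMap.comp_apply, hw] at this

/-- The isotypic component of an irreducible invariant subspace. -/
def isoComp (ρ : Representation k G V) (C : Submodule k V) (hC : InvSub ρ C) : Submodule k V :=
  spanOf (homs (subRep ρ C hC) ρ)

theorem subtype_mem_homs {ρ : Representation k G V} {C : Submodule k V} (hC : InvSub ρ C) :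
    C.subtype ∈ homs (subRep ρ C hC) ρ := fun _ _ => rfl

theorem le_isoComp {ρ : Representation k G V} {C : Submodule k V} (hC : InvSub ρ C) :
    C ≤ isoComp ρ C hC := by
  have := range_le_spanOf (subtype_mem_homs hC)
  rwa [Submodule.range_subtype] at this

theorem isoComp_eq_sSup [FiniteDimensional k V] {ρ : Representation k G V} {B : Set (Submodule k V)} (hB : Dec B)
    (hI : ∀ D ∈ B, IrrSub ρ D) {C : Submodule k V} (hC : IrrSub ρ C) :
    isoComp ρ C hC.1 =
      sSup {D ∈ B | ∃ f ∈ homs (subRep ρ C hC.1) ρ, LinearMap.range f = D} := by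
  apply le_antisymm
  · rw [isoComp, spanOf_le]
    intro f hf w
    have h1 := congrArg (fun e : V →ₗ[k] V => e (f w)) hB.sum_proj
    simp only [LinearMap.sum_apply, LinearMap.id_apply] at h1
    rw [← h1]
    refine Submodule.sum_mem _ fun D hD => ?_
    replace hD : D ∈ B := by simpa using hD
    have hfD : bproj B D ∘ₗ f ∈ homs (subRep ρ C hC.1) ρ := by
      intro g w
      have h2 := hB.proj_comp (rho_injective ρ g)
        (fun D hD => by rw [(hI D hD).1.map_eq]; exact hD) hD
      have h3 := congrArg (fun e : V →ₗ[k] V => e (f w)) h2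
      rw [(hI D hD).1.map_eq] at h3
      simp only [LinearMap.comp_apply] at h3
      rw [LinearMap.comp_apply, hf g w, ← h3]; rfl
    by_cases h0 : bproj B D ∘ₗ f = 0
    · have := congrArg (fun e : C →ₗ[k] V => e w) h0
      simp only [LinearMap.comp_apply, LinearMap.zero_apply] at this
      rw [this]; exact Submodule.zero_mem _
    · have hle : LinearMap.range (bproj B D ∘ₗ f) ≤ D := by
        rintro _ ⟨w, rfl⟩; exact hB.proj_mem hD _
      have heq := ((hI D hD).2.2 _ (inv_range _ hfD) hle).resolve_left
        fun h => h0 (LinearMap.range_eq_bot.mp h)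
      exact (le_sSup (⟨hD, _, hfD, heq⟩ : D ∈ {D ∈ B | ∃ f ∈ homs (subRep ρ C hC.1) ρ,
        LinearMap.range f = D}) : D ≤ _) (hB.proj_mem hD _)
  · apply sSup_le
    rintro D ⟨_, f, hf, rfl⟩
    exact range_le_spanOf hf

theorem dec_isoComp [FiniteDimensional k V] {ρ : Representation k G V}
    (h : sSup {C | IrrSub ρ C} = ⊤) :
    Dec {U | ∃ (C : Submodule k V) (hC : IrrSub ρ C), U = isoComp ρ C hC.1} := by
  obtain ⟨B, hB, hI⟩ := exists_dec_irrSub ρ h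
  constructor
  · rintro U ⟨C, hC, rfl⟩
    have hle : sSup ({U | ∃ (C : Submodule k V) (hC : IrrSub ρ C), U = isoComp ρ C hC.1} \
        {isoComp ρ C hC.1}) ≤
        sSup {D ∈ B | ¬ ∃ f ∈ homs (subRep ρ C hC.1) ρ, LinearMap.range f = D} := by
      apply sSup_le
      rintro _ ⟨⟨C', hC', rfl⟩, hne⟩
      rw [isoComp_eq_sSup hB hI hC']
      apply sSup_le_sSup
      rintro D ⟨hD, f', hf', hr'⟩
      refine ⟨hD, ?_⟩
      rintro ⟨f, hf, hr⟩
      apply hne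
      have hD0 := (hI D hD).2.1
      have hfi := hC.irr.injective f hf (fun h0 => hD0 (by rw [← hr, h0, LinearMap.range_zero]))
      have hfi' := hC'.irr.injective f' hf' (fun h0 => hD0 (by rw [← hr', h0, LinearMap.range_zero]))
      exact le_antisymm (spanOf_homs_le_of_range_eq hf' hfi' hf (by rw [hr, hr']))
        (spanOf_homs_le_of_range_eq hf hfi hf' (by rw [hr, hr']))
    refine Disjoint.mono_right hle ?_
    rw [isoComp_eq_sSup hB hI hC]
    refine hB.disjoint_sSup (fun _ h => h.1) (fun _ h => h.1) ?_
    rw [Set.disjoint_left]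
    exact fun D h1 h2 => h2.2 h1.2
  · rw [eq_top_iff, ← h]
    apply sSup_le
    intro C hC
    exact (le_isoComp hC.1).trans (le_sSup ⟨C, hC, rfl⟩)
end Isotypic

section Imprimitivity
open Module

variable {k : Type} [Field k] {G : Type} [Group G] {V : Type} [AddCommGroup V] [Module k V]
  {W : Type} [AddCommGroup W] [Module k W]

theorem map_sSup_submodule (f : W →ₗ[k] V) (B : Set (Submodule k W)) :
    (sSup B).map f = sSup (Submodule.map f '' B) := by
  rw [sSup_image, sSup_eq_iSup]
  simp only [Submodule.map_iSup]

theorem sSupIndep_image {f : W →ₗ[k] V} (hf : Function.Injective f) {B : Set (Submodule k W)}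
    (hB : sSupIndep B) : sSupIndep (Submodule.map f '' B) := by
  rintro _ ⟨C, hC, rfl⟩
  have h1 : Submodule.map f '' B \ {Submodule.map f C} = Submodule.map f '' (B \ {C}) := by
    rw [Set.image_sdiff (Submodule.map_injective_of_injective hf), Set.image_singleton]
  rw [h1, ← map_sSup_submodule]
  exact Submodule.disjoint_map hf (hB hC)

/-- The orbit of a subspace under a representation. -/
def orb (ρ : Representation k G V) (C : Submodule k V) : Set (Submodule k V) :=
  Set.range fun g => C.map (ρ g)

theorem map_map_rho (ρ : Representation k G V) (g h : G) (C : Submodule k V) :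
    (C.map (ρ h)).map (ρ g) = C.map (ρ (g * h)) := by
  rw [map_mul, ← Submodule.map_comp]; rfl

theorem map_rho_one (ρ : Representation k G V) (C : Submodule k V) : C.map (ρ 1) = C := by
  rw [map_one]; exact Submodule.map_id C

theorem mem_orb_self (ρ : Representation k G V) (C : Submodule k V) : C ∈ orb ρ C :=
  ⟨1, map_rho_one ρ C⟩

theorem map_mem_orb {ρ : Representation k G V} {C D : Submodule k V} (h : D ∈ orb ρ C) (g : G) :
    D.map (ρ g) ∈ orb ρ C := by
  obtain ⟨h, rfl⟩ := h
  exact ⟨g * h, (map_map_rho ρ g h C).symm⟩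

theorem invSub_sSup_of_perm {ρ : Representation k G V} {B : Set (Submodule k V)}
    (hB : ∀ g, ∀ C ∈ B, C.map (ρ g) ∈ B) : InvSub ρ (sSup B) := by
  intro g
  have : sSup B ≤ (sSup B).comap (ρ g) := by
    apply sSup_le
    intro W hW v hv
    exact (le_sSup (hB g W hW) : W.map (ρ g) ≤ sSup B) ⟨v, hv, rfl⟩
  exact fun v hv => this hv

theorem sSup_orb_eq_top {ρ : Representation k G V} (h : Irr ρ) {C : Submodule k V} (hC : C ≠ ⊥) :
    sSup (orb ρ C) = ⊤ := by
  refine (h.2 _ (invSub_sSup_of_perm fun g D hD => map_mem_orb hD g)).resolve_left fun h0 => hC ?_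
  rw [eq_bot_iff, ← h0]
  exact le_sSup (mem_orb_self ρ C)

theorem sSupIndep.dec_orb {ρ : Representation k G V} (h : Irr ρ) {B : Set (Submodule k V)}
    (hB : sSupIndep B) (hp : ∀ g, ∀ C ∈ B, C.map (ρ g) ∈ B) {C : Submodule k V} (hC : C ∈ B)
    (h0 : C ≠ ⊥) : Dec (orb ρ C) := by
  refine ⟨hB.mono ?_, sSup_orb_eq_top h h0⟩
  rintro _ ⟨g, rfl⟩
  exact hp g C hC

/-- The stabilizer of a subspace. -/
def stab (ρ : Representation k G V) (C : Submodule k V) : Subgroup G where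
  carrier := {g | C.map (ρ g) = C}
  mul_mem' := by
    intro a b ha hb
    change C.map (ρ (a * b)) = C
    rw [← map_map_rho, hb, ha]
  one_mem' := map_rho_one ρ C
  inv_mem' := by
    intro a ha
    change C.map (ρ a⁻¹) = C
    have ha' : C.map (ρ a) = C := ha
    conv_lhs => rw [← ha']
    rw [map_map_rho, inv_mul_cancel, map_rho_one]

theorem mem_stab {ρ : Representation k G V} {C : Submodule k V} {g : G} :
    g ∈ stab ρ C ↔ C.map (ρ g) = C := Iff.rfl

theorem stab_inv (ρ : Representation k G V) (C : Submodule k V) :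
    InvSub (ρ.comp (stab ρ C).subtype) C := by
  intro g v hv
  have h1 : C.map (ρ g) = C := g.2
  have h2 : ρ g v ∈ C.map (ρ g) := ⟨v, hv, rfl⟩
  rwa [h1] at h2

/-- The representation of the stabilizer of a subspace on that subspace. -/
def stabRep (ρ : Representation k G V) (C : Submodule k V) : Representation k (stab ρ C) C :=
  subRep (ρ.comp (stab ρ C).subtype) C (stab_inv ρ C)

theorem stabRep_coe (ρ : Representation k G V) (C : Submodule k V) (g : stab ρ C) (c : C) :
    ((stabRep ρ C g c : C) : V) = ρ g c := rfl

theorem irr_stabRep {ρ : Representation k G V} (h : Irr ρ) {C : Submodule k V}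
    (hC : C ≠ ⊥) (hd : Dec (orb ρ C)) : Irr (stabRep ρ C) := by
  refine ⟨Submodule.nontrivial_iff_ne_bot.mpr hC, fun U hU => ?_⟩
  by_cases hU0 : U = ⊥
  · exact Or.inl hU0
  right
  have h1 : U.map C.subtype ≠ ⊥ := fun h0 => hU0
    (Submodule.map_injective_of_injective C.subtype_injective (by rw [h0, Submodule.map_bot]))
  have h2 := sSup_orb_eq_top h h1
  have h3 : sSup (orb ρ (U.map C.subtype)) ≤ (U.map C.subtype).comap (bproj (orb ρ C) C) := by
    apply sSup_le
    rintro _ ⟨g, rfl⟩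
    rintro _ ⟨_, ⟨u, hu, rfl⟩, rfl⟩
    rw [Submodule.mem_comap]
    by_cases hg : g ∈ stab ρ C
    · have h4 : ρ g (C.subtype u) ∈ C := stab_inv ρ C ⟨g, hg⟩ u u.2
      rw [hd.proj_self (mem_orb_self ρ C) h4]
      exact ⟨stabRep ρ C ⟨g, hg⟩ u, hU ⟨g, hg⟩ u hu, rfl⟩
    · rw [hd.proj_other (mem_orb_self ρ C) ⟨g, rfl⟩ hg (⟨u, u.2, rfl⟩ : ρ g (C.subtype u) ∈ C.map (ρ g))]
      exact Submodule.zero_mem _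
  rw [h2] at h3
  rw [eq_top_iff]
  intro c _
  have h4 : (c : V) ∈ (U.map C.subtype).comap (bproj (orb ρ C) C) := h3 trivial
  rw [Submodule.mem_comap, hd.proj_self (mem_orb_self ρ C) c.2] at h4
  obtain ⟨u, hu, h5⟩ := h4
  have : u = c := Subtype.ext h5
  exact this ▸ hu

/-- There is a system of imprimitivity whose blocks have dimension prime to `p`. -/
def HasRegularBlocks (p : ℕ) (ρ : Representation k G V) : Prop :=
  ∃ B : Set (Submodule k V), Dec B ∧ (∀ g, ∀ C ∈ B, C.map (ρ g) ∈ B) ∧ ∀ C ∈ B, ¬ p ∣ finrank k C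

theorem hasRegularBlocks_of_stab {p : ℕ} {ρ : Representation k G V} {C : Submodule k V}
    (hd : Dec (orb ρ C)) (h : HasRegularBlocks p (stabRep ρ C)) : HasRegularBlocks p ρ := by
  obtain ⟨B, hB, hperm, hdim⟩ := h
  let B' : Set (Submodule k V) := Submodule.map C.subtype '' B
  have hB' : sSupIndep B' := sSupIndep_image C.subtype_injective hB.1
  have hBs : sSup B' = C := by
    rw [← map_sSup_submodule, hB.2, Submodule.map_top, Submodule.range_subtype]
  have hperm' : ∀ g ∈ stab ρ C, ∀ D ∈ B', D.map (ρ g) ∈ B' := by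
    rintro g hg _ ⟨D, hD, rfl⟩
    refine ⟨D.map (stabRep ρ C ⟨g, hg⟩), hperm _ D hD, ?_⟩
    rw [← Submodule.map_comp, ← Submodule.map_comp]
    rfl
  let F : Submodule k V → Set (Submodule k V) := fun U =>
    {E | ∃ g, C.map (ρ g) = U ∧ E ∈ Submodule.map (ρ g) '' B'}
  have hF : ∀ g, F (C.map (ρ g)) = Submodule.map (ρ g) '' B' := by
    intro g
    ext E
    constructor
    · rintro ⟨g', hg', D, hD, rfl⟩
      have ht : g⁻¹ * g' ∈ stab ρ C := by
        rw [mem_stab, ← map_map_rho, hg', map_map_rho, inv_mul_cancel, map_rho_one]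
      refine ⟨D.map (ρ (g⁻¹ * g')), hperm' _ ht D hD, ?_⟩
      rw [map_map_rho, mul_inv_cancel_left]
    · rintro ⟨D, hD, rfl⟩
      exact ⟨g, rfl, D, hD, rfl⟩
  refine ⟨{E | ∃ U ∈ orb ρ C, E ∈ F U}, hd.refine F ?_, ?_, ?_⟩
  · rintro _ ⟨g, rfl⟩
    simp only [hF g]
    refine ⟨sSupIndep_image (rho_injective ρ g) hB', ?_⟩
    rw [← map_sSup_submodule, hBs]
  · rintro g E ⟨U, hU, g', rfl, D, hD, rfl⟩
    refine ⟨_, map_mem_orb hU g, g * g', (map_map_rho _ _ _ _).symm, D, hD, (map_map_rho _ _ _ _).symm⟩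
  · rintro E ⟨U, hU, g', rfl, _, ⟨D, hD, rfl⟩, rfl⟩
    have h1 := (Submodule.equivMapOfInjective (ρ g' ∘ₗ C.subtype)
      ((rho_injective ρ g').comp C.subtype_injective) D).finrank_eq
    rw [← Submodule.map_comp, ← h1]
    exact hdim D hD

theorem IrrSub.map {ρ : Representation k G V} {N : Subgroup G} [hN : N.Normal] {C : Submodule k V}
    (h : IrrSub (ρ.comp N.subtype) C) (g : G) : IrrSub (ρ.comp N.subtype) (C.map (ρ g)) := by
  have key : ∀ (D : Submodule k V) (g : G), InvSub (ρ.comp N.subtype) D →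
      InvSub (ρ.comp N.subtype) (D.map (ρ g)) := by
    rintro D g hD n _ ⟨v, hv, rfl⟩
    refine ⟨ρ (g⁻¹ * n * g) v, hD ⟨g⁻¹ * n * g, by simpa using hN.conj_mem n n.2 g⁻¹⟩ v hv, ?_⟩
    rw [← rho_mul_apply]
    change _ = ρ n (ρ g v)
    rw [← rho_mul_apply]
    congr 2; group
  refine ⟨key _ _ h.1, fun h0 => h.2.1 ?_, fun D hD hDC => ?_⟩
  · exact Submodule.map_injective_of_injective (rho_injective ρ g) (by rw [h0, Submodule.map_bot])
  · have h1 : D.map (ρ g⁻¹) ≤ C := by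
      have := Submodule.map_mono (f := ρ g⁻¹) hDC
      rwa [map_map_rho, inv_mul_cancel, map_rho_one] at this
    have h2 : (D.map (ρ g⁻¹)).map (ρ g) = D := by rw [map_map_rho, mul_inv_cancel, map_rho_one]
    rcases h.2.2 _ (key _ _ hD) h1 with h3 | h3
    · left; rw [← h2, h3, Submodule.map_bot]
    · right; rw [← h2, h3]

theorem sSup_irrSub_eq_top [FiniteDimensional k V] {ρ : Representation k G V} (h : Irr ρ) (N : Subgroup G)
    [hN : N.Normal] : sSup {C | IrrSub (ρ.comp N.subtype) C} = ⊤ := by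
  have := h.1
  obtain ⟨C, -, hC⟩ := exists_irrSub (ρ.comp N.subtype) (W := ⊤) (fun _ _ _ => trivial) top_ne_bot
  rw [eq_top_iff, ← sSup_orb_eq_top h hC.2.1]
  apply sSup_le_sSup
  rintro _ ⟨g, rfl⟩
  exact hC.map g

theorem isoComp_map_le {ρ : Representation k G V} {N : Subgroup G} [hN : N.Normal] {C : Submodule k V}
    (h : IrrSub (ρ.comp N.subtype) C) (g : G) :
    (isoComp _ C h.1).map (ρ g) ≤ isoComp _ (C.map (ρ g)) (h.map g).1 := by
  rw [Submodule.map_le_iff_le_comap, isoComp, spanOf_le]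
  intro f hf w
  rw [Submodule.mem_comap]
  let e : C.map (ρ g) →ₗ[k] C := (ρ g⁻¹).restrict (by rintro _ ⟨v, hv, rfl⟩; simpa using hv)
  have hmem : (ρ g) ∘ₗ f ∘ₗ e ∈ homs (subRep (ρ.comp N.subtype) (C.map (ρ g)) (h.map g).1)
      (ρ.comp N.subtype) := by
    intro n c
    have hn : g⁻¹ * n * g ∈ N := by simpa using hN.conj_mem n n.2 g⁻¹
    have h1 : e (subRep (ρ.comp N.subtype) (C.map (ρ g)) (h.map g).1 n c) =
        subRep (ρ.comp N.subtype) C h.1 ⟨_, hn⟩ (e c) := by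
      apply Subtype.ext
      change ρ g⁻¹ (ρ n c) = ρ (g⁻¹ * n * g) (ρ g⁻¹ c)
      rw [← rho_mul_apply, ← rho_mul_apply]
      congr 2; group
    simp only [LinearMap.comp_apply]
    rw [h1, hf]
    change ρ g (ρ (g⁻¹ * n * g) _) = ρ n (ρ g _)
    rw [← rho_mul_apply, ← rho_mul_apply]
    congr 2; group
  have := apply_mem_spanOf hmem ⟨ρ g w, ⟨w, w.2, rfl⟩⟩
  have he : e ⟨ρ g w, ⟨w, w.2, rfl⟩⟩ = w := Subtype.ext (by
    change ρ g⁻¹ (ρ g w) = w; simp)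
  simp only [LinearMap.comp_apply, he] at this
  exact this

/-- Clifford's theorem: the restriction of an irreducible representation to a normal subgroup is
homogeneous, or its isotypic components form a system of imprimitivity. -/
theorem Irr.clifford [FiniteDimensional k V] {ρ : Representation k G V} (h : Irr ρ) (N : Subgroup G)
    [hN : N.Normal] :
    (∃ (C : Submodule k V) (hC : IrrSub (ρ.comp N.subtype) C), isoComp _ C hC.1 = ⊤) ∨
      ∃ U : Submodule k V, U ≠ ⊥ ∧ U ≠ ⊤ ∧ Dec (orb ρ U) := by
  have := h.1
  have hd := dec_isoComp (sSup_irrSub_eq_top h N)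
  obtain ⟨C, -, hC⟩ := exists_irrSub (ρ.comp N.subtype) (W := ⊤) (fun _ _ _ => trivial) top_ne_bot
  by_cases hT : isoComp _ C hC.1 = ⊤
  · exact Or.inl ⟨C, hC, hT⟩
  · have h0 : isoComp _ C hC.1 ≠ ⊥ := fun h0 => hC.2.1 (le_bot_iff.mp (h0 ▸ le_isoComp hC.1))
    refine Or.inr ⟨_, h0, hT, sSupIndep.dec_orb h hd.1 ?_ ⟨C, hC, rfl⟩ h0⟩
    rintro g _ ⟨D, hD, rfl⟩
    refine ⟨D.map (ρ g), hD.map g, le_antisymm (isoComp_map_le hD g) ?_⟩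
    have h1 := isoComp_map_le (hD.map g) g⁻¹
    have h2 : (D.map (ρ g)).map (ρ g⁻¹) = D := by
      rw [map_map_rho, inv_mul_cancel, map_rho_one]
    simp only [h2] at h1
    have h3 := Submodule.map_mono (f := ρ g) h1
    rwa [map_map_rho, mul_inv_cancel, map_rho_one] at h3
end Imprimitivity

section FixedBlocks
open Module

theorem sum_eq_zero_of_fixedPoints_eq_empty {p : ℕ} [Fact p.Prime] {P : Type} [Group P] (hP : IsPGroup p P)
    {α : Type} [Fintype α] [MulAction P α] {k : Type} [Field k] [CharP k p] (t : α → k)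
    (ht : ∀ (g : P) a, t (g • a) = t a) (h0 : ∀ a : α, ∃ g : P, g • a ≠ a) : ∑ a, t a = 0 := by
  have h1 := Finset.sum_comp (s := (Finset.univ : Finset α)) (fun x : k => x) t
  rw [h1]
  refine Finset.sum_eq_zero fun c _ => ?_
  let A : SubMulAction P α := ⟨{a | t a = c}, fun g a (ha : t a = c) => (ht g a).trans ha⟩
  have h2 := hP.card_modEq_card_fixedPoints A
  have h3 : Nat.card (MulAction.fixedPoints P A) = 0 := by
    rw [Nat.card_eq_zero]
    left
    refine ⟨?_⟩
    rintro ⟨a, ha⟩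
    obtain ⟨g, hg⟩ := h0 a
    exact hg (congrArg Subtype.val (ha g))
  rw [h3] at h2
  have h4 : (Finset.univ.filter fun a => t a = c).card = Nat.card A := by
    rw [Nat.card_eq_fintype_card]
    exact (Fintype.card_subtype _).symm
  rw [h4, nsmul_eq_mul, (CharP.cast_eq_zero_iff k p _).mpr ((Nat.modEq_zero_iff_dvd).mp h2), zero_mul]

variable {k : Type} [Field k] {G : Type} [Group G] {V : Type} [AddCommGroup V] [Module k V]

theorem Dec.trace_proj [FiniteDimensional k V] {B : Set (Submodule k V)} (hB : Dec B) {C : Submodule k V}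
    (hC : C ∈ B) : LinearMap.trace k V (bproj B C) = finrank k C := by
  refine LinearMap.IsProj.trace (p := C) ⟨hB.proj_mem hC, fun v hv => hB.proj_self hC hv⟩

/-- If a `p`-group permutes the members of two decompositions and fixes a member of the first whose
dimension is prime to `p`, then it fixes a member of the second. -/
theorem exists_fixed_member {p : ℕ} [Fact p.Prime] [CharP k p] [FiniteDimensional k V]
    (hP : IsPGroup p G) (ρ : Representation k G V) {A B : Set (Submodule k V)} (hA : Dec A) (hB : Dec B)
    (hpA : ∀ g, ∀ C ∈ A, C.map (ρ g) ∈ A) (hpB : ∀ g, ∀ C ∈ B, C.map (ρ g) ∈ B)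
    {S : Submodule k V} (hS : S ∈ A) (hfix : ∀ g, S.map (ρ g) = S) (hdim : ¬ p ∣ finrank k S) :
    ∃ C ∈ B, ∀ g, C.map (ρ g) = C := by
  by_contra hcon
  push Not at hcon
  have : Fintype B := hB.finite.fintype
  let act : MulAction G B :=
    { smul := fun g C => ⟨(C : Submodule k V).map (ρ g), hpB g C C.2⟩
      one_smul := fun C => Subtype.ext (map_rho_one ρ C)
      mul_smul := fun g h C => Subtype.ext (map_map_rho ρ g h C).symm }
  have hsm : ∀ (g : G) (C : B), ((g • C : B) : Submodule k V) = (C : Submodule k V).map (ρ g) :=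
    fun _ _ => rfl
  have hcomm : ∀ g, bproj A S ∘ₗ ρ g = ρ g ∘ₗ bproj A S := by
    intro g
    have h1 := hA.proj_comp (rho_injective ρ g) (hpA g) hS
    rw [hfix g] at h1
    exact h1.symm
  have hsum := sum_eq_zero_of_fixedPoints_eq_empty hP (k := k)
    (fun C : B => LinearMap.trace k V (bproj B C ∘ₗ bproj A S)) (by
      intro g C
      simp only [hsm]
      have h1 := hB.proj_comp (rho_injective ρ g) (hpB g) C.2
      have h3 : ρ g ∘ₗ ρ g⁻¹ = LinearMap.id := by ext v; simp
      have h4 : ρ g⁻¹ ∘ₗ ρ g = LinearMap.id := by ext v; simp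
      have h2 : bproj B ((C : Submodule k V).map (ρ g)) = ρ g ∘ₗ bproj B C ∘ₗ ρ g⁻¹ := by
        rw [← LinearMap.comp_assoc, h1, LinearMap.comp_assoc, h3, LinearMap.comp_id]
      rw [h2, LinearMap.comp_assoc, LinearMap.comp_assoc, ← hcomm, ← LinearMap.comp_assoc,
        LinearMap.trace_comp_comm', LinearMap.comp_assoc, ← LinearMap.comp_assoc (bproj B C), h4,
        LinearMap.id_comp, LinearMap.trace_comp_comm']) (by
      rintro ⟨C, hC⟩
      obtain ⟨g, hg⟩ := hcon C hC
      exact ⟨g, fun h => hg (congrArg Subtype.val h)⟩)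
  have h1 : ∑ C : B, LinearMap.trace k V (bproj B C ∘ₗ bproj A S) = finrank k S := by
    rw [← hA.trace_proj hS, ← map_sum]
    congr 1
    have h2 := hB.sum_proj
    rw [← Finset.sum_coe_sort] at h2
    have h3 : ∑ C : B, bproj B C = LinearMap.id := by
      rw [← h2]
      exact Fintype.sum_equiv (Equiv.subtypeEquivRight fun C => by simp) _ _ fun _ => rfl
    have h4 := congrArg (fun e : V →ₗ[k] V => e ∘ₗ bproj A S) h3
    simp only [LinearMap.id_comp] at h4
    refine Eq.trans ?_ h4
    ext v
    simp [LinearMap.sum_apply]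
  rw [h1] at hsum
  exact hdim ((CharP.cast_eq_zero_iff k p _).mp hsum)
end FixedBlocks

section Lifts
open Module Polynomial IsLocalRing

theorem IsPiElt.not_dvd_orderOf {p : ℕ} (hp : p.Prime) {G : Type} [Group G] {g : G}
    (h : IsPiElt {p}ᶜ g) : ¬ p ∣ orderOf g := fun hd => h p hp hd rfl

theorem isPiElt_of_not_dvd {p : ℕ} {G : Type} [Group G] {g : G}
    (h : ¬ p ∣ orderOf g) : IsPiElt {p}ᶜ g := by
  intro q _ hqd hqp
  rw [Set.mem_singleton_iff] at hqp
  exact h (hqp ▸ hqd)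

variable {p : ℕ} [hp : Fact p.Prime]
  {G V : Type} [Group G] [AddCommGroup V] [Module (KK p) V]

/-- The Brauer character of a modular representation. -/
def brChar (ρ : Representation (KK p) G V) [FiniteDimensional (KK p) V] : G → ℂ := fun g =>
  if IsPiElt {p}ᶜ g then brTr (ρ g).charpoly else 0

/-- A matrix representation over the valuation ring reduces to a modular representation. -/
def IsLift {ι : Type} [Fintype ι] (b : Basis ι (KK p) V) (A : G →* Matrix ι ι (VR p))
    (ρ : Representation (KK p) G V) : Prop :=
  ∀ g, (A g).map (residue (VR p)) = LinearMap.toMatrix b b (ρ g)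

/-- The representation is the reduction of a lattice. -/
def HasLift (ρ : Representation (KK p) G V) : Prop :=
  ∃ (ι : Type) (_ : Fintype ι) (b : Basis ι (KK p) V) (A : G →* Matrix ι ι (VR p)), IsLift b A ρ

/-- The complex character of a matrix representation over the valuation ring. -/
def latChar {ι : Type} [Fintype ι] (A : G →* Matrix ι ι (VR p)) : G → ℂ :=
  fun g => ((A g).trace : VR p)

theorem latChar_isCharacter {ι : Type} [Fintype ι] (A : G →* Matrix ι ι (VR p)) :
    IsCharacter G (latChar A) := by
  let τ : Representation ℂ G (ι → ℂ) :=
    ((Matrix.toLinAlgEquiv' : Matrix ι ι ℂ ≃ₐ[ℂ] _).toAlgHom.toMonoidHom.comp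
      ((algebraMap (VR p) ℂ).mapMatrix.toMonoidHom)).comp A
  refine ⟨FDRep.of τ, fun g => ?_⟩
  change _ = LinearMap.trace ℂ (ι → ℂ) (τ g)
  change _ = LinearMap.trace ℂ (ι → ℂ) (Matrix.toLin' ((A g).map (algebraMap (VR p) ℂ)))
  rw [Matrix.trace_toLin'_eq]
  simp [latChar, Matrix.trace]

theorem IsCharacter.trace {χ : G → ℂ} (h : IsCharacter G χ) :
    ∃ (n : ℕ) (A : G →* Matrix (Fin n) (Fin n) ℂ), ∀ g, χ g = (A g).trace := by
  obtain ⟨W, hW⟩ := h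
  let b := finBasis ℂ W
  refine ⟨_, (LinearMap.toMatrixAlgEquiv b).toAlgHom.toMonoidHom.comp W.ρ, fun g => ?_⟩
  rw [hW]
  change LinearMap.trace ℂ W (W.ρ g) = (LinearMap.toMatrix b b (W.ρ g)).trace
  rw [LinearMap.trace_eq_matrix_trace ℂ b]

theorem brChar_eq_of_isLift [FiniteDimensional (KK p) V] [Finite G] {ι : Type} [Fintype ι]
    {b : Basis ι (KK p) V} {A : G →* Matrix ι ι (VR p)}
    {ρ : Representation (KK p) G V} (h : IsLift b A ρ) :
    brChar ρ = piRestrict {p}ᶜ (latChar A) := by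
  ext g
  rw [brChar, piRestrict]
  split_ifs with hg
  · rw [← LinearMap.charpoly_toMatrix (ρ g) b, ← h g]
    exact brTr_charpoly _ (hg.not_dvd_orderOf hp.out) (by rw [← map_pow, pow_orderOf_eq_one, map_one])
  · rfl

theorem brChar_sub_quo [FiniteDimensional (KK p) V] (ρ : Representation (KK p) G V)
    (W : Submodule (KK p) V) (hW : InvSub ρ W) :
    brChar ρ = brChar (subRep ρ W hW) + brChar (quoRep ρ W hW) := by
  ext g
  rw [Pi.add_apply, brChar, brChar, brChar]
  split_ifs with hg
  · rw [charpoly_sub_quo (ρ g) W (hW g), brTr_mul (LinearMap.charpoly_monic _).ne_zero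
      (LinearMap.charpoly_monic _).ne_zero]
    rfl
  · simp

theorem latChar_one {ι : Type} [Fintype ι] (A : G →* Matrix ι ι (VR p)) :
    latChar A 1 = Fintype.card ι := by
  simp [latChar]

theorem latChar_ne_zero {ι : Type} [Fintype ι] [Nonempty ι] (A : G →* Matrix ι ι (VR p)) :
    latChar A ≠ 0 := by
  intro h
  have := congrFun h 1
  rw [latChar_one] at this
  simp at this

theorem HasLift.isPartialChar [FiniteDimensional (KK p) V] [Finite G] [Nontrivial V]
    {ρ : Representation (KK p) G V} (h : HasLift ρ) : IsPartialChar {p}ᶜ G (brChar ρ) := by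
  obtain ⟨ι, _, b, A, hA⟩ := h
  have := b.index_nonempty
  exact ⟨_, latChar_isCharacter A, latChar_ne_zero A, brChar_eq_of_isLift hA⟩

theorem isPiElt_one : IsPiElt {p}ᶜ (1 : G) := by
  apply isPiElt_of_not_dvd
  simpa using hp.out.one_lt.ne'

theorem HasLift.brChar_one [FiniteDimensional (KK p) V] [Finite G]
    {ρ : Representation (KK p) G V} (h : HasLift ρ) : brChar ρ 1 = finrank (KK p) V := by
  obtain ⟨ι, _, b, A, hA⟩ := h
  rw [brChar_eq_of_isLift hA, piRestrict, if_pos isPiElt_one, latChar_one, finrank_eq_card_basis b]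

theorem piRestrict_add {H : Type} [Group H] (σ : Set ℕ) (a b : H → ℂ) :
    piRestrict σ (a + b) = piRestrict σ a + piRestrict σ b := by
  ext g; simp only [piRestrict, Pi.add_apply]; split_ifs <;> simp

theorem IsCharacter.add {χ χ' : G → ℂ} (h : IsCharacter G χ) (h' : IsCharacter G χ') :
    IsCharacter G (χ + χ') := by
  obtain ⟨W, hW⟩ := h
  obtain ⟨W', hW'⟩ := h'
  refine ⟨FDRep.of (Representation.prod W.ρ W'.ρ), fun g => ?_⟩
  rw [Pi.add_apply, hW, hW']
  change _ = LinearMap.trace ℂ (W × W') ((W.ρ g).prodMap (W'.ρ g))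
  rw [LinearMap.trace_prodMap']
  rfl

theorem IsCharacter.apply_one {χ : G → ℂ} (h : IsCharacter G χ) : ∃ n : ℕ, χ 1 = n := by
  obtain ⟨n, A, hA⟩ := h.trace
  exact ⟨n, by simp [hA]⟩

theorem IsCharacter.apply_one_ne_zero {χ : G → ℂ} (h : IsCharacter G χ) (h0 : χ ≠ 0) : χ 1 ≠ 0 := by
  obtain ⟨n, A, hA⟩ := h.trace
  intro h1
  rw [hA, map_one, Matrix.trace_one, Fintype.card_fin, Nat.cast_eq_zero] at h1
  subst h1
  exact h0 (funext fun g => by rw [hA]; simp [Matrix.trace])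

theorem IsPartialChar.add {σ : Set ℕ} {φ φ' : G → ℂ} (h : IsPartialChar σ G φ)
    (h' : IsPartialChar σ G φ') : IsPartialChar σ G (φ + φ') := by
  obtain ⟨χ, hχ, h0, rfl⟩ := h
  obtain ⟨χ', hχ', h0', rfl⟩ := h'
  refine ⟨χ + χ', hχ.add hχ', fun h => ?_, (piRestrict_add _ _ _).symm⟩
  obtain ⟨n, hn⟩ := hχ.apply_one
  obtain ⟨n', hn'⟩ := hχ'.apply_one
  have h1 := congrFun h 1
  have h2 := hχ.apply_one_ne_zero h0
  rw [Pi.add_apply, hn, hn'] at h1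
  rw [hn] at h2
  norm_cast at h1 h2
  simp only [Pi.zero_apply, Nat.cast_eq_zero] at h1
  omega

end Lifts

section Lattices
open Module Polynomial IsLocalRing

variable {p : ℕ} [hp : Fact p.Prime] {G : Type} [Group G]

theorem exists_lattice [Finite G] {V : Type} [AddCommGroup V] [Module ℂ V] [FiniteDimensional ℂ V]
    (ρ : Representation ℂ G V) : ∃ (ι : Type) (_ : Fintype ι) (b : Basis ι ℂ V)
      (A : G →* Matrix ι ι (VR p)),
      ∀ g, LinearMap.toMatrix b b (ρ g) = (A g).map (algebraMap (VR p) ℂ) := by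
  let b0 := finBasis ℂ V
  let S : Set V := Set.range fun x : G × Fin (finrank ℂ V) => ρ x.1 (b0 x.2)
  let L : Submodule (VR p) V := Submodule.span (VR p) S
  have hL : ∀ g, ∀ v ∈ L, ρ g v ∈ L := by
    intro g
    have : L ≤ L.comap ((ρ g).restrictScalars (VR p)) := by
      rw [Submodule.span_le]
      rintro _ ⟨⟨h, i⟩, rfl⟩
      refine Submodule.subset_span ⟨(g * h, i), ?_⟩
      simp [map_mul]
    exact fun v hv => this hv
  have : Module.Finite (VR p) L := Module.Finite.span_of_finite _ (Set.finite_range _)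
  have : IsTorsionFree (VR p) V := by
    refine ⟨fun r hr v w h => ?_⟩
    have h0 : (r : ℂ) ≠ 0 := fun h => hr.ne_zero (Subtype.ext h)
    exact smul_right_injective V h0 h
  have : Module.Flat (VR p) L := by
    rw [Module.Flat.flat_iff_torsion_eq_bot_of_isBezout, ← Submodule.isTorsionFree_iff_torsion_eq_bot]
    infer_instance
  have : Module.Free (VR p) L := Module.free_of_flat_of_isLocalRing
  obtain ⟨ι, _, ⟨c⟩⟩ : ∃ (ι : Type) (_ : Fintype ι), Nonempty (Basis ι (VR p) L) :=
    ⟨_, inferInstance, ⟨finBasis (VR p) L⟩⟩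
  have hli : LinearIndependent ℂ fun i => (c i : V) := by
    rw [← LinearIndependent.iff_fractionRing (VR p) ℂ]
    exact c.linearIndependent.map' L.subtype L.ker_subtype
  have hsp : ⊤ ≤ Submodule.span ℂ (Set.range fun i => (c i : V)) := by
    have h1 : L ≤ (Submodule.span ℂ (Set.range fun i => (c i : V))).restrictScalars (VR p) := by
      intro v hv
      have := c.sum_repr ⟨v, hv⟩
      have h2 := congrArg Subtype.val this
      rw [Submodule.coe_sum] at h2
      change _ = v at h2
      rw [← h2]
      refine Submodule.sum_mem _ fun i _ => ?_
      rw [Submodule.coe_smul]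
      exact Submodule.smul_mem _ _ (Submodule.subset_span ⟨i, rfl⟩)
    rw [← b0.span_eq, Submodule.span_le]
    rintro _ ⟨i, rfl⟩
    exact h1 (Submodule.subset_span ⟨(1, i), by simp⟩)
  let b : Basis _ ℂ V := Basis.mk hli hsp
  have hb : ∀ i, b i = c i := fun i => by simp [b]
  let f : G →* Module.End (VR p) L :=
    { toFun := fun g => ((ρ g).restrictScalars (VR p)).restrict (hL g)
      map_one' := by ext; simp
      map_mul' := fun a b => by ext x; exact rho_mul_apply ρ a b x }
  refine ⟨_, _, b, (LinearMap.toMatrixAlgEquiv c).toAlgHom.toMonoidHom.comp f, fun g => ?_⟩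
  apply (LinearMap.toMatrix b b).symm.injective
  rw [LinearEquiv.symm_apply_apply, LinearMap.toMatrix_symm]
  refine b.ext fun j => ?_
  rw [Matrix.toLin_self, hb]
  have h1 := congrArg Subtype.val (c.sum_repr (f g (c j)))
  rw [Submodule.coe_sum] at h1
  change _ = ρ g (c j) at h1
  rw [← h1]
  refine Finset.sum_congr rfl fun i _ => ?_
  rw [hb]
  change _ = (algebraMap (VR p) ℂ (LinearMap.toMatrix c c (f g) i j)) • (c i : V)
  rw [LinearMap.toMatrix_apply]
  rfl

theorem IsCharacter.exists_latChar [Finite G] {χ : G → ℂ} (h : IsCharacter G χ) :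
    ∃ (ι : Type) (_ : Fintype ι) (A : G →* Matrix ι ι (VR p)), χ = latChar A := by
  obtain ⟨W, hW⟩ := h
  obtain ⟨n, _, b, A, hA⟩ := exists_lattice (p := p) W.ρ
  refine ⟨n, _, A, funext fun g => ?_⟩
  rw [hW]
  change LinearMap.trace ℂ W (W.ρ g) = _
  rw [LinearMap.trace_eq_matrix_trace ℂ b, hA]
  simp only [Matrix.trace, latChar, Matrix.diag_apply, Matrix.map_apply]
  exact (map_sum (algebraMap (VR p) ℂ) _ _).symm

variable {ι : Type} [Fintype ι]

/-- The reduction of a matrix representation over the valuation ring. -/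
def redRep (A : G →* Matrix ι ι (VR p)) : Representation (KK p) G (ι → KK p) :=
  ((Matrix.toLinAlgEquiv' : Matrix ι ι (KK p) ≃ₐ[KK p] _).toAlgHom.toMonoidHom.comp
    ((residue (VR p)).mapMatrix.toMonoidHom)).comp A

theorem redRep_apply (A : G →* Matrix ι ι (VR p)) (g : G) :
    redRep A g = Matrix.toLin' ((A g).map (residue (VR p))) := rfl

theorem isLift_redRep (A : G →* Matrix ι ι (VR p)) : IsLift (Pi.basisFun (KK p) ι) A (redRep A) := by
  intro g
  rw [redRep_apply, ← Matrix.toLin_eq_toLin', LinearMap.toMatrix_toLin]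

theorem HasLift.redRep (A : G →* Matrix ι ι (VR p)) : HasLift (redRep A) :=
  ⟨_, _, _, A, isLift_redRep A⟩

theorem IsLift.trace {V : Type} [AddCommGroup V] [Module (KK p) V]
    {b : Basis ι (KK p) V} {A : G →* Matrix ι ι (VR p)} {ρ : Representation (KK p) G V}
    (h : IsLift b A ρ) (g : G) : LinearMap.trace (KK p) V (ρ g) = residue (VR p) (A g).trace := by
  rw [LinearMap.trace_eq_matrix_trace _ b, ← h g]
  simp [Matrix.trace]

theorem exists_pow_isPiElt [Finite G] (g : G) : ∃ n, IsPiElt {p}ᶜ (g ^ p ^ n) := by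
  refine ⟨(orderOf g).factorization p, isPiElt_of_not_dvd ?_⟩
  rw [orderOf_pow, Nat.gcd_eq_right (Nat.ordProj_dvd _ _)]
  exact Nat.not_dvd_ordCompl hp.out (orderOf_pos g).ne'

theorem trace_pow_char_pow {k : Type} [Field k] [CharP k p] (M : Matrix ι ι k) (n : ℕ) :
    (M ^ p ^ n).trace = M.trace ^ p ^ n := by
  induction n with
  | zero => simp
  | succ n ih => rw [pow_succ, pow_mul, trace_pow_char, ih, ← pow_mul]

theorem HasLift.isIPiChar [Finite G] {V : Type} [AddCommGroup V] [Module (KK p) V]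
    [FiniteDimensional (KK p) V] {ρ : Representation (KK p) G V} (h : HasLift ρ) (hI : Irr ρ) :
    IsIPiChar {p}ᶜ G (brChar ρ) := by
  have := hI.1
  refine ⟨h.isPartialChar, ?_⟩
  rintro ⟨_, _, ⟨χ₁, hχ₁, h₁, rfl⟩, ⟨χ₂, hχ₂, h₂, rfl⟩, he⟩
  have e₁ := hχ₁.apply_one_ne_zero h₁
  have e₂ := hχ₂.apply_one_ne_zero h₂
  obtain ⟨ι₁, _, A₁, rfl⟩ := hχ₁.exists_latChar (p := p)
  obtain ⟨ι₂, _, A₂, rfl⟩ := hχ₂.exists_latChar (p := p)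
  obtain ⟨ι, _, b, A, hA⟩ := h
  rw [brChar_eq_of_isLift hA, ← piRestrict_add] at he
  have hreg : ∀ g, IsPiElt {p}ᶜ g → (A g).trace = (A₁ g).trace + (A₂ g).trace := by
    intro g hg
    have := congrFun he g
    simp only [piRestrict, if_pos hg, Pi.add_apply, latChar] at this
    exact Subtype.ext this
  have h1 := congrArg (Subtype.val) (hreg 1 isPiElt_one)
  simp only [map_one, Matrix.trace_one] at h1
  simp only [latChar_one, ne_eq, Nat.cast_eq_zero] at e₁ e₂
  have h2 : ((Fintype.card ι : ℕ) : ℂ) = ((Fintype.card ι₁ + Fintype.card ι₂ : ℕ) : ℂ) := by push_cast; simpa using h1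
  rw [Nat.cast_inj] at h2
  refine hI.trace_ne_add (_root_.redRep A₁) (_root_.redRep A₂) ?_ ?_ fun g => ?_
  · rw [finrank_eq_card_basis b]; simp; omega
  · rw [finrank_eq_card_basis b]; simp; omega
  · rw [hA.trace, (isLift_redRep A₁).trace, (isLift_redRep A₂).trace, ← map_add]
    obtain ⟨n, hn⟩ := exists_pow_isPiElt (p := p) g
    have key : ∀ {κ : Type} [Fintype κ] (B : G →* Matrix κ κ (VR p)),
        residue (VR p) (B g).trace ^ p ^ n = residue (VR p) (B (g ^ p ^ n)).trace := by
      intro κ _ B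
      have e : ∀ M : Matrix κ κ (VR p), residue (VR p) M.trace = (M.map (residue (VR p))).trace := by
        intro M; simp [Matrix.trace]
      rw [e, e, ← trace_pow_char_pow, map_pow]
      exact congrArg Matrix.trace (map_pow (residue (VR p)).mapMatrix (B g) (p ^ n)).symm
    have hf : Function.Injective (fun x : KK p => x ^ p ^ n) := by
      intro x y hxy
      exact iterateFrobenius_inj (KK p) p n hxy
    apply hf
    simp only
    rw [map_add, add_pow_char_pow, key, key, key, hreg _ hn, map_add]

end Lattices

section Induction
open Module Polynomial IsLocalRing

section Matrices
variable {R : Type} [CommRing R] {G : Type} [Group G] {T : Subgroup G} {ι : Type} [Fintype ι]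

/-- The index type of an induced matrix representation. -/
structure IndIdx (T : Subgroup G) (ι : Type) : Type where
  coset : G ⧸ T
  idx : ι

/-- Indices are pairs. -/
def indIdxEquiv (T : Subgroup G) (ι : Type) : IndIdx T ι ≃ (G ⧸ T) × ι where
  toFun x := (x.1, x.2)
  invFun x := ⟨x.1, x.2⟩

instance [Fintype (G ⧸ T)] : Fintype (IndIdx T ι) := Fintype.ofEquiv _ (indIdxEquiv T ι).symm

theorem sum_indIdx [Fintype (G ⧸ T)] {M : Type} [AddCommMonoid M] (f : IndIdx T ι → M) :
    ∑ x, f x = ∑ q : G ⧸ T, ∑ i : ι, f ⟨q, i⟩ := by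
  rw [← Fintype.sum_prod_type (f := fun x : (G ⧸ T) × ι => f ⟨x.1, x.2⟩)]
  exact Fintype.sum_equiv (indIdxEquiv T ι) _ _ fun _ => rfl

/-- The matrices of the induced representation. -/
def indMat [Fintype (G ⧸ T)] (A : T →* Matrix ι ι R) (g : G) :
    Matrix (IndIdx T ι) (IndIdx T ι) R := fun x y =>
  if h : x.1.out⁻¹ * g * y.1.out ∈ T then A ⟨_, h⟩ x.2 y.2 else 0

theorem out_inv_mul_mem_iff (x : G ⧸ T) (g : G) : x.out⁻¹ * g ∈ T ↔ x = (g : G ⧸ T) := by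
  rw [← QuotientGroup.eq, QuotientGroup.out_eq']

/-- The induced matrix representation. -/
def indHom [Fintype (G ⧸ T)] (A : T →* Matrix ι ι R) :
    G →* Matrix (IndIdx T ι) (IndIdx T ι) R where
  toFun := indMat A
  map_one' := by
    ext ⟨x, i⟩ ⟨y, j⟩
    rw [indMat, Matrix.one_apply]
    simp only [mul_one]
    by_cases h : x = y
    · subst h
      have : (⟨x.out⁻¹ * x.out, by simp⟩ : T) = 1 := Subtype.ext (by simp)
      rw [dif_pos (by simp), this, map_one, Matrix.one_apply]
      by_cases hij : i = j
      · rw [if_pos hij, if_pos (congrArg (IndIdx.mk x) hij)]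
      · rw [if_neg hij, if_neg (fun h' => hij (congrArg IndIdx.idx h'))]
    · rw [dif_neg, if_neg (fun h' => h (congrArg IndIdx.coset h'))]
      rw [out_inv_mul_mem_iff, QuotientGroup.out_eq']
      exact h
  map_mul' := by
    intro g h
    ext ⟨x, i⟩ ⟨z, j⟩
    rw [Matrix.mul_apply, sum_indIdx]
    have hy : (((h * z.out : G) : G ⧸ T)).out⁻¹ * (h * z.out) ∈ T := by
      rw [out_inv_mul_mem_iff]
    set y : G ⧸ T := ((h * z.out : G) : G ⧸ T) with hydef
    have hz : ∀ y' : G ⧸ T, y'.out⁻¹ * h * z.out ∈ T ↔ y' = y := by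
      intro y'
      rw [mul_assoc, out_inv_mul_mem_iff]
    rw [Finset.sum_eq_single y]
    · simp only [indMat]
      have h2 : y.out⁻¹ * h * z.out ∈ T := (hz y).mpr rfl
      have e : x.out⁻¹ * (g * h) * z.out =
        (x.out⁻¹ * g * y.out) * (y.out⁻¹ * h * z.out) := by group
      by_cases h1 : x.out⁻¹ * g * y.out ∈ T
      · have h3 : x.out⁻¹ * (g * h) * z.out ∈ T := by rw [e]; exact mul_mem h1 h2
        rw [dif_pos h3]
        have : (⟨_, h3⟩ : T) = ⟨_, h1⟩ * ⟨_, h2⟩ := Subtype.ext e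
        rw [this, map_mul, Matrix.mul_apply]
        exact Finset.sum_congr rfl fun l _ => by rw [dif_pos h1, dif_pos h2]
      · rw [dif_neg]
        · exact (Finset.sum_eq_zero fun l _ => by rw [dif_neg h1, zero_mul]).symm
        · rw [e, Subgroup.mul_mem_cancel_right T h2]; exact h1
    · intro y' _ hy'
      refine Finset.sum_eq_zero fun l _ => ?_
      rw [indMat, indMat, dif_neg (fun h' => hy' ((hz y').mp h')), mul_zero]
    · simp

theorem indHom_trace [Fintype (G ⧸ T)] (A : T →* Matrix ι ι R) (g : G) :
    (indHom A g).trace =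
      ∑ x : G ⧸ T, if h : x.out⁻¹ * g * x.out ∈ T then (A ⟨_, h⟩).trace else 0 := by
  rw [Matrix.trace, sum_indIdx]
  refine Finset.sum_congr rfl fun x _ => ?_
  change ∑ i, indMat A g ⟨x, i⟩ ⟨x, i⟩ = _
  simp only [indMat]
  split_ifs with h
  · rfl
  · simp

end Matrices

variable {G : Type} [Group G]

theorem indChar_eq_sum [Fintype G] {T : Subgroup G} (ψ : T → ℂ)
    (hψ : ∀ s t : T, ψ (s⁻¹ * t * s) = ψ t) (g : G) : indChar T ψ g =
    ∑ x : G ⧸ T, if h : x.out⁻¹ * g * x.out ∈ T then ψ ⟨_, h⟩ else 0 := by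
  let F : G → ℂ := fun x => if h : x⁻¹ * g * x ∈ T then ψ ⟨_, h⟩ else 0
  have hF : ∀ (x : G) (t : T), F (x * t) = F x := by
    intro x t
    have e : (x * t)⁻¹ * g * (x * t) = (t : G)⁻¹ * (x⁻¹ * g * x) * t := by group
    simp only [F]
    by_cases h : x⁻¹ * g * x ∈ T
    · have h' : (x * t)⁻¹ * g * (x * t) ∈ T := by
        rw [e]; exact mul_mem (mul_mem (inv_mem t.2) h) t.2
      rw [dif_pos h, dif_pos h', ← hψ t ⟨_, h⟩]
      exact congrArg ψ (Subtype.ext e)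
    · rw [dif_neg h, dif_neg]
      rw [e, Subgroup.mul_mem_cancel_right T t.2, Subgroup.mul_mem_cancel_left T (inv_mem t.2)]
      exact h
  have h1 : ∑ x : G, (if h : x * g * x⁻¹ ∈ T then ψ ⟨x * g * x⁻¹, h⟩ else 0) = ∑ x : G, F x := by
    refine Fintype.sum_equiv (Equiv.inv G) _ _ fun x => ?_
    simp only [F, Equiv.inv_apply, inv_inv]
  have h2 : ∑ x : G, F x = ∑ q : (G ⧸ T) × T, F (q.1.out * q.2) := by
    symm
    refine Fintype.sum_bijective (fun q : (G ⧸ T) × T => q.1.out * (q.2 : G)) ⟨?_, fun x => ?_⟩ _ _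
      fun _ => rfl
    · rintro ⟨a, s⟩ ⟨b, t⟩ h
      simp only at h
      have h1 : a = b := by
        have h2 : b.out⁻¹ * a.out ∈ T := by
          have : b.out⁻¹ * a.out = t * (s : G)⁻¹ := by
            rw [inv_mul_eq_iff_eq_mul, ← mul_assoc, ← h, mul_inv_cancel_right]
          rw [this]
          exact mul_mem t.2 (inv_mem s.2)
        rw [out_inv_mul_mem_iff, QuotientGroup.out_eq'] at h2
        exact h2.symm
      subst h1
      rw [mul_right_inj] at h
      rw [Subtype.ext h]
    · exact ⟨((x : G ⧸ T), ⟨(x : G ⧸ T).out⁻¹ * x, by rw [out_inv_mul_mem_iff]⟩),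
        mul_inv_cancel_left _ _⟩
  rw [indChar, h1, h2, Fintype.sum_prod_type]
  simp only [hF, Finset.sum_const, Finset.card_univ, nsmul_eq_mul]
  rw [← Finset.mul_sum, ← mul_assoc, Nat.card_eq_fintype_card, inv_mul_cancel₀, one_mul]
  exact Nat.cast_ne_zero.mpr Fintype.card_ne_zero

theorem indChar_piRestrict [Fintype G] (σ : Set ℕ) (T : Subgroup G) (ψ : T → ℂ) :
    indChar T (piRestrict σ ψ) = piRestrict σ (indChar T ψ) := by
  ext g
  have ho : ∀ (x : G) (h : x * g * x⁻¹ ∈ T), IsPiElt σ (⟨x * g * x⁻¹, h⟩ : T) ↔ IsPiElt σ g := by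
    intro x h
    have e : orderOf (x * g * x⁻¹) = orderOf g := by
      have := MulAut.conj_apply x g
      rw [← this]
      exact orderOf_injective (MulAut.conj x).toMonoidHom (MulAut.conj x).injective g
    rw [IsPiElt, IsPiElt, ← Subgroup.orderOf_coe, e]
  rw [piRestrict]
  split_ifs with hg
  · rw [indChar, indChar]
    congr 1
    refine Finset.sum_congr rfl fun x _ => ?_
    split_ifs with h
    · rw [piRestrict, if_pos ((ho x h).mpr hg)]
    · rfl
  · rw [indChar]
    refine mul_eq_zero_of_right _ (Finset.sum_eq_zero fun x _ => ?_)
    split_ifs with h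
    · rw [piRestrict, if_neg (fun h' => hg ((ho x h).mp h'))]
    · rfl

variable {p : ℕ} [hp : Fact p.Prime]

theorem latChar_indHom [Fintype G] {T : Subgroup G} {ι : Type} [Fintype ι]
    (A : T →* Matrix ι ι (VR p)) : latChar (indHom A) = indChar T (latChar A) := by
  ext g
  rw [indChar_eq_sum]
  · rw [latChar, indHom_trace]
    refine (map_sum (algebraMap (VR p) ℂ) _ _).trans (Finset.sum_congr rfl fun x _ => ?_)
    split_ifs with h
    · rfl
    · simp
  · intro s t
    rw [latChar, map_mul, map_mul, Matrix.trace_mul_comm, ← mul_assoc, ← map_mul]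
    simp [latChar]

section Blocks
variable {k V : Type} [Field k] [AddCommGroup V] [Module k V] (ρ : Representation k G V)

/-- The coset of an element maps `U` to its translate. -/
theorem map_out_stab (U : Submodule k V) (g : G) :
    U.map (ρ ((g : G ⧸ stab ρ U)).out) = U.map (ρ g) := by
  have h : ((g : G ⧸ stab ρ U)).out⁻¹ * g ∈ stab ρ U := by rw [out_inv_mul_mem_iff]
  rw [mem_stab] at h
  have h1 := congrArg (Submodule.map (ρ ((g : G ⧸ stab ρ U)).out)) h
  rw [map_map_rho, mul_inv_cancel_left] at h1
  exact h1.symm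

theorem eq_of_map_out_stab {U : Submodule k V} {x y : G ⧸ stab ρ U}
    (h : U.map (ρ x.out) = U.map (ρ y.out)) : x = y := by
  have : y.out⁻¹ * x.out ∈ stab ρ U := by
    rw [mem_stab, ← map_map_rho, h, map_map_rho, inv_mul_cancel, map_rho_one]
  rw [out_inv_mul_mem_iff, QuotientGroup.out_eq'] at this
  exact this.symm

variable {ρ} {U : Submodule k V} {ι : Type} [Fintype ι]

theorem linearIndependent_ind [Fintype G] (hd : Dec (orb ρ U)) (b : Basis ι k U) :
    LinearIndependent k fun x : IndIdx (stab ρ U) ι => ρ x.1.out (b x.2) := by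
  rw [Fintype.linearIndependent_iff]
  intro c hc ⟨q, i⟩
  rw [sum_indIdx] at hc
  have h1 := congrArg (bproj (orb ρ U) (U.map (ρ q.out))) hc
  have hm : ∀ q' : G ⧸ stab ρ U, ∑ i, c ⟨q', i⟩ • ρ q'.out (b i) ∈ U.map (ρ q'.out) := fun q' =>
    Submodule.sum_mem _ fun i _ => Submodule.smul_mem _ _ ⟨b i, (b i).2, rfl⟩
  rw [map_zero, map_sum, Finset.sum_eq_single q] at h1
  · have h2 := (hd.proj_self (Set.mem_range_self _) (hm q)).symm.trans h1
    have h3 : ρ q.out ((∑ i, c ⟨q, i⟩ • b i : U) : V) = 0 := by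
      rw [← h2, Submodule.coe_sum, map_sum]
      exact Finset.sum_congr rfl fun i _ => by rw [Submodule.coe_smul, map_smul]
    have h4 : (∑ i, c ⟨q, i⟩ • b i : U) = 0 :=
      Subtype.ext (rho_injective ρ q.out (h3.trans (map_zero _).symm))
    exact Fintype.linearIndependent_iff.mp b.linearIndependent _ h4 i
  · intro q' _ hq'
    exact hd.proj_other (Set.mem_range_self _) (Set.mem_range_self _)
      (fun h => hq' (eq_of_map_out_stab ρ h)) (hm q')
  · simp

theorem span_ind (hd : Dec (orb ρ U)) (b : Basis ι k U) :
    ⊤ ≤ Submodule.span k (Set.range fun x : IndIdx (stab ρ U) ι => ρ x.1.out (b x.2)) := by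
  rw [← hd.2]
  apply sSup_le
  rintro _ ⟨g, rfl⟩
  change U.map (ρ g) ≤ _
  rw [← map_out_stab]
  rintro _ ⟨u, hu, rfl⟩
  have h := congrArg Subtype.val (b.sum_repr ⟨u, hu⟩)
  rw [Submodule.coe_sum] at h
  rw [← show _ = u from h, map_sum]
  refine Submodule.sum_mem _ fun i _ => ?_
  rw [Submodule.coe_smul, map_smul]
  exact Submodule.smul_mem _ _ (Submodule.subset_span ⟨⟨(g : G ⧸ stab ρ U), i⟩, rfl⟩)

end Blocks

variable {V : Type} [AddCommGroup V] [Module (KK p) V] {ρ : Representation (KK p) G V}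

theorem isLift_iff {ι : Type} [Fintype ι] {H W : Type} [Group H] [AddCommGroup W] [Module (KK p) W]
    {σ : Representation (KK p) H W} {b : Basis ι (KK p) W} {A : H →* Matrix ι ι (VR p)} :
    IsLift b A σ ↔ ∀ g j, σ g (b j) = ∑ i, residue (VR p) (A g i j) • b i := by
  refine forall_congr' fun g => ?_
  constructor
  · intro h j
    have := Matrix.toLin_self b b ((A g).map (residue (VR p))) j
    rw [h, Matrix.toLin_toMatrix] at this
    rw [this, ← h]
    rfl
  · intro h
    apply (LinearMap.toMatrix b b).symm.injective
    rw [LinearEquiv.symm_apply_apply, LinearMap.toMatrix_symm]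
    refine b.ext fun j => ?_
    rw [Matrix.toLin_self, h]
    rfl

theorem HasLift.ind [Fintype G] [FiniteDimensional (KK p) V] {U : Submodule (KK p) V}
    (hd : Dec (orb ρ U)) (h : HasLift (stabRep ρ U)) :
    HasLift ρ ∧ brChar ρ = indChar (stab ρ U) (brChar (stabRep ρ U)) := by
  obtain ⟨ι, _, b, A, hA⟩ := h
  let c : Basis (IndIdx (stab ρ U) ι) (KK p) V :=
    Basis.mk (linearIndependent_ind hd b) (span_ind hd b)
  have hc : ∀ q i, c ⟨q, i⟩ = ρ q.out (b i) := fun q i => by simp [c]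
  have hl : IsLift c (indHom A) ρ := by
    rw [isLift_iff]
    rintro g ⟨y, j⟩
    rw [sum_indIdx, hc, ← rho_mul_apply]
    set x : G ⧸ stab ρ U := ((g * y.out : G) : G ⧸ stab ρ U)
    have hxy : ∀ x' : G ⧸ stab ρ U, x'.out⁻¹ * g * y.out ∈ stab ρ U ↔ x' = x := by
      intro x'
      rw [mul_assoc, out_inv_mul_mem_iff]
    rw [Finset.sum_eq_single x]
    · have hm := (hxy x).mpr rfl
      have e : g * y.out = x.out * (x.out⁻¹ * g * y.out) := by group
      have h1 := congrArg Subtype.val ((isLift_iff.mp hA) ⟨_, hm⟩ j)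
      rw [stabRep_coe, Submodule.coe_sum] at h1
      conv_lhs => rw [e, rho_mul_apply, h1, map_sum]
      refine Finset.sum_congr rfl fun i _ => ?_
      rw [hc, Submodule.coe_smul, map_smul]
      congr 2
      change _ = indMat A g ⟨x, i⟩ ⟨y, j⟩
      rw [indMat, dif_pos hm]
    · intro x' _ hx'
      refine Finset.sum_eq_zero fun i _ => ?_
      have : indHom A g ⟨x', i⟩ ⟨y, j⟩ = 0 := by
        change indMat A g ⟨x', i⟩ ⟨y, j⟩ = 0
        rw [indMat, dif_neg (fun h => hx' ((hxy x').mp h))]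
      rw [this, map_zero, zero_smul]
    · simp
  refine ⟨⟨_, _, c, indHom A, hl⟩, ?_⟩
  rw [brChar_eq_of_isLift hl, brChar_eq_of_isLift hA, indChar_piRestrict, latChar_indHom]

end Induction

section CoprimeLifts
open Module Polynomial IsLocalRing

variable {K : Type} [Group K] [Fintype K]

section Average
variable {k U W : Type} [Field k] [AddCommGroup U] [Module k U] [AddCommGroup W] [Module k W]

/-- The sum of the translates of a linear map. -/
def avg (τ : Representation k K U) (σ : Representation k K W) (e : U →ₗ[k] W) : U →ₗ[k] W :=
  ∑ x, σ x ∘ₗ e ∘ₗ τ x⁻¹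

theorem avg_comm (τ : Representation k K U) (σ : Representation k K W) (e : U →ₗ[k] W) (g : K) (u : U) :
    avg τ σ e (τ g u) = σ g (avg τ σ e u) := by
  simp only [avg, LinearMap.sum_apply, map_sum, LinearMap.comp_apply]
  refine Fintype.sum_equiv (Equiv.mulLeft g⁻¹) _ _ fun x => ?_
  rw [Equiv.coe_mulLeft, ← rho_mul_apply, ← rho_mul_apply, mul_inv_rev, inv_inv, mul_inv_cancel_left]

theorem trace_avg (σ : Representation k K W) (e : W →ₗ[k] W) :
    LinearMap.trace k W (avg σ σ e) = Fintype.card K * LinearMap.trace k W e := by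
  rw [avg, map_sum, Finset.sum_congr rfl (g := fun _ => LinearMap.trace k W e), Finset.sum_const,
    Finset.card_univ, nsmul_eq_mul]
  intro x _
  change LinearMap.trace k W (σ x * (e * σ x⁻¹)) = _
  rw [LinearMap.trace_mul_comm, mul_assoc, ← map_mul, inv_mul_cancel, map_one, mul_one]

theorem Irr.natCast_finrank_ne_zero [IsAlgClosed k] [FiniteDimensional k W]
    {σ : Representation k K W} (h : Irr σ) (hK : (Fintype.card K : k) ≠ 0) :
    (finrank k W : k) ≠ 0 := by
  intro h0
  have := h.1
  let b := finBasis k W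
  obtain ⟨i⟩ := b.index_nonempty
  let e := Matrix.toLin b b (Matrix.single i i (1 : k))
  have he : LinearMap.trace k W e = 1 := by
    rw [LinearMap.trace_eq_matrix_trace k b, LinearMap.toMatrix_toLin, Matrix.trace_single_eq_same]
  obtain ⟨c, hc⟩ := h.schur (avg σ σ e) (avg_comm σ σ e)
  have h1 : avg σ σ e = c • LinearMap.id := LinearMap.ext hc
  have h2 := trace_avg σ e
  rw [h1, he, map_smul, LinearMap.trace_id, h0, smul_zero, mul_one] at h2
  exact hK h2.symm

theorem exists_avg_ne_zero [FiniteDimensional k U] [FiniteDimensional k W]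
    (τ : Representation k K U) (σ : Representation k K W)
    (h : ∑ x, LinearMap.trace k W (σ x) * LinearMap.trace k U (τ x⁻¹) ≠ 0) :
    ∃ e, avg τ σ e ≠ 0 := by
  by_contra! h0
  apply h
  let b := finBasis k U
  let c := finBasis k W
  have key : ∀ i j, ∑ x, LinearMap.toMatrix c c (σ x) i i * LinearMap.toMatrix b b (τ x⁻¹) j j = 0 := by
    intro i j
    have h1 := congrArg (fun f => LinearMap.toMatrix b c f i j)
      (h0 (Matrix.toLin b c (Matrix.single i j (1 : k))))
    simp only [avg, map_sum, map_zero, Matrix.zero_apply, Matrix.sum_apply] at h1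
    rw [← h1]
    refine Finset.sum_congr rfl fun x _ => ?_
    rw [LinearMap.toMatrix_comp b c c, LinearMap.toMatrix_comp b b c, LinearMap.toMatrix_toLin,
      Matrix.mul_apply, Finset.sum_eq_single i]
    · rw [Matrix.single_mul_apply_same, one_mul]
    · intro i' _ hi'
      rw [Matrix.single_mul_apply_of_ne _ _ _ _ _ hi', mul_zero]
    · simp
  calc ∑ x, LinearMap.trace k W (σ x) * LinearMap.trace k U (τ x⁻¹)
      = ∑ x, ∑ i, ∑ j, LinearMap.toMatrix c c (σ x) i i * LinearMap.toMatrix b b (τ x⁻¹) j j := by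
        refine Finset.sum_congr rfl fun x _ => ?_
        rw [LinearMap.trace_eq_matrix_trace k b, LinearMap.trace_eq_matrix_trace k c, Matrix.trace,
          Matrix.trace, Finset.sum_mul_sum]
        rfl
    _ = 0 := by
        rw [Finset.sum_comm]
        refine Finset.sum_eq_zero fun i _ => ?_
        rw [Finset.sum_comm]
        exact Finset.sum_eq_zero fun j _ => key i j

theorem irr_of_scalar_commutant {σ : Representation k K W} [Nontrivial W]
    (hK : (Fintype.card K : k) ≠ 0)
    (h : ∀ f : W →ₗ[k] W, (∀ g v, f (σ g v) = σ g (f v)) → ∃ c : k, ∀ v, f v = c • v) : Irr σ := by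
  refine ⟨inferInstance, fun D hD => ?_⟩
  obtain ⟨π, hπ⟩ := D.subtype.exists_leftInverse_of_injective D.ker_subtype
  have hπ' : ∀ v : D, π v = v := fun v => LinearMap.congr_fun hπ v
  obtain ⟨c, hc⟩ := h (avg σ σ (D.subtype ∘ₗ π)) (avg_comm σ σ _)
  have hmem : ∀ v, avg σ σ (D.subtype ∘ₗ π) v ∈ D := by
    intro v
    rw [avg, LinearMap.sum_apply]
    exact Submodule.sum_mem _ fun x _ => hD x _ (π _).2
  have hself : ∀ v ∈ D, avg σ σ (D.subtype ∘ₗ π) v = (Fintype.card K : k) • v := by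
    intro v hv
    rw [avg, LinearMap.sum_apply, Finset.sum_congr rfl (g := fun _ => v), Finset.sum_const,
      Finset.card_univ, Nat.cast_smul_eq_nsmul]
    intro x _
    change σ x (π (σ x⁻¹ v) : W) = v
    rw [hπ' ⟨_, hD x⁻¹ v hv⟩]
    simp
  by_cases hD0 : D = ⊥
  · exact Or.inl hD0
  · obtain ⟨v, hv, hv0⟩ := D.ne_bot_iff.mp hD0
    have h1 := (hc v).symm.trans (hself v hv)
    have hcK : c = Fintype.card K := by
      have := sub_eq_zero.mpr h1
      rw [← sub_smul, smul_eq_zero] at this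
      exact sub_eq_zero.mp (this.resolve_right hv0)
    refine Or.inr ((Submodule.eq_top_iff').mpr fun u => ?_)
    have := hmem u
    rw [hc, hcK] at this
    exact (D.smul_mem_iff hK).mp this

end Average

set_option linter.unusedSectionVars false
variable {p : ℕ} [hp : Fact p.Prime] {ι : Type} [Fintype ι]

/-- The complexification of a matrix representation over the valuation ring. -/
def extRep (A : K →* Matrix ι ι (VR p)) : Representation ℂ K (ι → ℂ) :=
  ((Matrix.toLinAlgEquiv' : Matrix ι ι ℂ ≃ₐ[ℂ] _).toAlgHom.toMonoidHom.comp
    ((algebraMap (VR p) ℂ).mapMatrix.toMonoidHom)).comp A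

theorem extRep_apply (A : K →* Matrix ι ι (VR p)) (g : K) :
    extRep A g = Matrix.toLin' ((A g).map (algebraMap (VR p) ℂ)) := rfl

theorem trace_extRep (A : K →* Matrix ι ι (VR p)) (g : K) :
    LinearMap.trace ℂ _ (extRep A g) = ((A g).trace : VR p) := by
  rw [extRep_apply, Matrix.trace_toLin'_eq]
  simp only [Matrix.trace, Matrix.diag_apply, Matrix.map_apply]
  exact (map_sum (algebraMap (VR p) ℂ) _ _).symm

theorem natCast_card_ne_zero (hK : ¬ p ∣ Nat.card K) : (Fintype.card K : KK p) ≠ 0 := by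
  rw [Nat.card_eq_fintype_card] at hK
  exact natCast_KK_ne_zero hK

theorem irr_redRep (hK : ¬ p ∣ Nat.card K) {A : K →* Matrix ι ι (VR p)} (h : Irr (extRep A)) :
    Irr (redRep A) := by
  have hK' := natCast_card_ne_zero hK
  have := h.1
  have hne : Nonempty ι := by
    by_contra hcon
    rw [not_nonempty_iff] at hcon
    exact not_subsingleton (ι → ℂ) inferInstance
  refine irr_of_scalar_commutant hK' fun f hf => ?_
  obtain ⟨i0⟩ := hne
  let M0 := LinearMap.toMatrix' f
  choose lft hlft using residue_surjective (R := VR p)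
  let M : Matrix ι ι (VR p) := M0.map lft
  have hM : M.map (residue (VR p)) = M0 := by ext i j; simp [M, hlft]
  let N : Matrix ι ι (VR p) := ∑ x, A x * (M * A x⁻¹)
  have hN : ∀ g, N * A g = A g * N := by
    intro g
    rw [Finset.sum_mul, Finset.mul_sum]
    refine Fintype.sum_equiv (Equiv.mulLeft g⁻¹) _ _ fun x => ?_
    rw [Equiv.coe_mulLeft, ← mul_assoc (A g), ← map_mul, mul_inv_cancel_left, mul_assoc, mul_assoc,
      ← map_mul, mul_inv_rev, inv_inv]
  obtain ⟨c, hc⟩ := h.schur (Matrix.toLin' (N.map (algebraMap (VR p) ℂ))) (by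
    intro g v
    rw [extRep_apply, ← Matrix.toLin'_mul_apply, ← Matrix.toLin'_mul_apply, ← Matrix.map_mul,
      ← Matrix.map_mul, hN])
  have hNs : N = Matrix.scalar ι (N i0 i0) := by
    have h1 : N.map (algebraMap (VR p) ℂ) = Matrix.scalar ι c := by
      apply Matrix.toLin'.injective
      refine LinearMap.ext fun v => ?_
      rw [hc]
      ext i
      simp
    ext i j
    have h2 := fun i j => congrFun (congrFun h1 i) j
    have h3 := h2 i0 i0
    have h4 := h2 i j
    rw [Matrix.scalar_apply] at h3 h4
    rw [Matrix.scalar_apply]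
    rw [Matrix.diagonal_apply] at h4 ⊢
    rw [Matrix.diagonal_apply_eq] at h3
    split_ifs at h4 ⊢
    · exact h4.trans h3.symm
    · exact h4
  have hNr : N.map (residue (VR p)) = (Fintype.card K : KK p) • M0 := by
    have : ∀ x, (A x * (M * A x⁻¹)).map (residue (VR p)) = M0 := by
      intro x
      have h1 : M0 * (A x⁻¹).map (residue (VR p)) = (A x⁻¹).map (residue (VR p)) * M0 := by
        apply Matrix.toLin'.injective
        refine LinearMap.ext fun v => ?_
        have := hf x⁻¹ v
        rw [redRep_apply] at this
        rw [Matrix.toLin'_mul_apply, Matrix.toLin'_mul_apply, Matrix.toLin'_toMatrix']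
        exact this
      rw [Matrix.map_mul, Matrix.map_mul, hM, h1, ← mul_assoc, ← Matrix.map_mul, ← map_mul]
      simp
    change (residue (VR p)).mapMatrix N = _
    rw [map_sum]
    refine (Finset.sum_congr rfl fun x _ => this x).trans ?_
    rw [Finset.sum_const, Finset.card_univ, Nat.cast_smul_eq_nsmul]
  refine ⟨(Fintype.card K : KK p)⁻¹ * residue (VR p) (N i0 i0), fun v => ?_⟩
  have h5 : M0 = Matrix.scalar ι ((Fintype.card K : KK p)⁻¹ * residue (VR p) (N i0 i0)) := by
    have h7 : (N.map (residue (VR p))) = Matrix.scalar ι (residue (VR p) (N i0 i0)) := by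
      rw [hNs]
      ext i j
      simp only [Matrix.scalar_apply, Matrix.map_apply, Matrix.diagonal_apply]
      split_ifs <;> simp
    have h8 := congrArg (fun X => (Fintype.card K : KK p)⁻¹ • X) (h7.symm.trans hNr)
    simp only [smul_smul, inv_mul_cancel₀ hK', one_smul] at h8
    rw [← h8]
    ext i j
    simp only [Matrix.scalar_apply, Matrix.smul_apply, Matrix.diagonal_apply, smul_eq_mul]
    split_ifs <;> simp
  have h6 : f v = Matrix.toLin' M0 v := by rw [Matrix.toLin'_toMatrix']
  rw [h6, h5]
  ext i
  simp

theorem HasLift.of_equiv {U W : Type} [AddCommGroup U] [Module (KK p) U] [AddCommGroup W]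
    [Module (KK p) W] {τ : Representation (KK p) K U} {σ : Representation (KK p) K W}
    (e : U ≃ₗ[KK p] W) (he : ∀ g u, e (τ g u) = σ g (e u)) (h : HasLift τ) : HasLift σ := by
  obtain ⟨ι, _, b, A, hA⟩ := h
  refine ⟨ι, _, b.map e, A, ?_⟩
  rw [isLift_iff] at hA ⊢
  intro g j
  rw [Basis.map_apply, ← he, hA, map_sum]
  exact Finset.sum_congr rfl fun i _ => by rw [map_smul, Basis.map_apply]

/-- The pairing of a lattice with a modular representation. -/
def pairing {W : Type} [AddCommGroup W] [Module (KK p) W] (σ : Representation (KK p) K W)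
    (A : K →* Matrix ι ι (VR p)) : KK p :=
  ∑ x, LinearMap.trace (KK p) W (σ x) * residue (VR p) (A x⁻¹).trace

theorem hasLift_of_pairing {W : Type} [AddCommGroup W] [Module (KK p) W] [FiniteDimensional (KK p) W]
    {σ : Representation (KK p) K W} (h : Irr σ) (hK : ¬ p ∣ Nat.card K) (n : ℕ) :
    ∀ (ι : Type) [Fintype ι] (A : K →* Matrix ι ι (VR p)), Fintype.card ι = n →
      pairing σ A ≠ 0 → HasLift σ := by
  induction n using Nat.strong_induction_on with
  | _ n ih =>
  intro ι _ A hn h0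
  by_cases hA : Irr (extRep A)
  · obtain ⟨e, he⟩ := exists_avg_ne_zero (redRep A) σ (by
      intro h1
      apply h0
      rw [← h1]
      exact Finset.sum_congr rfl fun x _ => by rw [(isLift_redRep A).trace])
    have hc := avg_comm (redRep A) σ e
    have hi := (irr_redRep hK hA).injective _ hc he
    have hs := h.surjective _ hc he
    exact (HasLift.redRep A).of_equiv (LinearEquiv.ofBijective _ ⟨hi, hs⟩) hc
  · have hne : Nonempty ι := by
      by_contra hcon
      rw [not_nonempty_iff] at hcon
      apply h0
      simp [pairing, Matrix.trace]
    have : ∃ D, InvSub (extRep A) D ∧ D ≠ ⊥ ∧ D ≠ ⊤ := by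
      by_contra! hcon
      exact hA ⟨inferInstance, fun D hD => or_iff_not_imp_left.mpr (hcon D hD)⟩
    obtain ⟨D, hD, hD0, hD1⟩ := this
    obtain ⟨ι₁, _, b₁, A₁, hA₁⟩ := exists_lattice (p := p) (subRep _ D hD)
    obtain ⟨ι₂, _, b₂, A₂, hA₂⟩ := exists_lattice (p := p) (quoRep _ D hD)
    have hd : finrank ℂ (ι → ℂ) = n := by simp [hn]
    have hd1 := D.finrank_quotient_add_finrank
    have hd2 := Submodule.finrank_lt hD1
    have hd3 : finrank ℂ D ≠ 0 := fun h => hD0 (Submodule.finrank_eq_zero.mp h)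
    have hd4 := finrank_eq_card_basis b₁
    have hd5 := finrank_eq_card_basis b₂
    have htr : ∀ {κ V : Type} [Fintype κ] [AddCommGroup V] [Module ℂ V] (ρ : Representation ℂ K V)
        (b : Basis κ ℂ V) (B : K →* Matrix κ κ (VR p)),
        (∀ g, LinearMap.toMatrix b b (ρ g) = (B g).map (algebraMap (VR p) ℂ)) →
        ∀ g, LinearMap.trace ℂ V (ρ g) = ((B g).trace : VR p) := by
      intro κ V _ _ _ ρ b B hB g
      rw [LinearMap.trace_eq_matrix_trace ℂ b, hB]
      simp only [Matrix.trace, Matrix.diag_apply, Matrix.map_apply]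
      exact (map_sum (algebraMap (VR p) ℂ) _ _).symm
    have hadd : ∀ g, (A g).trace = (A₁ g).trace + (A₂ g).trace := by
      intro g
      apply Subtype.ext
      have := trace_sub_quo (extRep A g) D (hD g)
      rw [trace_extRep] at this
      rw [this]
      exact congrArg₂ _ (htr _ b₁ A₁ hA₁ g) (htr _ b₂ A₂ hA₂ g)
    have hp : pairing σ A = pairing σ A₁ + pairing σ A₂ := by
      rw [pairing, pairing, pairing, ← Finset.sum_add_distrib]
      exact Finset.sum_congr rfl fun x _ => by rw [hadd, map_add, mul_add]
    by_cases h1 : pairing σ A₁ = 0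
    · rw [h1, zero_add] at hp
      exact ih _ (by omega) ι₂ A₂ rfl (hp ▸ h0)
    · exact ih _ (by omega) ι₁ A₁ rfl h1

/-- The regular matrix representation. -/
def regHom (R : Type) [CommRing R] : K →* Matrix K K R where
  toFun g := Matrix.of fun x y => if x = g * y then 1 else 0
  map_one' := by ext x y; simp [Matrix.one_apply]
  map_mul' g h := by
    ext x y
    rw [Matrix.mul_apply, Finset.sum_eq_single (h * y)]
    · simp [mul_assoc]
    · intro z _ hz
      rw [Matrix.of_apply, Matrix.of_apply, if_neg hz, mul_zero]
    · simp

theorem Irr.hasLift_of_coprime {W : Type} [AddCommGroup W] [Module (KK p) W] [FiniteDimensional (KK p) W]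
    {σ : Representation (KK p) K W} (h : Irr σ) (hK : ¬ p ∣ Nat.card K) : HasLift σ := by
  refine hasLift_of_pairing h hK _ K (regHom (VR p)) rfl ?_
  have htr : ∀ g : K, (regHom (VR p) g).trace = if g = 1 then (Fintype.card K : VR p) else 0 := by
    intro g
    simp only [Matrix.trace, Matrix.diag_apply, regHom, MonoidHom.coe_mk, OneHom.coe_mk, Matrix.of_apply,
      right_eq_mul]
    split_ifs <;> simp
  rw [pairing, Finset.sum_eq_single 1]
  · rw [inv_one, htr, if_pos rfl, map_one, map_natCast]
    have h1 : LinearMap.trace (KK p) W 1 = finrank (KK p) W := LinearMap.trace_one _ _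
    rw [h1]
    exact mul_ne_zero (h.natCast_finrank_ne_zero (natCast_card_ne_zero hK)) (natCast_card_ne_zero hK)
  · intro x _ hx
    rw [htr, if_neg (by simpa using hx), map_zero, mul_zero]
  · simp

theorem Irr.not_dvd_finrank_of_coprime {W : Type} [AddCommGroup W] [Module (KK p) W]
    [FiniteDimensional (KK p) W] {σ : Representation (KK p) K W} (h : Irr σ)
    (hK : ¬ p ∣ Nat.card K) : ¬ p ∣ finrank (KK p) W := by
  intro hd
  apply h.natCast_finrank_ne_zero (natCast_card_ne_zero hK)
  rwa [CharP.cast_eq_zero_iff (KK p) p]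

end CoprimeLifts

section PCores
open Module

variable {p : ℕ} [hp : Fact p.Prime] {k : Type} [Field k] [CharP k p] {H : Type} [Group H] {E : Type}
  [AddCommGroup E] [Module k E]

theorem exists_fixed_vector {D : Type} [Group D] [Finite D] (hD : IsPGroup p D)
    (X : Representation k D E) [Nontrivial E] : ∃ v ≠ 0, ∀ d, X d v = v := by
  obtain ⟨v, hv⟩ := exists_ne (0 : E)
  have : CharP k p := inferInstance
  let S : AddSubgroup E := AddSubgroup.closure (Set.range fun d => X d v)
  have hpS : ∀ s ∈ S, p • s = 0 := by
    intro s _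
    rw [← Nat.cast_smul_eq_nsmul k, CharP.cast_eq_zero, zero_smul]
  have hfin : Finite S := by
    have h1 : AddGroup.FG S := (AddGroup.fg_iff_addSubgroup_fg S).mpr
      ⟨(Set.finite_range fun d => X d v).toFinset, by simp [S]⟩
    refine AddCommGroup.finite_of_fg_isAddTorsion S fun s => ?_
    refine isOfFinAddOrder_iff_nsmul_eq_zero.mpr ⟨p, hp.out.pos, ?_⟩
    exact Subtype.ext (hpS s s.2)
  have hS : ∀ d, ∀ s ∈ S, X d s ∈ S := by
    intro d s hs
    have : S ≤ S.comap (X d).toAddMonoidHom := by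
      rw [AddSubgroup.closure_le]
      rintro _ ⟨e, rfl⟩
      refine AddSubgroup.subset_closure ⟨d * e, ?_⟩
      simp
    exact this hs
  let act : MulAction D S :=
    { smul := fun d s => ⟨X d s, hS d s s.2⟩
      one_smul := fun s => Subtype.ext (by change X 1 (s : E) = s; simp)
      mul_smul := fun a b s => Subtype.ext (by change X (a * b) (s : E) = X a (X b s); simp) }
  have hcard : p ∣ Nat.card S := by
    have hv' : v ∈ S := AddSubgroup.subset_closure ⟨1, by simp⟩
    have h2 : addOrderOf (⟨v, hv'⟩ : S) = p := by
      refine addOrderOf_eq_prime (Subtype.ext (hpS v hv')) ?_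
      intro h
      exact hv (congrArg Subtype.val h)
    rw [← h2]
    exact addOrderOf_dvd_natCard _
  have h0 : (0 : S) ∈ MulAction.fixedPoints D S := fun d => Subtype.ext (map_zero (X d))
  obtain ⟨s, hs, hs0⟩ := hD.exists_fixed_point_of_prime_dvd_card_of_fixed_point S hcard h0
  refine ⟨s, fun h => hs0 (Subtype.ext h.symm), fun d => ?_⟩
  exact congrArg Subtype.val (hs d)

theorem factorization_quotient_ker_lt [Finite H] {X : Representation k H E} (hX : Irr X)
    {N L : Subgroup H} (hN : N.Normal) (hL : L.Normal) (hNL : N < L)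
    (hpow : PowStep (EPow p) N L) (hs : ∀ n ∈ N, ∃ c : k, ∀ v, X n v = c • v) :
    (Nat.card (H ⧸ X.ker)).factorization p < (Nat.card H).factorization p := by
  let D : Sylow p L := default
  let D' : Subgroup H := (D : Subgroup L).map L.subtype
  have hDL : D' ≤ L := Subgroup.map_subtype_le _
  have hDp : IsPGroup p D' := D.2.map _
  have hDN : D' ⊔ N = L := by
    refine le_antisymm (sup_le hDL hNL.le) ?_
    rw [← Subgroup.relIndex_eq_one]
    have h1 : (D' ⊔ N).relIndex L ∣ D'.relIndex L := Subgroup.relIndex_dvd_of_le_left _ le_sup_left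
    have h2 : (D' ⊔ N).relIndex L ∣ N.relIndex L := Subgroup.relIndex_dvd_of_le_left _ le_sup_right
    have h3 : D'.relIndex L = (D : Subgroup L).index := by
      rw [Subgroup.relIndex, Subgroup.subgroupOf, Subgroup.comap_map_eq_self_of_injective L.subtype_injective]
    have h4 : ¬ p ∣ (D : Subgroup L).index := D.not_dvd_index
    have h5 : IsPGroup p (L ⧸ N.subgroupOf L) := by
      intro x
      obtain ⟨x, rfl⟩ := QuotientGroup.mk_surjective x
      obtain ⟨q, ⟨a, rfl⟩, hq⟩ := hpow x x.2
      refine ⟨a, ?_⟩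
      rw [← QuotientGroup.mk_pow, QuotientGroup.eq_one_iff]
      exact hq
    obtain ⟨n, hn⟩ := IsPGroup.iff_card.mp h5
    have h6 : N.relIndex L = p ^ n := hn
    rw [h3] at h1
    rw [h6] at h2
    obtain ⟨m, -, hm⟩ := (Nat.dvd_prime_pow hp.out).mp h2
    rw [hm] at h1 ⊢
    cases m with
    | zero => simp
    | succ m => exact absurd ((dvd_pow_self p (Nat.succ_ne_zero m)).trans h1) h4
  have hD1 : D' ≠ ⊥ := by
    intro h
    rw [h, bot_sup_eq] at hDN
    exact hNL.ne hDN
  have := hX.1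
  let F : Submodule k E := ⨅ d : D', LinearMap.eqLocus (X d) LinearMap.id
  have hF : ∀ v, v ∈ F ↔ ∀ d ∈ D', X d v = v := by
    intro v
    simp [F, Submodule.mem_iInf, LinearMap.mem_eqLocus]
  have hFinv : InvSub X F := by
    have h1 : (⊤ : Subgroup H) ≤
        { carrier := {g | ∀ v ∈ F, X g v ∈ F ∧ X g⁻¹ v ∈ F}
          mul_mem' := by
            intro a b ha hb v hv
            rw [mul_inv_rev, rho_mul_apply, rho_mul_apply]
            exact ⟨(ha _ (hb v hv).1).1, (hb _ (ha v hv).2).2⟩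
          one_mem' := by intro v hv; simpa using hv
          inv_mem' := by intro a ha v hv; rw [inv_inv]; exact (ha v hv).symm } := by
      rw [← Sylow.normalizer_sup_eq_top D, sup_le_iff]
      constructor
      · have key : ∀ g, g ∈ Subgroup.normalizer (D' : Set H) → ∀ v ∈ F, X g v ∈ F := by
          intro g hg v hv
          rw [hF] at hv ⊢
          intro d hd
          have h2 : g⁻¹ * d * g ∈ D' := by
            have h3 := (Subgroup.mem_normalizer_iff.mp (inv_mem hg) d).mp hd
            simpa using h3
          rw [← rho_mul_apply, show d * g = g * (g⁻¹ * d * g) by group, rho_mul_apply, hv _ h2]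
        intro g hg v hv
        exact ⟨key g hg v hv, key g⁻¹ (inv_mem hg) v hv⟩
      · have key : ∀ g ∈ L, ∀ v ∈ F, X g v ∈ F := by
          intro g hg v hv
          rw [← hDN, Subgroup.mem_sup_of_normal_right] at hg
          obtain ⟨d, hd, n, hn, rfl⟩ := hg
          obtain ⟨c, hc⟩ := hs n hn
          rw [rho_mul_apply, hc, map_smul, (hF v).mp hv d hd]
          exact F.smul_mem c hv
        intro g hg v hv
        exact ⟨key g hg v hv, key g⁻¹ (inv_mem hg) v hv⟩
    intro g v hv
    exact (h1 (Subgroup.mem_top g) v hv).1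
  have hF0 : F ≠ ⊥ := by
    obtain ⟨v, hv, h1⟩ := exists_fixed_vector hDp (X.comp D'.subtype)
    exact F.ne_bot_iff.mpr ⟨v, (hF v).mpr fun d hd => h1 ⟨d, hd⟩, hv⟩
  have hFt := (hX.2 F hFinv).resolve_left hF0
  have hDker : D' ≤ X.ker := by
    intro d hd
    rw [MonoidHom.mem_ker]
    refine LinearMap.ext fun v => ?_
    exact (hF v).mp (by rw [hFt]; trivial) d hd
  have hpk : p ∣ Nat.card X.ker := by
    have h1 : p ∣ Nat.card D' := by
      obtain ⟨n, hn⟩ := IsPGroup.iff_card.mp hDp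
      rw [hn]
      refine dvd_pow_self p ?_
      rintro rfl
      exact hD1 (Subgroup.card_eq_one.mp (by simpa using hn))
    exact h1.trans (Subgroup.card_dvd_of_le hDker)
  have hc := X.ker.card_eq_card_quotient_mul_card_subgroup
  rw [hc, Nat.factorization_mul Nat.card_pos.ne' Nat.card_pos.ne', Finsupp.add_apply]
  have := hp.out.factorization_pos_of_dvd Nat.card_pos.ne' hpk
  omega

end PCores

section LiftExtension
open Module IsLocalRing Polynomial

variable {p : ℕ} [hp : Fact p.Prime] {ι : Type} [Fintype ι]

theorem exists_root_VR (u : VR p) {n : ℕ} (hn : n ≠ 0) : ∃ v : VR p, v ^ n = u := by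
  obtain ⟨s, hs⟩ := monic_eq_prod_roots (X ^ n - C u : (VR p)[X]) (monic_X_pow_sub_C u hn)
  have hd : (X ^ n - C u : (VR p)[X]).natDegree = n := natDegree_X_pow_sub_C
  have hs0 : s ≠ 0 := by
    rintro rfl
    rw [Multiset.map_zero, Multiset.prod_zero] at hs
    rw [hs, natDegree_one] at hd
    exact hn hd.symm
  obtain ⟨v, hv⟩ := Multiset.exists_mem_of_ne_zero hs0
  refine ⟨v, ?_⟩
  have h1 := congrArg (eval v) hs
  rw [eval_multiset_prod, Multiset.prod_eq_zero, eval_sub, eval_pow, eval_X, eval_C, sub_eq_zero] at h1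
  · exact h1
  · rw [Multiset.map_map, Multiset.mem_map]
    exact ⟨v, hv, by simp⟩

/-- A nonzero matrix over the valuation ring is a multiple of one with an entry equal to one. -/
theorem exists_primitive {N : Matrix ι ι (VR p)} (hN : N ≠ 0) :
    ∃ (c : VR p) (P : Matrix ι ι (VR p)) (i j : ι), c ≠ 0 ∧ N = c • P ∧ P i j = 1 := by
  have hne : Nonempty ι := by
    by_contra h
    rw [not_nonempty_iff] at h
    exact hN (Subsingleton.elim _ _)
  obtain ⟨⟨i, j⟩, -, hij⟩ := Finset.exists_max_image Finset.univ
    (fun x : ι × ι => (VR p).valuation (N x.1 x.2)) Finset.univ_nonempty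
  have hdvd : ∀ a b, ∃ d, N a b = N i j * d := fun a b => by
    have h1 := hij (a, b) (Finset.mem_univ _)
    obtain ⟨d, hd⟩ := ((VR p).valuation_le_iff _ _).mp h1
    exact ⟨d, Subtype.ext (hd.symm.trans (mul_comm _ _))⟩
  choose P hP using hdvd
  have h0 : N i j ≠ 0 := by
    intro h
    apply hN
    ext a b
    rw [hP, h, zero_mul]; rfl
  refine ⟨N i j, Matrix.of P, i, j, h0, ?_, ?_⟩
  · ext a b
    rw [hP a b]; rfl
  · have := hP i j
    exact mul_left_cancel₀ h0 (by rw [mul_one]; exact this.symm)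

theorem scalar_of_commute {H : Type} [Group H] {S : H →* Matrix ι ι (VR p)} (h : Irr (redRep S))
    {N : Matrix ι ι (VR p)} (hN : ∀ x, N * S x = S x * N) : ∃ c, N = Matrix.scalar ι c := by
  have := h.1
  have hne : Nonempty ι := by
    by_contra hcon
    rw [not_nonempty_iff] at hcon
    exact not_subsingleton (ι → KK p) inferInstance
  obtain ⟨i0⟩ := hne
  refine ⟨N i0 i0, ?_⟩
  by_contra hcon
  obtain ⟨c, P, i, j, hc, hP, hij⟩ := exists_primitive (sub_ne_zero.mpr hcon)
  have hPc : ∀ x, P * S x = S x * P := by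
    intro x
    apply smul_right_injective _ hc
    change c • (P * S x) = c • (S x * P)
    rw [← Matrix.smul_mul, ← Matrix.mul_smul, ← hP, sub_mul, mul_sub, hN,
      (Matrix.scalar_commute (N i0 i0) (fun r => Commute.all _ _) (S x)).eq]
  obtain ⟨d, hd⟩ := h.schur (Matrix.toLin' (P.map (residue (VR p)))) (by
    intro g v
    rw [redRep_apply, ← Matrix.toLin'_mul_apply, ← Matrix.toLin'_mul_apply, ← Matrix.map_mul,
      ← Matrix.map_mul, hPc])
  have h1 : P.map (residue (VR p)) = Matrix.scalar ι d := by
    apply Matrix.toLin'.injective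
    refine LinearMap.ext fun v => ?_
    rw [hd]
    ext i
    simp
  have hP0 : P i0 i0 = 0 := by
    have h2 := congrFun (congrFun hP i0) i0
    simp only [Matrix.sub_apply, Matrix.scalar_apply, Matrix.diagonal_apply_eq, sub_self,
      Matrix.smul_apply, smul_eq_mul] at h2
    exact (mul_eq_zero.mp h2.symm).resolve_left hc
  have hd0 : d = 0 := by
    have h2 := congrFun (congrFun h1 i0) i0
    rw [Matrix.map_apply, hP0, map_zero, Matrix.scalar_apply, Matrix.diagonal_apply_eq] at h2
    exact h2.symm
  have h3 := congrFun (congrFun h1 i) j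
  rw [Matrix.map_apply, hij, map_one, hd0, map_zero] at h3
  exact one_ne_zero h3

variable {G : Type} [Group G] {K : Subgroup G} [hKn : K.Normal]

/-- The group of pairs of a group element and a unimodular matrix inducing the same
automorphism on a lattice for a normal subgroup. -/
def liftGroup (S : K →* Matrix ι ι (VR p)) : Subgroup (G × (Matrix ι ι (VR p))ˣ) where
  carrier := {a | (∀ x, (a.2 : Matrix ι ι (VR p)) * S x = S (MulAut.conjNormal a.1 x) * a.2) ∧
    (a.2 : Matrix ι ι (VR p)).det = 1}
  mul_mem' := by
    rintro a b ⟨ha, ha'⟩ ⟨hb, hb'⟩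
    refine ⟨fun x => ?_, ?_⟩
    · rw [Prod.snd_mul, Units.val_mul, mul_assoc, hb, ← mul_assoc, ha, mul_assoc, Prod.fst_mul, map_mul]
      rfl
    · rw [Prod.snd_mul, Units.val_mul, Matrix.det_mul, ha', hb', one_mul]
  one_mem' := by
    refine ⟨fun x => ?_, ?_⟩ <;> simp
  inv_mem' := by
    rintro a ⟨ha, ha'⟩
    refine ⟨fun x => ?_, ?_⟩
    · have h1 := ha (MulAut.conjNormal a.1⁻¹ x)
      rw [← MulAut.mul_apply, ← map_mul, mul_inv_cancel, map_one, MulAut.one_apply] at h1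
      rw [Prod.snd_inv, Units.inv_mul_eq_iff_eq_mul, ← mul_assoc, Prod.fst_inv, h1, mul_assoc,
        Units.mul_inv, mul_one]
    · have h2 : (a.2⁻¹ * a.2 : (Matrix ι ι (VR p))ˣ) = 1 := inv_mul_cancel _
      have h3 := congrArg (fun u : (Matrix ι ι (VR p))ˣ => (u : Matrix ι ι (VR p)).det) h2
      simp only [Units.val_mul, Matrix.det_mul, ha', mul_one, Units.val_one, Matrix.det_one] at h3
      exact h3

variable (S : K →* Matrix ι ι (VR p))

/-- The projection to the group. -/
def liftProj : liftGroup S →* G := (MonoidHom.fst _ _).comp (liftGroup S).subtype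

/-- The matrix component. -/
def liftMat : liftGroup S →* Matrix ι ι (VR p) :=
  (Units.coeHom _).comp ((MonoidHom.snd _ _).comp (liftGroup S).subtype)

variable {S}

theorem liftMat_mul (a : liftGroup S) (x : K) :
    liftMat S a * S x = S (MulAut.conjNormal (liftProj S a) x) * liftMat S a := a.2.1 x

theorem liftMat_det (a : liftGroup S) : (liftMat S a).det = 1 := a.2.2

theorem liftMat_of_ker (h : Irr (redRep S)) (a : liftGroup S) (ha : a ∈ (liftProj S).ker) :
    ∃ c : VR p, liftMat S a = Matrix.scalar ι c ∧ c ^ Fintype.card ι = 1 := by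
  rw [MonoidHom.mem_ker] at ha
  obtain ⟨c, hc⟩ := scalar_of_commute h (N := liftMat S a) (by
    intro x
    rw [liftMat_mul, ha, map_one, MulAut.one_apply])
  refine ⟨c, hc, ?_⟩
  have := liftMat_det a
  rwa [hc, Matrix.scalar_apply, Matrix.det_diagonal, Finset.prod_const, Finset.card_univ] at this

theorem liftGroup_ext {a b : liftGroup S} (h1 : liftProj S a = liftProj S b)
    (h2 : liftMat S a = liftMat S b) : a = b :=
  Subtype.ext (Prod.ext h1 (Units.ext h2))

theorem pow_eq_one_of_ker (h : Irr (redRep S)) (a : liftGroup S) (ha : a ∈ (liftProj S).ker) :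
    a ^ Fintype.card ι = 1 := by
  obtain ⟨c, hc, h1⟩ := liftMat_of_ker h a ha
  apply liftGroup_ext
  · rw [map_pow, (MonoidHom.mem_ker).mp ha, one_pow, map_one]
  · rw [map_pow, hc, ← map_pow, h1, map_one, map_one]

theorem finite_ker (h : Irr (redRep S)) : Finite (liftProj S).ker := by
  have := h.1
  have hne : Nonempty ι := by
    by_contra hcon
    rw [not_nonempty_iff] at hcon
    exact not_subsingleton (ι → KK p) inferInstance
  have hfin : Finite {c : VR p | c ^ Fintype.card ι = 1} := by
    refine Set.Finite.subset (nthRoots (Fintype.card ι) (1 : VR p)).toFinset.finite_toSet ?_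
    intro c hc
    simpa [mem_nthRoots Fintype.card_pos] using hc
  choose f hf using fun a : (liftProj S).ker => liftMat_of_ker h a.1 a.2
  refine Finite.of_injective (fun a => (⟨f a, (hf a).2⟩ : {c : VR p | c ^ Fintype.card ι = 1})) ?_
  intro a b hab
  have h1 : f a = f b := congrArg Subtype.val hab
  refine Subtype.ext (liftGroup_ext ?_ ?_)
  · rw [(MonoidHom.mem_ker).mp a.2, (MonoidHom.mem_ker).mp b.2]
  · rw [(hf a).1, (hf b).1, h1]

theorem finite_liftGroup [Finite G] (h : Irr (redRep S)) : Finite (liftGroup S) := by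
  have := finite_ker h
  have h1 : Finite (liftGroup S ⧸ (liftProj S).ker) :=
    Finite.of_injective _ (QuotientGroup.kerLift_injective (liftProj S))
  exact Finite.of_equiv _ (Subgroup.groupEquivQuotientProdSubgroup (s := (liftProj S).ker)).symm

theorem factorization_liftGroup [Finite G] (h : Irr (redRep S)) (hι : ¬ p ∣ Fintype.card ι)
    (hs : Function.Surjective (liftProj S)) :
    (Nat.card (liftGroup S)).factorization p = (Nat.card G).factorization p := by
  have := finite_liftGroup h
  have h1 : ¬ p ∣ Nat.card (liftProj S).ker := by
    intro hd
    obtain ⟨x, hx⟩ := exists_prime_orderOf_dvd_card' p hd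
    have h2 : x ^ Fintype.card ι = 1 := Subtype.ext (pow_eq_one_of_ker h x x.2)
    exact hι (hx ▸ orderOf_dvd_of_pow_eq_one h2)
  rw [(liftProj S).ker.card_eq_card_quotient_mul_card_subgroup,
    Nat.factorization_mul Nat.card_pos.ne' Nat.card_pos.ne', Finsupp.add_apply,
    Nat.factorization_eq_zero_of_not_dvd h1, add_zero,
    Nat.card_congr (QuotientGroup.quotientKerEquivOfSurjective _ hs).toEquiv]

theorem liftProj_surjective [Finite G] (hK : ¬ p ∣ Nat.card K) (hι : Fintype.card ι ≠ 0)
    (hT : ∀ g : G, ∃ T : Matrix ι ι (KK p), T.det ≠ 0 ∧ ∀ x : K,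
      T * (S x).map (residue (VR p)) = (S (MulAut.conjNormal g x)).map (residue (VR p)) * T) :
    Function.Surjective (liftProj S) := by
  intro g
  obtain ⟨T, hT0, hT⟩ := hT g
  have := Fintype.ofFinite K
  have hK' := natCast_card_ne_zero hK
  choose lft hlft using residue_surjective (R := VR p)
  let M : Matrix ι ι (VR p) := T.map lft
  have hM : M.map (residue (VR p)) = T := by ext i j; simp [M, hlft]
  let N : Matrix ι ι (VR p) := ∑ x : K, S (MulAut.conjNormal g x) * (M * S x⁻¹)
  have hN : ∀ y, N * S y = S (MulAut.conjNormal g y) * N := by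
    intro y
    rw [Finset.sum_mul, Finset.mul_sum]
    refine Fintype.sum_equiv (Equiv.mulLeft y⁻¹) _ _ fun x => ?_
    rw [Equiv.coe_mulLeft, ← mul_assoc (S (MulAut.conjNormal g y)), ← map_mul, ← map_mul,
      mul_inv_cancel_left, mul_assoc, mul_assoc, ← map_mul, mul_inv_rev, inv_inv]
  have hNr : N.map (residue (VR p)) = (Fintype.card K : KK p) • T := by
    have : ∀ x : K, (S (MulAut.conjNormal g x) * (M * S x⁻¹)).map (residue (VR p)) = T := by
      intro x
      rw [Matrix.map_mul, Matrix.map_mul, hM, hT, ← mul_assoc, ← Matrix.map_mul, ← map_mul,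
        ← map_mul, mul_inv_cancel, map_one, map_one]
      simp
    change (residue (VR p)).mapMatrix N = _
    rw [map_sum]
    refine (Finset.sum_congr rfl fun x _ => this x).trans ?_
    rw [Finset.sum_const, Finset.card_univ, Nat.cast_smul_eq_nsmul]
  have hdet : IsUnit N.det := by
    rw [← residue_ne_zero_iff_isUnit, RingHom.map_det]
    change (N.map (residue (VR p))).det ≠ 0
    rw [hNr, Matrix.det_smul]
    exact mul_ne_zero (pow_ne_zero _ hK') hT0
  obtain ⟨u, hu⟩ := hdet
  obtain ⟨c, hc⟩ := exists_root_VR ((u⁻¹ : (VR p)ˣ) : VR p) hι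
  have hd : (c • N).det = 1 := by
    rw [Matrix.det_smul, hc, ← hu, Units.inv_mul]
  let U : (Matrix ι ι (VR p))ˣ := Matrix.nonsingInvUnit (c • N) (by rw [hd]; exact isUnit_one)
  have hU : (U : Matrix ι ι (VR p)) = c • N := rfl
  refine ⟨⟨(g, U), fun x => ?_, ?_⟩, rfl⟩
  · change (U : Matrix ι ι (VR p)) * S x = S (MulAut.conjNormal g x) * U
    rw [hU, Matrix.smul_mul, hN, Matrix.mul_smul]
  · change (U : Matrix ι ι (VR p)).det = 1
    rw [hU, hd]

end LiftExtension

section Homogeneous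
open Module IsLocalRing

/-- The index type of a Kronecker product of matrix representations. -/
structure PairIdx (J ι : Type) : Type where
  left : J
  right : ι

/-- Indices are pairs. -/
def pairIdxEquiv (J ι : Type) : PairIdx J ι ≃ J × ι where
  toFun x := (x.1, x.2)
  invFun x := ⟨x.1, x.2⟩

instance {J ι : Type} [Fintype J] [Fintype ι] : Fintype (PairIdx J ι) :=
  Fintype.ofEquiv _ (pairIdxEquiv J ι).symm

theorem sum_pairIdx {J ι : Type} [Fintype J] [Fintype ι] {M : Type} [AddCommMonoid M]
    (f : PairIdx J ι → M) : ∑ x, f x = ∑ q : J, ∑ i : ι, f ⟨q, i⟩ := by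
  rw [← Fintype.sum_prod_type (f := fun x : J × ι => f ⟨x.1, x.2⟩)]
  exact Fintype.sum_equiv (pairIdxEquiv J ι) _ _ fun _ => rfl

/-- The Kronecker product of matrix representations. -/
def kronHom {R : Type} [CommRing R] {H : Type} [Group H] {J ι : Type} [Fintype J] [Fintype ι]
    (A : H →* Matrix J J R) (B : H →* Matrix ι ι R) :
    H →* Matrix (PairIdx J ι) (PairIdx J ι) R where
  toFun h := Matrix.of fun x y => A h x.1 y.1 * B h x.2 y.2
  map_one' := by
    ext ⟨x, i⟩ ⟨y, j⟩
    simp only [map_one, Matrix.of_apply, Matrix.one_apply, PairIdx.mk.injEq]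
    by_cases h1 : x = y <;> by_cases h2 : i = j <;> simp [h1, h2]
  map_mul' a b := by
    ext ⟨x, i⟩ ⟨y, j⟩
    rw [Matrix.mul_apply, sum_pairIdx]
    simp only [map_mul, Matrix.of_apply, Matrix.mul_apply, Finset.sum_mul_sum]
    exact Finset.sum_congr rfl fun q _ => Finset.sum_congr rfl fun r _ => by ring

theorem exists_descent {H G M : Type} [Group H] [Group G] [Monoid M] {π : H →* G}
    (hπ : Function.Surjective π) (A : H →* M) (hA : ∀ h, π h = 1 → A h = 1) :
    ∃ B : G →* M, ∀ h, B (π h) = A h := by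
  let e := QuotientGroup.quotientKerEquivOfSurjective π hπ
  refine ⟨(QuotientGroup.lift π.ker A hA).comp e.symm.toMonoidHom, fun h => ?_⟩
  have h1 : e (h : H ⧸ π.ker) = π h := rfl
  rw [← h1]
  simp
  rfl

set_option linter.unusedSectionVars false

section
variable {k : Type} [Field k] {G : Type} [Group G] {K : Subgroup G} [hKn : K.Normal]
  {V : Type} [AddCommGroup V] [Module k V] {ρ : Representation k G V}
  {W : Type} [AddCommGroup W] [Module k W] {σ : Representation k K W}
  {H : Type} [Group H] (π : H →* G) (τ : Representation k H W)

theorem exists_twist [IsAlgClosed k] [FiniteDimensional k V] [FiniteDimensional k W] [Fintype K]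
    (hσ : Irr σ) (hK : (Fintype.card K : k) ≠ 0)
    (hE : spanOf (homs σ (ρ.comp K.subtype)) = ⊤) (hV : Nontrivial V) (g : G) :
    ∃ f : W →ₗ[k] W, Function.Injective f ∧
      ∀ (x : K) w, f (σ x w) = σ (MulAut.conjNormal g x) (f w) := by
  have := hσ.1
  obtain ⟨h0, hh0, hh0'⟩ : ∃ h ∈ homs σ (ρ.comp K.subtype), h ≠ 0 := by
    by_contra! hcon
    apply bot_ne_top (α := Submodule k V)
    rw [← hE, eq_comm, eq_bot_iff, spanOf_le]
    intro f hf w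
    rw [hcon f hf]; simp
  have hh0i := hσ.injective h0 hh0 hh0'
  let f : W →ₗ[k] V := ρ g⁻¹ ∘ₗ h0
  have hfi : Function.Injective f := (rho_injective ρ g⁻¹).comp hh0i
  have hf : ∀ (x : K) w, f (σ (MulAut.conjNormal g x) w) = ρ x (f w) := by
    intro x w
    change ρ g⁻¹ (h0 _) = ρ x (ρ g⁻¹ (h0 w))
    have h1 := hh0 (MulAut.conjNormal g x) w
    rw [h1, ← rho_mul_apply]
    change ρ g⁻¹ (ρ (MulAut.conjNormal g x : K) (h0 w)) = _
    rw [← rho_mul_apply, MulAut.conjNormal_apply]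
    congr 2
    group
  obtain ⟨r, hr⟩ := f.exists_leftInverse_of_injective (LinearMap.ker_eq_bot.mpr hfi)
  let σ' : Representation k K W := σ.comp (MulAut.conjNormal g).toMonoidHom
  let s := avg (ρ.comp K.subtype) σ' r
  have hs := avg_comm (ρ.comp K.subtype) σ' r
  have hsf : ∀ w, s (f w) = (Fintype.card K : k) • w := by
    intro w
    change avg _ _ _ _ = _
    rw [avg, LinearMap.sum_apply, Finset.sum_congr rfl (g := fun _ => w), Finset.sum_const,
      Finset.card_univ, Nat.cast_smul_eq_nsmul]
    intro x _
    change σ' x (r (ρ (x⁻¹ : K) (f w))) = w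
    rw [← hf]
    have h2 := LinearMap.congr_fun hr (σ (MulAut.conjNormal g x⁻¹) w)
    rw [LinearMap.comp_apply] at h2
    rw [h2, LinearMap.id_apply]
    change σ' x (σ' x⁻¹ w) = w
    rw [rho_self_inv]
  obtain ⟨h, hh, w0, hw0⟩ : ∃ h ∈ homs σ (ρ.comp K.subtype), ∃ w, s (h w) ≠ 0 := by
    by_contra! hcon
    obtain ⟨w, hw⟩ := exists_ne (0 : W)
    have h1 : spanOf (homs σ (ρ.comp K.subtype)) ≤ LinearMap.ker s :=
      spanOf_le.mpr fun h hh w => hcon h hh w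
    rw [hE] at h1
    have h2 : s (f w) = 0 := h1 (Submodule.mem_top)
    rw [hsf] at h2
    exact (smul_ne_zero hK hw) h2
  have hc : ∀ (x : K) w, (s ∘ₗ h) (σ x w) = σ' x ((s ∘ₗ h) w) := by
    intro x w
    change s (h (σ x w)) = σ' x (s (h w))
    rw [hh x w]
    exact hs x (h w)
  refine ⟨s ∘ₗ h, hσ.injective (σ := σ') _ hc ?_, hc⟩
  intro h0
  exact hw0 (LinearMap.congr_fun h0 w0)

variable {π τ}
variable (hτ : ∀ h (x : K) w, τ h (σ x w) = σ (MulAut.conjNormal (π h) x) (τ h w))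

/-- The action on the multiplicity space. -/
def multRep (ρ : Representation k G V)
    (hτ : ∀ h (x : K) w, τ h (σ x w) = σ (MulAut.conjNormal (π h) x) (τ h w)) :
    Representation k H (homs σ (ρ.comp K.subtype)) where
  toFun h :=
    { toFun := fun f => ⟨ρ (π h) ∘ₗ f.1 ∘ₗ τ h⁻¹, by
        intro x w
        change ρ (π h) (f.1 (τ h⁻¹ (σ x w))) = ρ x (ρ (π h) (f.1 (τ h⁻¹ w)))
        rw [hτ, f.2]
        change ρ (π h) (ρ (MulAut.conjNormal (π h⁻¹) x : K) (f.1 (τ h⁻¹ w))) = _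
        rw [← rho_mul_apply, ← rho_mul_apply, MulAut.conjNormal_apply, map_inv]
        congr 2
        group⟩
      map_add' := fun f g => by
        apply Subtype.ext
        ext w
        simp
      map_smul' := fun c f => by
        apply Subtype.ext
        ext w
        simp }
  map_one' := by
    ext f w
    simp
  map_mul' a b := by
    ext f w
    simp [mul_inv_rev]

theorem multRep_apply (h : H) (f : homs σ (ρ.comp K.subtype)) (w : W) :
    (multRep ρ hτ h f).1 w = ρ (π h) (f.1 (τ h⁻¹ w)) := rfl

theorem rho_apply_hom (h : H) (f : homs σ (ρ.comp K.subtype)) (w : W) :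
    ρ (π h) (f.1 w) = (multRep ρ hτ h f).1 (τ h w) := by
  rw [multRep_apply, rho_inv_self]

/-- The subspace of `V` attached to a subspace of the multiplicity space. -/
def multSpan (F : Submodule k (homs σ (ρ.comp K.subtype))) : Submodule k V :=
  spanOf (F.map (homs σ (ρ.comp K.subtype)).subtype)

theorem multSpan_le {F : Submodule k (homs σ (ρ.comp K.subtype))} {U : Submodule k V} :
    multSpan F ≤ U ↔ ∀ f ∈ F, ∀ w, f.1 w ∈ U := by
  rw [multSpan, spanOf_le]
  constructor
  · intro h f hf w
    exact h _ ⟨f, hf, rfl⟩ w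
  · rintro h _ ⟨f, hf, rfl⟩ w
    exact h f hf w

theorem apply_mem_multSpan {F : Submodule k (homs σ (ρ.comp K.subtype))}
    {f : homs σ (ρ.comp K.subtype)} (hf : f ∈ F) (w : W) : f.1 w ∈ multSpan F :=
  multSpan_le.mp le_rfl f hf w

theorem multSpan_map_le (F : Submodule k (homs σ (ρ.comp K.subtype))) (h : H) :
    (multSpan F).map (ρ (π h)) ≤ multSpan (F.map (multRep ρ hτ h)) := by
  rw [Submodule.map_le_iff_le_comap, multSpan_le]
  intro f hf w
  rw [Submodule.mem_comap, rho_apply_hom hτ]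
  exact apply_mem_multSpan (Submodule.mem_map_of_mem hf) _

theorem multSpan_map (F : Submodule k (homs σ (ρ.comp K.subtype))) (h : H) :
    (multSpan F).map (ρ (π h)) = multSpan (F.map (multRep ρ hτ h)) := by
  refine le_antisymm (multSpan_map_le hτ F h) ?_
  have h1 := Submodule.map_mono (f := ρ (π h)) (multSpan_map_le hτ (F.map (multRep ρ hτ h)) h⁻¹)
  rwa [map_map_rho, map_map_rho, map_inv, mul_inv_cancel, inv_mul_cancel, map_rho_one,
    map_rho_one] at h1

variable [IsAlgClosed k] [FiniteDimensional k V] [FiniteDimensional k W]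

theorem map_subtype_le_homs (F : Submodule k (homs σ (ρ.comp K.subtype))) :
    F.map (homs σ (ρ.comp K.subtype)).subtype ≤ homs σ (ρ.comp K.subtype) :=
  Submodule.map_subtype_le _ _

theorem finrank_multSpan (hσ : Irr σ) (F : Submodule k (homs σ (ρ.comp K.subtype))) :
    finrank k (multSpan F) = finrank k F * finrank k W := by
  rw [multSpan, finrank_spanOf hσ (map_subtype_le_homs F)]
  congr 1
  exact Submodule.finrank_map_subtype_eq _ _

theorem irr_multRep (hρ : Irr ρ) (hσ : Irr σ) (hE : spanOf (homs σ (ρ.comp K.subtype)) = ⊤)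
    (hπ : Function.Surjective π) : Irr (multRep ρ hτ) := by
  have := hρ.1
  have := hσ.1
  have hW : finrank k W ≠ 0 := finrank_pos.ne'
  have hbt : multSpan (⊤ : Submodule k (homs σ (ρ.comp K.subtype))) = ⊤ := by
    rw [multSpan, Submodule.map_top, Submodule.range_subtype, hE]
  refine ⟨?_, fun F hF => ?_⟩
  · rw [← not_subsingleton_iff_nontrivial]
    intro h
    have h1 := finrank_multSpan hσ (⊤ : Submodule k (homs σ (ρ.comp K.subtype)))
    rw [hbt, finrank_top, finrank_top,
      finrank_zero_of_subsingleton (M := homs σ (ρ.comp K.subtype)), zero_mul] at h1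
    exact finrank_pos.ne' h1
  · have hinv : InvSub ρ (multSpan F) := by
      intro g
      obtain ⟨h, rfl⟩ := hπ g
      have h1 := multSpan_map hτ F h
      rw [hF.map_eq] at h1
      intro v hv
      rw [← h1]
      exact ⟨v, hv, rfl⟩
    rcases hρ.2 _ hinv with h1 | h1
    · left
      have h2 := finrank_multSpan hσ F
      rw [h1, finrank_bot] at h2
      exact Submodule.finrank_eq_zero.mp ((mul_eq_zero.mp h2.symm).resolve_right hW)
    · right
      have h2 := finrank_multSpan hσ F
      rw [h1, ← hbt, finrank_multSpan hσ, finrank_top] at h2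
      exact Submodule.eq_top_of_finrank_eq (Nat.eq_of_mul_eq_mul_right (Nat.pos_of_ne_zero hW) h2.symm)

theorem multRep_scalar (hσ : Irr σ) {h : H} (hh : π h ∈ K) :
    ∃ c : k, ∀ f, multRep ρ hτ h f = c • f := by
  let x : K := ⟨π h, hh⟩
  obtain ⟨c, hc⟩ := hσ.schur (σ x ∘ₗ τ h⁻¹) (by
    intro y w
    rw [LinearMap.comp_apply, LinearMap.comp_apply, hτ, ← rho_mul_apply, ← rho_mul_apply]
    congr 2
    apply Subtype.ext
    rw [Subgroup.coe_mul, Subgroup.coe_mul, MulAut.conjNormal_apply, map_inv]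
    change π h * ((π h)⁻¹ * y * (π h)⁻¹⁻¹) = y * π h
    group)
  refine ⟨c, fun f => ?_⟩
  apply Subtype.ext
  ext w
  rw [multRep_apply]
  have h1 := f.2 x (τ h⁻¹ w)
  change _ = ρ (π h) _ at h1
  rw [← h1]
  change f.1 ((σ x ∘ₗ τ h⁻¹) w) = c • f.1 w
  rw [hc, map_smul]

theorem hasRegularBlocks_of_multRep {p : ℕ} (hp : p.Prime) (hσ : Irr σ)
    (hE : spanOf (homs σ (ρ.comp K.subtype)) = ⊤)
    (hπ : Function.Surjective π) (hW : ¬ p ∣ finrank k W)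
    (hB : HasRegularBlocks p (multRep ρ hτ)) : HasRegularBlocks p ρ := by
  obtain ⟨B, ⟨hBi, hBt⟩, hBp, hBd⟩ := hB
  have hsup : ∀ S : Set (Submodule k (homs σ (ρ.comp K.subtype))),
      multSpan (sSup S) = sSup (multSpan '' S) := by
    intro S
    rw [multSpan, map_sSup_submodule, spanOf_sSup, Set.image_image]
    rfl
  refine ⟨multSpan '' B, ⟨?_, ?_⟩, ?_, ?_⟩
  · rintro _ ⟨F, hF, rfl⟩
    refine Disjoint.mono_right (b := sSup (multSpan '' B \ {multSpan F})) ?_ (spanOf_disjoint hσ (map_subtype_le_homs F)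
      (map_subtype_le_homs (sSup (B \ {F}))) ?_)
    · change _ ≤ multSpan (sSup (B \ {F}))
      rw [hsup]
      refine sSup_le_sSup ?_
      rintro _ ⟨⟨F', hF', rfl⟩, h⟩
      exact ⟨F', ⟨hF', fun h' => h (by rw [Set.mem_singleton_iff] at h' ⊢; rw [h'])⟩, rfl⟩
    · exact Submodule.disjoint_map (Submodule.subtype_injective _) (hBi hF)
  · rw [← hsup, hBt, multSpan, Submodule.map_top, Submodule.range_subtype, hE]
  · rintro g _ ⟨F, hF, rfl⟩
    obtain ⟨h, rfl⟩ := hπ g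
    exact ⟨_, hBp h F hF, (multSpan_map hτ F h).symm⟩
  · rintro _ ⟨F, hF, rfl⟩
    rw [finrank_multSpan hσ, hp.dvd_mul]
    exact not_or.mpr ⟨hBd F hF, hW⟩

end

variable {p : ℕ} [hp : Fact p.Prime] {G : Type} [Group G] {K : Subgroup G} [hKn : K.Normal]
  {V : Type} [AddCommGroup V] [Module (KK p) V] [FiniteDimensional (KK p) V]
  {ρ : Representation (KK p) G V}
  {W : Type} [AddCommGroup W] [Module (KK p) W] [FiniteDimensional (KK p) W]
  {σ : Representation (KK p) K W}
  {H : Type} [Group H] {π : H →* G} {τ : Representation (KK p) H W}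

theorem hasLift_of_multRep
    (hτ : ∀ h (x : K) w, τ h (σ x w) = σ (MulAut.conjNormal (π h) x) (τ h w)) (hσ : Irr σ)
    (hE : spanOf (homs σ (ρ.comp K.subtype)) = ⊤)
    (hπ : Function.Surjective π) {n : ℕ} (hn : ¬ p ∣ n) (hker : ∀ h, π h = 1 → h ^ n = 1)
    (h1 : HasLift (multRep ρ hτ)) (h2 : HasLift τ) : HasLift ρ := by
  obtain ⟨J, _, bE, A, hA⟩ := h1
  obtain ⟨ι, _, b, B, hB⟩ := h2
  let e : spanOf (homs σ (ρ.comp K.subtype)) ≃ₗ[KK p] V := LinearEquiv.ofTop _ hE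
  let c : Basis (PairIdx J ι) (KK p) V :=
    ((spanBasis hσ le_rfl bE b).map e).reindex (pairIdxEquiv J ι).symm
  have hc : ∀ x : PairIdx J ι, c x = (bE x.1).1 (b x.2) := by
    intro x
    rw [Basis.reindex_apply, Basis.map_apply]
    exact spanBasis_apply hσ le_rfl bE b (x.1, x.2)
  rw [isLift_iff] at hA hB
  have hL : IsLift c (kronHom A B) (ρ.comp π) := by
    rw [isLift_iff]
    rintro h ⟨j, i⟩
    rw [hc]
    change ρ (π h) _ = _
    rw [rho_apply_hom hτ, hA, hB, sum_pairIdx, map_sum, Finset.sum_comm]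
    refine Finset.sum_congr rfl fun i' _ => ?_
    rw [Submodule.coe_sum, LinearMap.sum_apply]
    refine Finset.sum_congr rfl fun j' _ => ?_
    rw [hc, map_smul, Submodule.coe_smul, LinearMap.smul_apply, smul_smul]
    congr 1
    change _ = residue (VR p) (A h j' j * B h i' i)
    rw [map_mul, mul_comm]
  obtain ⟨D, hD⟩ := exists_descent hπ (kronHom A B) (by
    intro h hh
    refine matrix_eq_one_of_residue hn ?_ ?_
    · rw [hL h]
      change LinearMap.toMatrix c c (ρ (π h)) = 1
      rw [hh, map_one]
      exact LinearMap.toMatrix_one c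
    · rw [← map_pow, hker h hh, map_one])
  refine ⟨_, _, c, D, fun g => ?_⟩
  obtain ⟨h, rfl⟩ := hπ g
  rw [hD, hL h]
  rfl

end Homogeneous

section LiftsAndBlocks
open Module IsLocalRing

theorem Irr.of_equiv {k : Type} [Field k] {G V W : Type} [Group G] [AddCommGroup V] [Module k V]
    [AddCommGroup W] [Module k W] {ρ : Representation k G V} {σ : Representation k G W} (h : Irr ρ)
    (e : V ≃ₗ[k] W) (he : ∀ g v, e (ρ g v) = σ g (e v)) : Irr σ := by
  have := h.1
  refine ⟨e.symm.toEquiv.nontrivial, fun D hD => ?_⟩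
  have h1 : InvSub ρ (D.comap e.toLinearMap) := by
    intro g v hv
    change e (ρ g v) ∈ D
    rw [he]
    exact hD g _ hv
  have h3 : (D.comap e.toLinearMap).map e.toLinearMap = D :=
    Submodule.map_comap_eq_of_surjective e.surjective D
  rcases h.2 _ h1 with h2 | h2
  · left; rw [← h3, h2, Submodule.map_bot]
  · right; rw [← h3, h2, Submodule.map_top]; exact e.range

theorem Irr.of_comp {k : Type} [Field k] {G H V : Type} [Group G] [Group H] [AddCommGroup V] [Module k V]
    {ρ : Representation k G V} {f : H →* G} (h : Irr (ρ.comp f)) : Irr ρ :=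
  ⟨h.1, fun W hW => h.2 W fun g v hv => hW (f g) v hv⟩

theorem HasRegularBlocks.comp {k : Type} [Field k] {G H V : Type} [Group G] [Group H]
    [AddCommGroup V] [Module k V] {p : ℕ} {ρ : Representation k G V} (h : HasRegularBlocks p ρ)
    (f : H →* G) : HasRegularBlocks p (ρ.comp f) := by
  obtain ⟨B, h1, h2, h3⟩ := h
  exact ⟨B, h1, fun g => h2 (f g), h3⟩

variable {p : ℕ} [hp : Fact p.Prime]

theorem HasLift.comp {G H V : Type} [Group G] [Group H] [AddCommGroup V] [Module (KK p) V]
    {ρ : Representation (KK p) G V} (h : HasLift ρ) (f : H →* G) : HasLift (ρ.comp f) := by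
  obtain ⟨ι, _, b, A, hA⟩ := h
  exact ⟨ι, _, b, A.comp f, fun g => hA (f g)⟩

theorem IsLift.irr_redRep {G V ι : Type} [Group G] [Fintype ι] [AddCommGroup V] [Module (KK p) V]
    {b : Basis ι (KK p) V} {A : G →* Matrix ι ι (VR p)} {ρ : Representation (KK p) G V}
    (h : IsLift b A ρ) (hI : Irr ρ) : Irr (redRep A) := by
  refine hI.of_equiv b.equivFun fun g v => ?_
  rw [redRep_apply, h g]
  ext i
  rw [Matrix.toLin'_apply, Basis.equivFun_apply, Basis.equivFun_apply, LinearMap.toMatrix_mulVec_repr]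

theorem exists_maximal_normal (G : Type) [Group G] [Finite G] : ∃ K : Subgroup G, K.Normal ∧
    ¬ p ∣ Nat.card K ∧ ∀ L : Subgroup G, L.Normal → K < L → p ∣ Nat.card L := by
  obtain ⟨K, ⟨h1, h2⟩, h3⟩ := (wellFounded_gt (α := Subgroup G)).has_min
    {K | K.Normal ∧ ¬ p ∣ Nat.card K} ⟨⊥, inferInstance, by simpa using hp.out.one_lt.ne'⟩
  refine ⟨K, h1, h2, fun L hL hKL => ?_⟩
  by_contra h
  exact h3 L ⟨hL, h⟩ hKL

theorem PSolv.exists_pow_step {G : Type} [Group G] [Finite G] (hG : PSolv p G) {K : Subgroup G}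
    (hK : K.Normal) (hp' : ¬ p ∣ Nat.card K)
    (hmax : ∀ L : Subgroup G, L.Normal → K < L → p ∣ Nat.card L) (ht : K ≠ ⊤) :
    ∃ L : Subgroup G, L.Normal ∧ K < L ∧ PowStep (EPow p) K L := by
  obtain ⟨L, hL, hKL, h⟩ := hG G (MonoidHom.id G) Function.injective_id K hK ht
  refine ⟨L, hL, hKL, h.resolve_right fun h => ?_⟩
  obtain ⟨x, hx⟩ := exists_prime_orderOf_dvd_card' p (hmax L hL hKL)
  obtain ⟨q, hq, hxq⟩ := h x x.2
  apply hp'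
  have h1 : orderOf (x : G) = p := by rw [Subgroup.orderOf_coe, hx]
  have h2 : orderOf ((x : G) ^ q) = p := by
    rw [Nat.Coprime.orderOf_pow, h1]
    rw [h1]
    exact (Nat.Prime.coprime_iff_not_dvd hp.out).mpr hq
  have h3 := orderOf_dvd_natCard (⟨(x : G) ^ q, hxq⟩ : K)
  rwa [← Subgroup.orderOf_coe, h2] at h3

theorem exists_twist_matrix {G : Type} [Group G] {K : Subgroup G} [K.Normal] [Finite G]
    {V : Type} [AddCommGroup V] [Module (KK p) V] [FiniteDimensional (KK p) V]
    {ρ : Representation (KK p) G V} [Nontrivial V]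
    {W : Type} [AddCommGroup W] [Module (KK p) W] [FiniteDimensional (KK p) W]
    {σ : Representation (KK p) K W} (hσ : Irr σ) (hK : ¬ p ∣ Nat.card K)
    (hE : spanOf (homs σ (ρ.comp K.subtype)) = ⊤) {ι : Type} [Fintype ι] {b : Basis ι (KK p) W}
    {S : K →* Matrix ι ι (VR p)} (hS : IsLift b S σ) (g : G) :
    ∃ T : Matrix ι ι (KK p), T.det ≠ 0 ∧ ∀ x : K,
      T * (S x).map (residue (VR p)) = (S (MulAut.conjNormal g x)).map (residue (VR p)) * T := by
  have := Fintype.ofFinite K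
  obtain ⟨f, hf, hc⟩ := exists_twist hσ (natCast_card_ne_zero hK) hE inferInstance g
  refine ⟨LinearMap.toMatrix b b f, ?_, fun x => ?_⟩
  · rw [LinearMap.det_toMatrix]
    exact (LinearEquiv.isUnit_det' (LinearEquiv.ofInjectiveEndo f hf)).ne_zero
  · rw [hS, hS, ← LinearMap.toMatrix_comp, ← LinearMap.toMatrix_comp]
    congr 1
    exact LinearMap.ext (hc x)

theorem Irr.hasLift_and_hasRegularBlocks_aux (a m : ℕ)
    (ih : ∀ a' m', (a' < a ∨ a' = a ∧ m' < m) → ∀ (G : Type) [Group G] [Finite G], PSolv p G →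
      (Nat.card G).factorization p = a' → Nat.card G = m' →
      ∀ (V : Type) [AddCommGroup V] [Module (KK p) V] [FiniteDimensional (KK p) V]
        (ρ : Representation (KK p) G V), Irr ρ → HasLift ρ ∧ HasRegularBlocks p ρ)
    (G : Type) [Group G] [Finite G] (hG : PSolv p G)
    (ha : (Nat.card G).factorization p = a) (hm : Nat.card G = m)
    (V : Type) [AddCommGroup V] [Module (KK p) V] [FiniteDimensional (KK p) V]
    (ρ : Representation (KK p) G V) (hρ : Irr ρ) : HasLift ρ ∧ HasRegularBlocks p ρ := by
  have hFG := Fintype.ofFinite G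
  have := hρ.1
  obtain ⟨K, hK, hpK, hmax⟩ := exists_maximal_normal (p := p) G
  have hFK := Fintype.ofFinite K
  by_cases hKt : K = ⊤
  · have hpG : ¬ p ∣ Nat.card G := by rwa [hKt, Subgroup.card_top] at hpK
    refine ⟨hρ.hasLift_of_coprime hpG, {⊤}, ⟨sSupIndep_singleton _, sSup_singleton⟩, ?_, ?_⟩
    · rintro g _ rfl
      exact InvSub.map_eq (ρ := ρ) (W := ⊤) (fun _ _ _ => Submodule.mem_top) g
    · rintro _ rfl
      rw [finrank_top]
      exact hρ.not_dvd_finrank_of_coprime hpG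
  rcases hρ.clifford K with ⟨C, hC, hCt⟩ | ⟨U, hU0, hU1, hd⟩
  · have hσ := hC.irr
    have hE : spanOf (homs (subRep _ C hC.1) (ρ.comp K.subtype)) = ⊤ := hCt
    obtain ⟨ι, _, b, S, hS⟩ := hσ.hasLift_of_coprime hpK
    have hdim := hσ.not_dvd_finrank_of_coprime hpK
    have hι : ¬ p ∣ Fintype.card ι := by rwa [← finrank_eq_card_basis b]
    have hι0 : Fintype.card ι ≠ 0 := fun h => hι (h ▸ dvd_zero p)
    have hSI := hS.irr_redRep hσ
    have hπ := liftProj_surjective hpK hι0 (exists_twist_matrix hσ hpK hE hS)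
    have hfin := finite_liftGroup hSI
    let τ : Representation (KK p) (liftGroup S) C :=
      ((Matrix.toLinAlgEquiv b : Matrix ι ι (KK p) ≃ₐ[KK p] _).toAlgHom.toMonoidHom.comp
        ((residue (VR p)).mapMatrix.toMonoidHom)).comp (liftMat S)
    have hτL : IsLift b (liftMat S) τ := by
      intro g
      exact (LinearMap.toMatrix_toLin b b _).symm
    have hτ : ∀ h (x : K) w, τ h (subRep _ C hC.1 x w) =
        subRep _ C hC.1 (MulAut.conjNormal (liftProj S h) x) (τ h w) := by
      intro h x w
      have h1 : LinearMap.toMatrix b b (τ h ∘ₗ subRep _ C hC.1 x) =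
          LinearMap.toMatrix b b (subRep _ C hC.1 (MulAut.conjNormal (liftProj S h) x) ∘ₗ τ h) := by
        rw [LinearMap.toMatrix_comp b b b, LinearMap.toMatrix_comp b b b, ← hS, ← hS, ← hτL,
          ← Matrix.map_mul, ← Matrix.map_mul, liftMat_mul]
      exact LinearMap.congr_fun ((LinearMap.toMatrix b b).injective h1) w
    have hX := irr_multRep hτ hρ hσ hE hπ
    set X := multRep ρ hτ with hXdef
    obtain ⟨L, hL, hKL, hpow⟩ := hG.exists_pow_step hK hpK hmax hKt
    have hlt := factorization_quotient_ker_lt (p := p) hX (hK.comap (liftProj S))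
      (hL.comap (liftProj S)) ((Subgroup.comap_lt_comap_of_surjective hπ).mpr hKL)
      (hpow.comap (liftProj S)) (fun n hn => multRep_scalar hτ hσ hn)
    rw [factorization_liftGroup hSI hι hπ, ha] at hlt
    have hsolv : PSolv p (liftGroup S) := hG.of_ker (liftProj S) fun x hx =>
      ⟨_, hι, pow_eq_one_of_ker hSI x hx⟩
    let X' : Representation (KK p) (liftGroup S ⧸ X.ker) _ := QuotientGroup.lift X.ker X fun h hh => hh
    have hX' : X'.comp (QuotientGroup.mk' X.ker) = X := MonoidHom.ext fun h => rfl
    obtain ⟨h1, h2⟩ := ih _ _ (Or.inl hlt) (liftGroup S ⧸ X.ker)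
      (hsolv.of_surjective (QuotientGroup.mk' X.ker) (QuotientGroup.mk'_surjective _)) rfl rfl _ X'
      (Irr.of_comp (f := QuotientGroup.mk' X.ker) (by rw [hX']; exact hX))
    have h1' := h1.comp (QuotientGroup.mk' X.ker)
    have h2' := h2.comp (QuotientGroup.mk' X.ker)
    rw [hX'] at h1' h2'
    exact ⟨hasLift_of_multRep hτ hσ hE hπ hι (fun h hh => pow_eq_one_of_ker hSI h hh) h1'
      ⟨_, _, _, _, hτL⟩, hasRegularBlocks_of_multRep hτ hp.out hσ hE hπ hdim h2'⟩
  · have hst : stab ρ U ≠ ⊤ := by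
      intro h
      have hinv : InvSub ρ U := by
        intro g v hv
        have h1 : g ∈ stab ρ U := by rw [h]; trivial
        rw [mem_stab] at h1
        rw [← h1]
        exact ⟨v, hv, rfl⟩
      rcases hρ.2 U hinv with h1 | h1
      · exact hU0 h1
      · exact hU1 h1
    have hlt : Nat.card (stab ρ U) < m := by
      rw [← hm]
      refine lt_of_le_of_ne (Subgroup.card_le_card_group _) fun h => hst ?_
      exact Subgroup.eq_top_of_card_eq _ h
    have hle : (Nat.card (stab ρ U)).factorization p ≤ a := by
      rw [← ha]
      exact (Nat.factorization_le_iff_dvd Nat.card_pos.ne' Nat.card_pos.ne').mpr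
        (Subgroup.card_subgroup_dvd_card _) p
    obtain ⟨h1, h2⟩ := ih _ _ (hle.lt_or_eq.imp id fun h => ⟨h, hlt⟩) (stab ρ U)
      (hG.of_injective _ (stab ρ U).subtype_injective) rfl rfl U (stabRep ρ U)
      (irr_stabRep hρ hU0 hd)
    exact ⟨(HasLift.ind hd h1).1, hasRegularBlocks_of_stab hd h2⟩

theorem Irr.hasLift_and_hasRegularBlocks {G : Type} [Group G] [Finite G] (hG : PSolv p G)
    {V : Type} [AddCommGroup V] [Module (KK p) V] [FiniteDimensional (KK p) V]
    {ρ : Representation (KK p) G V} (hρ : Irr ρ) : HasLift ρ ∧ HasRegularBlocks p ρ := by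
  have key : ∀ a m : ℕ, ∀ (G : Type) [Group G] [Finite G], PSolv p G →
      (Nat.card G).factorization p = a → Nat.card G = m →
      ∀ (V : Type) [AddCommGroup V] [Module (KK p) V] [FiniteDimensional (KK p) V]
        (ρ : Representation (KK p) G V), Irr ρ → HasLift ρ ∧ HasRegularBlocks p ρ := by
    intro a
    induction a using Nat.strong_induction_on with
    | _ a iha =>
    intro m
    induction m using Nat.strong_induction_on with
    | _ m ihm =>
    refine Irr.hasLift_and_hasRegularBlocks_aux a m ?_
    rintro a' m' (h | ⟨rfl, h⟩)
    · exact iha a' h m'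
    · exact ihm m' h
  exact key _ _ G hG rfl rfl V ρ hρ

end LiftsAndBlocks

section Constituents

open Module IsLocalRing

theorem isPGroup_of_isPiNumber {p : ℕ} {G : Type} [Group G] [Finite G] (h : IsPiNumber ({p}ᶜᶜ) (Nat.card G)) : IsPGroup p G := by
  refine IsPGroup.of_card (n := (Nat.card G).primeFactorsList.length)
    (Nat.eq_prime_pow_of_unique_prime_dvd Nat.card_pos.ne' fun {q} hq hd => ?_)
  have := h q hq hd
  rwa [compl_compl] at this

variable {p : ℕ} [hp : Fact p.Prime] {G : Type} [Group G]

theorem isPiNumber_compl_singleton {n : ℕ} (h : ¬ p ∣ n) : IsPiNumber ({p}ᶜ) n := by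
  rintro q - hqn rfl
  exact h hqn

theorem IsPiNumber.not_dvd {n : ℕ} (h : IsPiNumber ({p}ᶜ) n) : ¬ p ∣ n := fun hd =>
  h p hp.out hd rfl

theorem isPartialChar_brChar_aux [Finite G] (hG : PSolv p G) (n : ℕ) :
    ∀ (V : Type) [AddCommGroup V] [Module (KK p) V] [FiniteDimensional (KK p) V] [Nontrivial V]
      (ρ : Representation (KK p) G V), finrank (KK p) V = n → IsPartialChar ({p}ᶜ) G (brChar ρ) := by
  induction n using Nat.strong_induction_on with
  | _ n ih =>
  intro V _ _ _ _ ρ hn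
  obtain ⟨C, -, hC⟩ := exists_irrSub ρ (W := ⊤) (fun _ _ _ => trivial) top_ne_bot
  have hI := hC.irr
  have := hI.1
  have h1 := (hI.hasLift_and_hasRegularBlocks hG).1.isPartialChar
  by_cases hCt : C = ⊤
  · have hρ : Irr ρ := ⟨inferInstance, fun D hD => by
      have := hC.2.2 D hD (hCt ▸ le_top)
      rwa [hCt] at this⟩
    exact (hρ.hasLift_and_hasRegularBlocks hG).1.isPartialChar
  · rw [brChar_sub_quo ρ C hC.1]
    have : Nontrivial (V ⧸ C) := Submodule.Quotient.nontrivial_iff.mpr hCt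
    refine h1.add (ih (finrank (KK p) (V ⧸ C)) ?_ (V ⧸ C) _ rfl)
    have h2 := C.finrank_quotient_add_finrank
    have h3 : 0 < finrank (KK p) C := finrank_pos
    omega

variable {V : Type} [AddCommGroup V] [Module (KK p) V] [FiniteDimensional (KK p) V]

/-- The Brauer character of a nonzero representation of a `p`-solvable group is the restriction of an
ordinary character. -/
theorem isPartialChar_brChar [Finite G] (hG : PSolv p G) [Nontrivial V]
    (ρ : Representation (KK p) G V) : IsPartialChar ({p}ᶜ) G (brChar ρ) :=
  isPartialChar_brChar_aux hG _ V ρ rfl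

theorem IsIPiChar.irr [Finite G] (hG : PSolv p G) [Nontrivial V] {ρ : Representation (KK p) G V}
    (h : IsIPiChar ({p}ᶜ) G (brChar ρ)) : Irr ρ := by
  refine ⟨inferInstance, fun W hW => ?_⟩
  by_contra! hcon
  have : Nontrivial W := Submodule.nontrivial_iff_ne_bot.mpr hcon.1
  have : Nontrivial (V ⧸ W) := Submodule.Quotient.nontrivial_iff.mpr hcon.2
  exact h.2 ⟨_, _, isPartialChar_brChar hG _, isPartialChar_brChar hG _, brChar_sub_quo ρ W hW⟩

theorem resChar_brChar (ρ : Representation (KK p) G V) (M : Subgroup G) :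
    resChar M (brChar ρ) = brChar (ρ.comp M.subtype) := by
  funext m
  have : IsPiElt ({p}ᶜ) (m : G) ↔ IsPiElt ({p}ᶜ) m := by
    rw [IsPiElt, IsPiElt, Subgroup.orderOf_coe]
  simp only [resChar, brChar, this]
  rfl

theorem isIPiConstituent_of_irrSub [Finite G] (hG : PSolv p G) (ρ : Representation (KK p) G V)
    {M : Subgroup G} {W : Submodule (KK p) V} (hW : IrrSub (ρ.comp M.subtype) W) :
    IsIPiConstituent ({p}ᶜ) M (brChar (subRep _ W hW.1)) (brChar ρ) := by
  have hM : PSolv p M := hG.of_injective M.subtype M.subtype_injective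
  refine ⟨(hW.irr.hasLift_and_hasRegularBlocks hM).1.isIPiChar hW.irr,
    brChar (quoRep _ W hW.1), ?_, ?_⟩
  · by_cases hWt : W = ⊤
    · left
      have hs : Subsingleton (V ⧸ W) := Submodule.Quotient.subsingleton_iff.mpr hWt
      funext m
      have h1 : (quoRep _ W hW.1 m).charpoly = 1 := by
        refine Polynomial.eq_one_of_monic_natDegree_zero (LinearMap.charpoly_monic _) ?_
        rw [LinearMap.charpoly_natDegree]
        exact finrank_zero_of_subsingleton
      simp only [brChar, h1]
      simp [brTr]
    · right
      have : Nontrivial (V ⧸ W) := Submodule.Quotient.nontrivial_iff.mpr hWt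
      exact isPartialChar_brChar hM _
  · rw [resChar_brChar, brChar_sub_quo _ W hW.1]

end Constituents

section InducedBlocks

open Module IsLocalRing

variable {G : Type} [Group G] {T : Subgroup G} {ι k : Type} [Field k]

/-- The vectors supported on the coordinates of one coset. -/
def cosetBlock (k : Type) [Field k] (ι : Type) (x : G ⧸ T) : Submodule k (IndIdx T ι → k) where
  carrier := {v | ∀ y, y.coset ≠ x → v y = 0}
  add_mem' := fun ha hb y hy => by simp [ha y hy, hb y hy]
  zero_mem' := fun _ _ => rfl
  smul_mem' := fun c v hv y hy => by simp [hv y hy]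

theorem single_mem_cosetBlock (z : IndIdx T ι) (c : k) : Pi.single z c ∈ cosetBlock k ι z.coset := by
  intro y hy
  exact Pi.single_eq_of_ne (fun h => hy (congrArg IndIdx.coset h)) _

theorem cosetBlock_injective [Nonempty ι] :
    Function.Injective (cosetBlock (T := T) k ι) := by
  intro x y hxy
  by_contra hne
  obtain ⟨i⟩ := ‹Nonempty ι›
  have h : (Pi.single ⟨x, i⟩ 1 : IndIdx T ι → k) ∈ cosetBlock k ι y := by
    rw [← hxy]; exact single_mem_cosetBlock ⟨x, i⟩ 1
  have := h ⟨x, i⟩ hne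
  rw [Pi.single_eq_same] at this
  exact one_ne_zero this

/-- Vectors in a block are the functions on the index set of the inducing representation. -/
def cosetBlockEquiv (x : G ⧸ T) : cosetBlock k ι x ≃ₗ[k] (ι → k) where
  toFun v i := v.1 ⟨x, i⟩
  map_add' _ _ := rfl
  map_smul' _ _ := rfl
  invFun w := ⟨fun y => if y.coset = x then w y.idx else 0, fun y hy => if_neg hy⟩
  left_inv v := by
    ext ⟨y, i⟩
    by_cases h : y = x
    · subst h; simp
    · simp [h, v.2 ⟨y, i⟩ h]
  right_inv w := by ext i; simp

theorem finrank_cosetBlock [Fintype ι] (x : G ⧸ T) : finrank k (cosetBlock k ι x) = Fintype.card ι := by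
  rw [(cosetBlockEquiv x).finrank_eq, finrank_fintype_fun_eq_card]

theorem dec_cosetBlock [Fintype ι] [Fintype (G ⧸ T)] : Dec (Set.range (cosetBlock (T := T) k ι)) := by
  constructor
  · rintro _ ⟨x, rfl⟩
    let E : Submodule k (IndIdx T ι → k) :=
      { carrier := {v | ∀ y, y.coset = x → v y = 0}
        add_mem' := fun ha hb y hy => by simp [ha y hy, hb y hy]
        zero_mem' := fun _ _ => rfl
        smul_mem' := fun c v hv y hy => by simp [hv y hy] }
    have hle : sSup (Set.range (cosetBlock (T := T) k ι) \ {cosetBlock k ι x}) ≤ E := by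
      apply sSup_le
      rintro _ ⟨⟨z, rfl⟩, hz⟩ v hv y hy
      refine hv y fun h => hz ?_
      rw [← h, hy]; rfl
    rw [Submodule.disjoint_def]
    intro v hv hv'
    ext y
    by_cases h : y.coset = x
    · exact hle hv' y h
    · exact hv y h
  · rw [eq_top_iff]
    intro v _
    have hv : v = ∑ z : IndIdx T ι, Pi.single z (v z) := (Finset.univ_sum_single v).symm
    rw [hv]
    exact Submodule.sum_mem _ fun z _ => (le_sSup (Set.mem_range_self z.coset) :
      cosetBlock k ι z.coset ≤ _) (single_mem_cosetBlock z (v z))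

variable {p : ℕ} [hp : Fact p.Prime] [Fintype ι] [Fintype (G ⧸ T)]

theorem cosetBlock_map (A : T →* Matrix ι ι (VR p)) (g : G) (x : G ⧸ T) :
    (cosetBlock (KK p) ι x).map (redRep (indHom A) g) = cosetBlock (KK p) ι (g • x) := by
  have key : ∀ (g : G) (x : G ⧸ T),
      (cosetBlock (KK p) ι x).map (redRep (indHom A) g) ≤ cosetBlock (KK p) ι (g • x) := by
    rintro g x _ ⟨v, hv, rfl⟩ z hz
    rw [redRep_apply, Matrix.toLin'_apply]
    refine Finset.sum_eq_zero fun y _ => ?_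
    by_cases hy : y.coset = x
    · have hm : ¬ z.coset.out⁻¹ * g * y.coset.out ∈ T := by
        rw [mul_assoc, out_inv_mul_mem_iff, hy]
        intro h
        apply hz
        rw [h]
        conv_rhs => rw [← QuotientGroup.out_eq' x]
        rfl
      have h0 : indHom A g z y = 0 := dif_neg hm
      change residue (VR p) (indHom A g z y) * v y = 0
      rw [h0, map_zero, zero_mul]
    · rw [hv y hy, mul_zero]
  refine le_antisymm (key g x) ?_
  have h := Submodule.map_mono (f := redRep (indHom A) g) (key g⁻¹ (g • x))
  rwa [map_map_rho, mul_inv_cancel, map_rho_one, inv_smul_smul] at h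

end InducedBlocks

section VertexOfConstituent

open Module IsLocalRing Pointwise

/-- A `p`-subgroup of `U` is conjugate in `U` into any subgroup of index prime to `p` that is a
`p`-group. -/
theorem IsPGroup.exists_conj_mem {p : ℕ} [Fact p.Prime] {G : Type} [Group G] [Finite G]
    {P Q : Subgroup G} (hP : IsPGroup p P) (hQ : IsPGroup p Q) (hi : ¬ p ∣ Q.index) :
    ∃ u : G, ∀ g ∈ P, u⁻¹ * g * u ∈ Q := by
  obtain ⟨S, hS⟩ := hP.exists_le_sylow
  obtain ⟨u, hu⟩ := MulAction.exists_smul_eq G (hQ.toSylow hi) S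
  refine ⟨u, fun g hg => ?_⟩
  have h1 : g ∈ (S : Subgroup G) := hS hg
  rw [← hu, Sylow.coe_subgroup_smul, Subgroup.mem_pointwise_smul_iff_inv_smul_mem,
    ← map_inv, MulAut.smul_def, MulAut.conj_apply, inv_inv] at h1
  exact h1

variable {p : ℕ} [hp : Fact p.Prime] {G : Type} [Group G] {V : Type} [AddCommGroup V]
  [Module (KK p) V] [FiniteDimensional (KK p) V]

/-- The representation restricted to a normal subgroup is a direct sum of irreducible
subrepresentations, each refined by a system of imprimitivity with block dimensions prime to `p`. -/
theorem Irr.exists_refined_blocks [Finite G] (hG : PSolv p G) {ρ : Representation (KK p) G V}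
    (hρ : Irr ρ) (M : Subgroup G) [M.Normal] :
    ∃ B : Set (Submodule (KK p) V), Dec B ∧ (∀ m : M, ∀ C ∈ B, C.map (ρ m) ∈ B) ∧
      ∀ C ∈ B, ∃ (W : Submodule (KK p) V) (hW : IrrSub (ρ.comp M.subtype) W)
        (D : Submodule (KK p) W), D.map W.subtype = C ∧ D ≠ ⊥ ∧
          Dec (orb (subRep _ W hW.1) D) ∧ ¬ p ∣ finrank (KK p) D := by
  have hM : PSolv p M := hG.of_injective M.subtype M.subtype_injective
  obtain ⟨Ω, hΩ, hirr⟩ := exists_dec_irrSub (ρ.comp M.subtype) (sSup_irrSub_eq_top hρ M)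
  have key : ∀ W ∈ Ω, ∃ F : Set (Submodule (KK p) V), (sSupIndep F ∧ sSup F = W) ∧
      (∀ m : M, ∀ C ∈ F, C.map (ρ m) ∈ F) ∧
      ∀ C ∈ F, ∃ (W : Submodule (KK p) V) (hW : IrrSub (ρ.comp M.subtype) W)
        (D : Submodule (KK p) W), D.map W.subtype = C ∧ D ≠ ⊥ ∧
          Dec (orb (subRep _ W hW.1) D) ∧ ¬ p ∣ finrank (KK p) D := by
    intro W hWΩ
    have hW := hirr W hWΩ
    have hI := hW.irr
    obtain ⟨B, hB, hperm, hdim⟩ := (hI.hasLift_and_hasRegularBlocks hM).2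
    refine ⟨Submodule.map W.subtype '' B, ⟨sSupIndep_image W.subtype_injective hB.1, ?_⟩, ?_, ?_⟩
    · rw [← map_sSup_submodule, hB.2, Submodule.map_top, Submodule.range_subtype]
    · rintro m _ ⟨D, hD, rfl⟩
      refine ⟨_, hperm m D hD, ?_⟩
      rw [← Submodule.map_comp, ← Submodule.map_comp]
      rfl
    · rintro _ ⟨D, hD, rfl⟩
      have hD0 : D ≠ ⊥ := by
        rintro rfl
        exact hdim _ hD (by simp)
      exact ⟨W, hW, D, rfl, hD0, hB.1.dec_orb hI hperm hD hD0, hdim D hD⟩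
  choose! F hF using key
  refine ⟨_, hΩ.refine F fun W hW => (hF W hW).1, ?_, ?_⟩
  · rintro m C ⟨W, hW, hC⟩
    exact ⟨W, hW, (hF W hW).2.1 m C hC⟩
  · rintro C ⟨W, hW, hC⟩
    exact (hF W hW).2.2 C hC

theorem isVertexSubgroup_of_stab [Fintype G] (hG : PSolv p G)
    {ρ : Representation (KK p) G V} (hρ : Irr ρ) {D : Submodule (KK p) V} (h0 : D ≠ ⊥)
    (hd : Dec (orb ρ D)) (hdim : ¬ p ∣ finrank (KK p) D) {R : Subgroup G} (hR : R ≤ stab ρ D)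
    (hRp : IsPiNumber ({p}ᶜᶜ) (Nat.card R)) (hi : ¬ p ∣ (R.subgroupOf (stab ρ D)).index) :
    IsVertexSubgroup ({p}ᶜ) (brChar ρ) R := by
  have hI := irr_stabRep hρ h0 hd
  have hl := (hI.hasLift_and_hasRegularBlocks
    (hG.of_injective (stab ρ D).subtype (stab ρ D).subtype_injective)).1
  exact ⟨stab ρ D, brChar (stabRep ρ D), hR, hRp, isPiNumber_compl_singleton hi, hl.isIPiChar hI,
    ⟨_, hl.brChar_one, isPiNumber_compl_singleton hdim⟩, (hl.ind hd).2.symm⟩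

end VertexOfConstituent

/-- **Theorem (Statement 4).** Let `p` be a prime and `G` a finite `p`-solvable group.
Let `φ ∈ IBr(G)` have vertex subgroup `Q` and let `M ⊴ G`.  Then some irreducible
constituent `θ` of `φ_M` has vertex `Q ⊓ M`. -/
theorem constituent_with_vertex_inter
    (p : ℕ) (hp : p.Prime)
    (G : Type) [Group G] [Fintype G] (hG : IsPSolvable p G)
    (φ : G → ℂ) (hφ : IsIBrChar p G φ)
    (Q : Subgroup G) (hQ : IsVertexSubgroup ({p}ᶜ) φ Q)
    (M : Subgroup G) (hM : M.Normal) :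
    ∃ θ : ↥M → ℂ, IsIPiConstituent ({p}ᶜ) M θ φ ∧
      IsVertexSubgroup ({p}ᶜ) θ ((Q ⊓ M).subgroupOf M) := by
  have : Fact p.Prime := ⟨hp⟩
  have hGs := hG.pSolv hp
  have hMs : PSolv p M := hGs.of_injective M.subtype M.subtype_injective
  obtain ⟨U, κ, hQU, hQp, hQi, ⟨⟨χ, hχ, -, rfl⟩, -⟩, ⟨n, hn, hnp⟩, rfl⟩ := hQ
  obtain ⟨ι, _, A, rfl⟩ := hχ.exists_latChar (p := p)
  have hcard : ¬ p ∣ Fintype.card ι := by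
    have h1 : piRestrict ({p}ᶜ) (latChar A) 1 = Fintype.card ι := by
      rw [piRestrict, if_pos isPiElt_one, latChar_one]
    rw [h1] at hn
    rw [Nat.cast_injective hn]
    exact hnp.not_dvd
  have hne : Nonempty ι := by
    by_contra h
    rw [not_nonempty_iff] at h
    exact hcard (by rw [Fintype.card_eq_zero]; exact dvd_zero p)
  have hφρ : indChar U (piRestrict ({p}ᶜ) (latChar A)) = brChar (redRep (indHom A)) := by
    rw [indChar_piRestrict, ← latChar_indHom, brChar_eq_of_isLift (isLift_redRep _)]
  have : Nonempty (IndIdx U ι) := ⟨⟨(1 : G), hne.some⟩⟩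
  rw [hφρ] at hφ ⊢
  have hρ := IsIPiChar.irr hGs hφ
  have hblk := cosetBlock_map A
  have hdec := dec_cosetBlock (k := KK p) (T := U) (ι := ι)
  have hfr := finrank_cosetBlock (k := KK p) (T := U) (ι := ι)
  have hinj := cosetBlock_injective (k := KK p) (T := U) (ι := ι)
  generalize redRep (indHom A) = ρ at hρ hblk ⊢
  have hpermA : ∀ g, ∀ C ∈ Set.range (cosetBlock (T := U) (KK p) ι),
      C.map (ρ g) ∈ Set.range (cosetBlock (T := U) (KK p) ι) := by
    rintro g _ ⟨x, rfl⟩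
    exact ⟨_, (hblk g x).symm⟩
  obtain ⟨B, hB, hpermB, hBC⟩ := hρ.exists_refined_blocks hGs M
  have hQP : IsPGroup p Q := isPGroup_of_isPiNumber hQp
  have hQM : IsPGroup p (Q ⊓ M : Subgroup G) := hQP.to_le inf_le_left
  obtain ⟨C, hC, hCfix⟩ := exists_fixed_member hQM (ρ.comp (Q ⊓ M).subtype) hdec hB
    (fun g => hpermA g) (fun g C hC => hpermB ⟨g, g.2.2⟩ C hC)
    (Set.mem_range_self ((1 : G) : G ⧸ U)) (fun g => by
      refine (hblk g _).trans (congrArg _ ?_)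
      exact QuotientGroup.eq.mpr (by simpa using hQU g.2.1))
    (by rwa [hfr])
  obtain ⟨W, hW, D, rfl, hD0, hDd, hDdim⟩ := hBC C hC
  refine ⟨_, isIPiConstituent_of_irrSub hGs ρ hW, ?_⟩
  set ω := subRep _ W hW.1
  have hmem : ∀ m : M, m ∈ stab ω D ↔ (D.map W.subtype).map (ρ m) = D.map W.subtype := by
    intro m
    rw [mem_stab, ← (Submodule.map_injective_of_injective W.subtype_injective).eq_iff,
      ← Submodule.map_comp, ← Submodule.map_comp]
    rfl
  have hR : (Q ⊓ M).subgroupOf M ≤ stab ω D := fun m hm => (hmem m).mpr (hCfix ⟨m, hm⟩)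
  have hRcard : Nat.card ((Q ⊓ M).subgroupOf M) = Nat.card (Q ⊓ M : Subgroup G) :=
    Nat.card_congr (Subgroup.subgroupOfEquivOfLe inf_le_right).toEquiv
  refine isVertexSubgroup_of_stab hMs hW.irr hD0 hDd hDdim hR ?_ ?_
  · intro q hq hd
    refine hQp q hq (hd.trans ?_)
    rw [hRcard]
    exact Subgroup.card_dvd_of_le inf_le_left
  have hRp : IsPGroup p ((Q ⊓ M).subgroupOf M) := hQM.comap_subtype
  obtain ⟨P, hP⟩ := (hRp.comap_subtype (K := stab ω D)).exists_le_sylow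
  let f : P →* G := M.subtype.comp ((stab ω D).subtype.comp (P : Subgroup (stab ω D)).subtype)
  have hf : Function.Injective f := M.subtype_injective.comp
    ((stab ω D).subtype_injective.comp (Subgroup.subtype_injective _))
  obtain ⟨_, ⟨x, rfl⟩, hx⟩ := exists_fixed_member P.2 (ρ.comp f) hB hdec
    (fun g C hC => hpermB g.1.1 C hC) (fun g => hpermA (f g)) hC (fun g => (hmem g.1.1).mp g.1.2)
    (by rwa [← (Submodule.equivMapOfInjective W.subtype W.subtype_injective D).finrank_eq])
  have hxU : ∀ g : P, x.out⁻¹ * f g * x.out ∈ U := by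
    intro g
    have h1 : f g • x = x := hinj ((hblk (f g) x).symm.trans (hx g))
    rw [mul_assoc, out_inv_mul_mem_iff]
    conv_lhs => rw [← h1, ← QuotientGroup.out_eq' x]
    rfl
  let f' : P →* U :=
    ((MulAut.conj x.out⁻¹).toMonoidHom.comp f).codRestrict U fun g => by
      simpa using hxU g
  have hf' : Function.Injective f' := fun a b hab =>
    hf ((MulAut.conj x.out⁻¹).injective (congrArg Subtype.val hab))
  obtain ⟨u, hu⟩ := IsPGroup.exists_conj_mem (P := f'.range) (Q := Q.subgroupOf U)
    (P.2.of_surjective f'.rangeRestrict f'.rangeRestrict_surjective) hQP.comap_subtype hQi.not_dvd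
  have hle : Nat.card P ≤ Nat.card (Q ⊓ M : Subgroup G) := by
    refine Nat.card_le_card_of_injective
      (fun g => ⟨(MulAut.conj (u : G)⁻¹ (MulAut.conj x.out⁻¹ (f g)) : G), ?_, ?_⟩) ?_
    · have := hu (f' g) ⟨g, rfl⟩
      rw [Subgroup.mem_subgroupOf] at this
      simpa [f'] using this
    · exact hM.conj_mem _ (hM.conj_mem _ g.1.1.2 _) _
    · intro a b hab
      exact hf ((MulAut.conj x.out⁻¹).injective ((MulAut.conj (u : G)⁻¹).injective
        (congrArg Subtype.val hab)))
  have hPR : ((Q ⊓ M).subgroupOf M).subgroupOf (stab ω D) = P := by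
    refine Subgroup.eq_of_le_of_card_ge hP (hle.trans_eq ?_)
    rw [← hRcard]
    exact (Nat.card_congr (Subgroup.subgroupOfEquivOfLe hR).toEquiv).symm
  rw [hPR]
  exact P.not_dvd_index
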